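/- There exist absolute constants C > 0 and c > 0 such that for every integer n ≥ 1 and every real x ≥ 1, if H is an n×n GUE random matrix with eigenvalues λ₁, …, λₙ ordered by absolute value, |λ₁| ≥ … ≥ |λₙ|, then Prob{ log|λ₁| − log|λ₂| < 1/x } ≤ C·n^{2/3}/x + C·n⁴/x³ + C·e^{−cn}. -/

import Mathlib

open MeasureTheory ProbabilityTheory Matrix

noncomputable instance matrixMeasurableSpace {m n α : Type*} [MeasurableSpace α] :
    MeasurableSpace (Matrix m n α) := MeasurableSpace.pi

/-- The standard complex Gaussian measure on `ℂ` (independent standard Gaussian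
real and imaginary parts). -/
noncomputable def complexGaussian : Measure ℂ :=
  ((gaussianReal 0 1).prod (gaussianReal 0 1)).map (fun p => Complex.mk p.1 p.2)

/-- The law of an `n × n` matrix with i.i.d. standard complex Gaussian entries. -/
noncomputable def matrixGaussian (n : ℕ) : Measure (Matrix (Fin n) (Fin n) ℂ) :=
  Measure.pi fun _ : Fin n => Measure.pi fun _ : Fin n => complexGaussian

/-- The Gaussian Unitary Ensemble: the law of `H = (G + G*)/2` for `G` complex Gaussian. -/
noncomputable def GUE (n : ℕ) : Measure (Matrix (Fin n) (Fin n) ℂ) :=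
  (matrixGaussian n).map (fun G => (1 / 2 : ℂ) • (G + Gᴴ))

/-- The eigenvalues of a Hermitian matrix, sorted in increasing order
(junk value `0` if the matrix is not Hermitian). -/
noncomputable def sortedEigs {n : ℕ} (H : Matrix (Fin n) (Fin n) ℂ) : Fin n → ℝ :=
  if h : H.IsHermitian then h.eigenvalues ∘ (Tuple.sort h.eigenvalues) else 0

/-- The eigenvalues of a Hermitian matrix, sorted by absolute value in decreasing order,
`|λ₁| ≥ |λ₂| ≥ … ≥ |λₙ|` (junk value `0` if the matrix is not Hermitian);
`absSortedEigs H j` is the eigenvalue of `(j+1)`-largest absolute value. -/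
noncomputable def absSortedEigs {n : ℕ} (H : Matrix (Fin n) (Fin n) ℂ) : Fin n → ℝ :=
  if h : H.IsHermitian then
    fun j => h.eigenvalues ((Tuple.sort fun i => |h.eigenvalues i|) j.rev)
  else 0

namespace GUEGap

/-! ### Coordinates on Hermitian matrices -/

/-- The real coordinate space of Hermitian `m × m` matrices. -/
abbrev HC (m : ℕ) := Fin m → Fin m → ℝ

/-- The Hermitian matrix with given real coordinates. -/
noncomputable def herm {m : ℕ} (X : HC m) : Matrix (Fin m) (Fin m) ℂ := fun i j =>
  if i = j then (X i i : ℂ) else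
    if j < i then (X j i : ℂ) + (X i j : ℂ) * Complex.I
    else (X i j : ℂ) - (X j i : ℂ) * Complex.I

/-- Coordinates of a matrix. -/
noncomputable def coord {m : ℕ} (H : Matrix (Fin m) (Fin m) ℂ) : HC m := fun i j =>
  if j < i then (H i j).im else (H i j).re

lemma herm_isHermitian {m : ℕ} (X : HC m) : (herm X).IsHermitian := by
  ext i j
  simp only [herm, conjTranspose_apply]
  rcases lt_trichotomy i j with h | h | h
  · simp [h, h.ne, h.ne', h.not_gt, Complex.ext_iff]
  · subst h; simp
  · simp [h, h.ne, h.ne', h.not_gt, Complex.ext_iff]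

lemma coord_herm {m : ℕ} (X : HC m) : coord (herm X) = X := by
  ext i j
  simp only [herm, coord]
  rcases lt_trichotomy i j with h | h | h
  · simp [h.ne, h.not_gt]
  · subst h; simp
  · simp [h, h.ne']

lemma herm_coord {m : ℕ} {H : Matrix (Fin m) (Fin m) ℂ} (hH : H.IsHermitian) :
    herm (coord H) = H := by
  ext i j
  have h1 := hH.apply i j
  have h2 := hH.apply i i
  rw [Complex.ext_iff] at h1 h2
  simp at h1 h2
  simp only [herm, coord]
  rcases lt_trichotomy i j with h | h | h
  · simp [h, h.ne, h.not_gt, Complex.ext_iff, h1]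
  · subst h; simp [Complex.ext_iff]; linarith
  · simp [h, h.ne', h.not_gt, Complex.ext_iff, h1]

lemma herm_add {m : ℕ} (X Y : HC m) : herm (X + Y) = herm X + herm Y := by
  ext i j
  simp only [herm, Matrix.add_apply, Pi.add_apply]
  split_ifs <;> push_cast <;> ring

lemma herm_smul {m : ℕ} (c : ℝ) (X : HC m) : herm (c • X) = (c : ℂ) • herm X := by
  ext i j
  simp only [herm, Matrix.smul_apply, Pi.smul_apply, smul_eq_mul]
  split_ifs <;> push_cast <;> ring

lemma coord_add {m : ℕ} (X Y : Matrix (Fin m) (Fin m) ℂ) : coord (X + Y) = coord X + coord Y := by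
  ext i j
  simp only [coord, Matrix.add_apply, Pi.add_apply]
  split_ifs <;> simp

lemma coord_smul {m : ℕ} (c : ℝ) (X : Matrix (Fin m) (Fin m) ℂ) :
    coord ((c : ℂ) • X) = c • coord X := by
  ext i j
  simp only [coord, Matrix.smul_apply, Pi.smul_apply, smul_eq_mul]
  split_ifs <;> simp

lemma herm_sub {m : ℕ} (X Y : HC m) : herm (X - Y) = herm X - herm Y := by
  ext i j
  simp only [herm, Matrix.sub_apply, Pi.sub_apply]
  split_ifs <;> push_cast <;> ring

lemma continuous_herm {m : ℕ} : Continuous (herm (m := m)) := by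
  refine continuous_pi fun i => continuous_pi fun j => ?_
  simp only [herm]
  split_ifs <;> fun_prop

lemma measurable_herm {m : ℕ} : Measurable (herm (m := m)) := by
  refine measurable_pi_lambda _ fun i => measurable_pi_lambda _ fun j => ?_
  simp only [herm]
  split_ifs <;> fun_prop

/-! ### Bordered matrices -/

/-- Block matrix with a distinguished zeroth coordinate. -/
def blk {m : ℕ} (a : ℂ) (r c : Fin m → ℂ) (D : Matrix (Fin m) (Fin m) ℂ) :
    Matrix (Fin (m + 1)) (Fin (m + 1)) ℂ :=
  fun i j => Fin.cases (Fin.cases a (fun j => r j) j)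
    (fun i => Fin.cases (c i) (fun j => D i j) j) i

@[simp] lemma blk_zero_zero {m : ℕ} (a : ℂ) (r c : Fin m → ℂ) (D : Matrix (Fin m) (Fin m) ℂ) :
    blk a r c D 0 0 = a := rfl
@[simp] lemma blk_zero_succ {m : ℕ} (a : ℂ) (r c : Fin m → ℂ) (D : Matrix (Fin m) (Fin m) ℂ)
    (j : Fin m) : blk a r c D 0 j.succ = r j := rfl
@[simp] lemma blk_succ_zero {m : ℕ} (a : ℂ) (r c : Fin m → ℂ) (D : Matrix (Fin m) (Fin m) ℂ)
    (i : Fin m) : blk a r c D i.succ 0 = c i := rfl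
@[simp] lemma blk_succ_succ {m : ℕ} (a : ℂ) (r c : Fin m → ℂ) (D : Matrix (Fin m) (Fin m) ℂ)
    (i j : Fin m) : blk a r c D i.succ j.succ = D i j := rfl

lemma blk_mul {m : ℕ} (a a' : ℂ) (r c r' c' : Fin m → ℂ) (D D' : Matrix (Fin m) (Fin m) ℂ) :
    blk a r c D * blk a' r' c' D' =
      blk (a * a' + r ⬝ᵥ c') (a • r' + r ᵥ* D') (a' • c + D *ᵥ c') (vecMulVec c r' + D * D') := by
  ext i j
  refine Fin.cases ?_ (fun i => ?_) i <;> refine Fin.cases ?_ (fun j => ?_) j <;>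
    simp [Matrix.mul_apply, Fin.sum_univ_succ, dotProduct, vecMul, mulVec, vecMulVec, mul_comm]

lemma blk_conjTranspose {m : ℕ} (a : ℂ) (r c : Fin m → ℂ) (D : Matrix (Fin m) (Fin m) ℂ) :
    (blk a r c D)ᴴ = blk (star a) (star c) (star r) Dᴴ := by
  ext i j
  refine Fin.cases ?_ (fun i => ?_) i <;> refine Fin.cases ?_ (fun j => ?_) j <;>
    simp [conjTranspose_apply]

lemma blk_one {m : ℕ} : blk 1 0 0 (1 : Matrix (Fin m) (Fin m) ℂ) = 1 := by
  ext i j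
  refine Fin.cases ?_ (fun i => ?_) i <;> refine Fin.cases ?_ (fun j => ?_) j <;>
    simp [Matrix.one_apply, Fin.succ_ne_zero, (Fin.succ_ne_zero _).symm]

/-- Hermitian bordered matrix. -/
def hblk {m : ℕ} (h : ℝ) (w : Fin m → ℂ) (D : Matrix (Fin m) (Fin m) ℂ) :
    Matrix (Fin (m + 1)) (Fin (m + 1)) ℂ := blk (h : ℂ) (star w) w D

/-- Block diagonal matrix `diag(u, B)`. -/
def bd {m : ℕ} (u : ℝ) (D : Matrix (Fin m) (Fin m) ℂ) :
    Matrix (Fin (m + 1)) (Fin (m + 1)) ℂ := blk (u : ℂ) 0 0 D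

/-- The coordinates of a bordered matrix. -/
def joinC {m : ℕ} (p : ℝ × (Fin m → ℂ) × HC m) : HC (m + 1) :=
  fun i j => Fin.cases (Fin.cases p.1 (fun j => (p.2.1 j).re) j)
    (fun i => Fin.cases (p.2.1 i).im (fun j => p.2.2 i j) j) i

lemma herm_joinC {m : ℕ} (p : ℝ × (Fin m → ℂ) × HC m) :
    herm (joinC p) = hblk p.1 p.2.1 (herm p.2.2) := by
  ext i j
  refine Fin.cases ?_ (fun i => ?_) i <;> refine Fin.cases ?_ (fun j => ?_) j
  · simp [herm, joinC, hblk]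
  · simp [herm, joinC, hblk, (Fin.succ_ne_zero _).symm, Complex.ext_iff]
  · simp [herm, joinC, hblk, Fin.succ_ne_zero, Complex.ext_iff]
  · simp [herm, joinC, hblk]

lemma mp_congr_fun {α β : Type*} [MeasurableSpace α] [MeasurableSpace β] {μ : Measure α}
    {ν : Measure β} {f g : α → β} (h : MeasurePreserving f μ ν) (hg : g = f) :
    MeasurePreserving g μ ν := hg ▸ h

lemma joinC_measurePreserving (m : ℕ) :
    MeasurePreserving (joinC (m := m)) volume volume := by
  -- build the inverse as a composition of measurable equivalences
  have e1 := (volume_preserving_piFinSuccAbove (fun _ : Fin (m + 1) => (Fin (m + 1) → ℝ)) 0).symm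
  have e2 := (volume_preserving_piFinSuccAbove (fun _ : Fin (m + 1) => ℝ) 0).symm
  have e3 : MeasurePreserving _ (volume : Measure ((Fin m → ℝ × (Fin m → ℝ)))) volume :=
    volume_preserving_pi (fun _ : Fin m => e2)
  have e4 := (volume_measurePreserving_arrowProdEquivProdArrow ℝ (Fin m → ℝ) (Fin m)).symm
  have e5 := volume_measurePreserving_arrowProdEquivProdArrow ℝ ℝ (Fin m)
  have e6 : MeasurePreserving _ (volume : Measure (Fin m → ℂ)) volume :=
    volume_preserving_pi (fun _ : Fin m => Complex.volume_preserving_equiv_real_prod)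
  have e7 := e5.comp e6
  have e8 : MeasurePreserving (fun q : (ℝ × (Fin m → ℝ)) × ((Fin m → ℝ) × HC m) => joinC
    (q.1.1, fun i => ⟨q.1.2 i, q.2.1 i⟩, q.2.2)) volume volume := by
    have := (e1.comp (e2.prod (e3.comp e4)))
    refine mp_congr_fun (show MeasurePreserving _ volume volume from this) ?_
    funext q i j
    refine Fin.cases ?_ (fun i => ?_) i <;> refine Fin.cases ?_ (fun j => ?_) j <;> rfl
  have e9 : MeasurePreserving (fun p : ℝ × (Fin m → ℂ) × HC m =>
      (((p.1, fun i => (p.2.1 i).re), ((fun i => (p.2.1 i).im), p.2.2)) :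
        (ℝ × (Fin m → ℝ)) × ((Fin m → ℝ) × HC m))) volume volume := by
    have a1 : MeasurePreserving (fun p : ℝ × (Fin m → ℂ) × HC m =>
      ((p.1, (((fun i => (p.2.1 i).re), (fun i => (p.2.1 i).im)), p.2.2)) :
        ℝ × ((Fin m → ℝ) × (Fin m → ℝ)) × HC m)) volume volume :=
      (MeasurePreserving.id volume).prod (e7.prod (MeasurePreserving.id volume))
    have a2 : MeasurePreserving (fun p : ℝ × ((Fin m → ℝ) × (Fin m → ℝ)) × HC m =>
      (p.1, (p.2.1.1, (p.2.1.2, p.2.2)))) volume volume :=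
      (MeasurePreserving.id volume).prod (measurePreserving_prodAssoc volume volume volume)
    have a3 : MeasurePreserving (fun p : ℝ × (Fin m → ℝ) × (Fin m → ℝ) × HC m =>
      ((p.1, p.2.1), p.2.2)) volume volume :=
      (measurePreserving_prodAssoc volume volume volume).symm
    exact a3.comp (a2.comp a1)
  exact e8.comp e9

end GUEGap

namespace GUEGap

/-- Unitarily invariant functions. -/
def UInv {n : ℕ} {β : Type*} (Ψ : Matrix (Fin n) (Fin n) ℂ → β) : Prop :=
  ∀ U H : Matrix (Fin n) (Fin n) ℂ, U * Uᴴ = 1 → Ψ (U * H * Uᴴ) = Ψ H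

/-- squared norm of a complex vector -/
noncomputable def nsq {m : ℕ} (z : Fin m → ℂ) : ℝ := ∑ i, ‖z i‖ ^ 2

lemma nsq_nonneg {m : ℕ} (z : Fin m → ℂ) : 0 ≤ nsq z := by unfold nsq; positivity

lemma star_dot_self {m : ℕ} (z : Fin m → ℂ) : star z ⬝ᵥ z = (nsq z : ℂ) := by
  simp [dotProduct, nsq, Complex.conj_mul']

noncomputable def sz {m : ℕ} (z : Fin m → ℂ) : ℝ := Real.sqrt (1 + nsq z)

lemma sz_sq {m : ℕ} (z : Fin m → ℂ) : sz z ^ 2 = 1 + nsq z :=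
  Real.sq_sqrt (by have := nsq_nonneg z; linarith)

lemma sz_pos {m : ℕ} (z : Fin m → ℂ) : 0 < sz z :=
  Real.sqrt_pos.2 (by have := nsq_nonneg z; linarith)

noncomputable def pz {m : ℕ} (z : Fin m → ℂ) : Matrix (Fin m) (Fin m) ℂ := vecMulVec z (star z)

noncomputable def Lz {m : ℕ} (z : Fin m → ℂ) : Matrix (Fin m) (Fin m) ℂ :=
  1 + (((1 / (sz z + 1) : ℝ)) : ℂ) • pz z

noncomputable def Liz {m : ℕ} (z : Fin m → ℂ) : Matrix (Fin m) (Fin m) ℂ :=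
  1 - (((1 / (sz z * (sz z + 1)) : ℝ)) : ℂ) • pz z

lemma pz_mul {m : ℕ} (z : Fin m → ℂ) : pz z * pz z = ((sz z ^ 2 - 1 : ℝ) : ℂ) • pz z := by
  rw [sz_sq]
  simp [pz, vecMulVec_mul_vecMulVec, star_dot_self, vecMulVec_smul]

lemma pz_conj {m : ℕ} (z : Fin m → ℂ) : (pz z)ᴴ = pz z := by
  simp [pz, conjTranspose_vecMulVec]

lemma pz_mulVec {m : ℕ} (z : Fin m → ℂ) : pz z *ᵥ z = ((sz z ^ 2 - 1 : ℝ) : ℂ) • z := by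
  rw [sz_sq]
  simp [pz, vecMulVec_mulVec, star_dot_self]

lemma vecMul_pz {m : ℕ} (z : Fin m → ℂ) : star z ᵥ* pz z = ((sz z ^ 2 - 1 : ℝ) : ℂ) • star z := by
  rw [sz_sq]
  simp [pz, vecMul_vecMulVec, star_dot_self]

lemma Lz_conj {m : ℕ} (z : Fin m → ℂ) : (Lz z)ᴴ = Lz z := by
  simp [Lz, conjTranspose_add, conjTranspose_smul, pz_conj]

lemma Liz_conj {m : ℕ} (z : Fin m → ℂ) : (Liz z)ᴴ = Liz z := by
  simp [Liz, conjTranspose_sub, conjTranspose_smul, pz_conj]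

lemma Lz_mulVec {m : ℕ} (z : Fin m → ℂ) : Lz z *ᵥ z = (sz z : ℂ) • z := by
  have h := sz_pos z
  rw [Lz, add_mulVec, smul_mulVec, pz_mulVec, one_mulVec, smul_smul]
  rw [← one_smul ℂ z, smul_smul, ← add_smul, one_smul]
  congr 1
  rw [← Complex.ofReal_mul]
  norm_cast
  field_simp
  ring

lemma sz_ne {m : ℕ} (z : Fin m → ℂ) : (sz z : ℂ) ≠ 0 := by
  exact_mod_cast (sz_pos z).ne'

lemma sz_ne' {m : ℕ} (z : Fin m → ℂ) : (sz z : ℂ) + 1 ≠ 0 := by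
  have := sz_pos z
  exact_mod_cast (by linarith : 0 < sz z + 1).ne'

lemma Lz_mul_Liz {m : ℕ} (z : Fin m → ℂ) : Lz z * Liz z = 1 := by
  have h1 := sz_ne z
  have h2 := sz_ne' z
  rw [Lz, Liz, add_mul, one_mul, mul_sub, mul_one, smul_mul_smul_comm, pz_mul, smul_smul]
  push_cast
  match_scalars
  · ring
  · field_simp
    ring

lemma Liz_mul_Lz {m : ℕ} (z : Fin m → ℂ) : Liz z * Lz z = 1 :=
  mul_eq_one_comm.1 (Lz_mul_Liz z)

lemma Liz_mulVec {m : ℕ} (z : Fin m → ℂ) : Liz z *ᵥ z = (sz z : ℂ)⁻¹ • z := by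
  have h1 := sz_ne z
  have : Liz z *ᵥ (Lz z *ᵥ z) = z := by rw [mulVec_mulVec, Liz_mul_Lz, one_mulVec]
  rw [Lz_mulVec, mulVec_smul] at this
  rw [eq_inv_smul_iff₀ h1, this]

lemma star_vecMul_of_conj {m : ℕ} {A : Matrix (Fin m) (Fin m) ℂ} (hA : Aᴴ = A) (z : Fin m → ℂ) :
    star z ᵥ* A = star (A *ᵥ z) := by
  rw [star_mulVec, hA]

lemma Liz_sq {m : ℕ} (z : Fin m → ℂ) :
    ((sz z : ℂ) ^ 2)⁻¹ • pz z + Liz z * Liz z = 1 := by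
  have h1 := sz_ne z
  have h2 := sz_ne' z
  rw [Liz, sub_mul, one_mul, mul_sub, mul_one, smul_mul_smul_comm, pz_mul, smul_smul]
  push_cast
  match_scalars
  · field_simp
    ring
  · ring

/-- The unitary matrix realizing the deflation. -/
noncomputable def Vz {m : ℕ} (z : Fin m → ℂ) : Matrix (Fin (m + 1)) (Fin (m + 1)) ℂ :=
  blk ((sz z : ℂ)⁻¹) (-((sz z : ℂ)⁻¹ • star z)) ((sz z : ℂ)⁻¹ • z) (Liz z)

lemma Vz_conj {m : ℕ} (z : Fin m → ℂ) : (Vz z)ᴴ =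
    blk ((sz z : ℂ)⁻¹) ((sz z : ℂ)⁻¹ • star z) (-((sz z : ℂ)⁻¹ • z)) (Liz z) := by
  rw [Vz, blk_conjTranspose, Liz_conj]
  simp

lemma Vz_unitary {m : ℕ} (z : Fin m → ℂ) : Vz z * (Vz z)ᴴ = 1 := by
  have h1 := sz_ne z
  rw [Vz_conj, Vz, blk_mul, ← blk_one]
  congr 1
  · simp only [neg_dotProduct, dotProduct_neg, neg_neg, smul_dotProduct, dotProduct_smul,
      star_dot_self, smul_eq_mul]
    have : (nsq z : ℂ) = (sz z : ℂ) ^ 2 - 1 := by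
      have := sz_sq z
      rw [eq_sub_iff_add_eq]; norm_cast; linarith
    rw [this]
    field_simp
    ring
  · rw [neg_vecMul, smul_vecMul, star_vecMul_of_conj (Liz_conj z), Liz_mulVec]
    simp
  · rw [mulVec_neg, mulVec_smul, Liz_mulVec]
    simp
  · rw [vecMulVec_smul, smul_vecMulVec, smul_smul, ← Liz_sq z, pz]
    congr 2
    field_simp

lemma Vz_mul {m : ℕ} (z : Fin m → ℂ) (N : Matrix (Fin m) (Fin m) ℂ) (hN : N.IsHermitian) :
    Vz z * blk 0 0 0 (Lz z * N * Lz z) * (Vz z)ᴴ =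
      blk (star z ⬝ᵥ (N *ᵥ z)) (-star (N *ᵥ z)) (-(N *ᵥ z)) N := by
  have h1 := sz_ne z
  have e1 : Liz z * (Lz z * N * Lz z) * Liz z = N := by
    calc _ = (Liz z * Lz z) * N * (Lz z * Liz z) := by simp only [Matrix.mul_assoc]
      _ = N := by rw [Liz_mul_Lz, Lz_mul_Liz, one_mul, mul_one]
  have e2 : (Lz z * N * Lz z) *ᵥ z = (sz z : ℂ) • (Lz z *ᵥ (N *ᵥ z)) := by
    rw [← mulVec_mulVec, Lz_mulVec, mulVec_smul, mulVec_mulVec]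
  have hK : (Lz z * N * Lz z)ᴴ = Lz z * N * Lz z := by
    rw [conjTranspose_mul, conjTranspose_mul, Lz_conj, hN.eq, Matrix.mul_assoc]
  have e3 : Liz z *ᵥ (Lz z *ᵥ (N *ᵥ z)) = N *ᵥ z := by
    rw [mulVec_mulVec, Liz_mul_Lz, one_mulVec]
  have e4 : star z ᵥ* (Lz z * N * Lz z) = (sz z : ℂ) • star (Lz z *ᵥ (N *ᵥ z)) := by
    rw [star_vecMul_of_conj hK, e2]; simp
  have e5 : star z ⬝ᵥ (Lz z *ᵥ (N *ᵥ z)) = (sz z : ℂ) * (star z ⬝ᵥ (N *ᵥ z)) := by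
    rw [dotProduct_mulVec, star_vecMul_of_conj (Lz_conj z), Lz_mulVec]; simp
  rw [Vz_conj, Vz, blk_mul, blk_mul]
  congr 1
  · simp only [smul_zero, zero_add, dotProduct_neg, dotProduct_smul, neg_vecMul,
      smul_vecMul, neg_dotProduct, smul_dotProduct, dotProduct_zero, mul_zero,
      smul_eq_mul, neg_neg, zero_mul, add_zero]
    rw [← dotProduct_mulVec, e2, dotProduct_smul, e5, smul_eq_mul]
    field_simp
  · simp only [smul_zero, zero_add, dotProduct_zero, mul_zero, add_zero, zero_smul,
      neg_vecMul, smul_vecMul]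
    rw [e4, smul_vecMul, smul_smul, inv_mul_cancel₀ h1, one_smul, star_vecMul_of_conj (Liz_conj z), e3]
  · simp only [smul_zero, zero_add, mulVec_zero, mulVec_neg, mulVec_smul, zero_smul, vecMulVec_zero]
    rw [← mulVec_mulVec, e2, mulVec_smul, e3, smul_smul, inv_mul_cancel₀ h1, one_smul]
  · rw [← e1]
    simp [vecMulVec_zero, zero_vecMulVec, e1]

lemma deflate {m : ℕ} {β : Type*} (Ψ : Matrix (Fin (m + 1)) (Fin (m + 1)) ℂ → β) (hΨ : UInv Ψ)
    (u : ℝ) (z : Fin m → ℂ) (N : Matrix (Fin m) (Fin m) ℂ) (hN : N.IsHermitian) :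
    Ψ (hblk (u - (star z ⬝ᵥ (N *ᵥ z)).re) (N *ᵥ z) ((u : ℂ) • 1 - N)) =
      Ψ (bd u ((u : ℂ) • 1 - Lz z * N * Lz z)) := by
  rw [← hΨ (Vz z) (bd u ((u : ℂ) • 1 - Lz z * N * Lz z)) (Vz_unitary z)]
  congr 1
  have e : bd u ((u : ℂ) • 1 - Lz z * N * Lz z) =
      (u : ℂ) • 1 - blk 0 0 0 (Lz z * N * Lz z) := by
    rw [← blk_one]
    ext i j
    refine Fin.cases ?_ (fun i => ?_) i <;> refine Fin.cases ?_ (fun j => ?_) j <;>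
      simp [bd]
  have him : (star z ⬝ᵥ (N *ᵥ z)).im = 0 := hN.im_star_dotProduct_mulVec_self z
  rw [e, mul_sub, sub_mul, Vz_mul z N hN, mul_smul_comm, mul_one, smul_mul_assoc, Vz_unitary,
    ← blk_one]
  ext i j
  refine Fin.cases ?_ (fun i => ?_) i <;> refine Fin.cases ?_ (fun j => ?_) j <;>
      simp [hblk, Complex.ext_iff, him]

end GUEGap

namespace GUEGap

lemma oned_real {m : ℕ} (l a : Fin m → ℝ) (ha : ∀ i, 0 < a i) (F : ℝ → ENNReal) :
    ∫⁻ h, F h = ∫⁻ u in {u : ℝ | ∀ i, l i < u},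
      ENNReal.ofReal (1 + ∑ i, a i / (u - l i) ^ 2) * F (u - ∑ i, a i / (u - l i)) := by
  set s : Set ℝ := {u : ℝ | ∀ i, l i < u} with hs
  have hso : IsOpen s := by
    have : s = ⋂ i, Set.Ioi (l i) := by ext; simp [hs]
    rw [this]
    exact isOpen_iInter_of_finite fun i => isOpen_Ioi
  have hconv : Convex ℝ s := by
    have : s = ⋂ i, Set.Ioi (l i) := by ext; simp [hs]
    rw [this]
    exact convex_iInter fun i => convex_Ioi _
  have hd : ∀ u ∈ s, HasDerivAt (fun u : ℝ => u - ∑ i, a i / (u - l i))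
      (1 + ∑ i, a i / (u - l i) ^ 2) u := by
    intro u hu
    have h1 : ∀ i ∈ Finset.univ, HasDerivAt (fun u : ℝ => a i / (u - l i))
        (-(a i / (u - l i) ^ 2)) u := by
      intro i _
      have hne : u - l i ≠ 0 := (sub_pos.2 (hu i)).ne'
      have := (hasDerivAt_const u (a i)).div ((hasDerivAt_id u).sub_const (l i)) hne
      refine this.congr_deriv ?_
      simp; ring
    have := (hasDerivAt_id u).sub (HasDerivAt.fun_sum h1)
    refine this.congr_deriv ?_
    simp
  have hpos : ∀ u : ℝ, 0 < 1 + ∑ i, a i / (u - l i) ^ 2 := by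
    intro u
    have : 0 ≤ ∑ i, a i / (u - l i) ^ 2 :=
      Finset.sum_nonneg fun i _ => div_nonneg (ha i).le (sq_nonneg _)
    linarith
  have hcont : ContinuousOn (fun u : ℝ => u - ∑ i, a i / (u - l i)) s :=
    fun u hu => (hd u hu).continuousAt.continuousWithinAt
  have hmono : StrictMonoOn (fun u : ℝ => u - ∑ i, a i / (u - l i)) s := by
    refine strictMonoOn_of_deriv_pos hconv hcont ?_
    intro u hu
    rw [(hd u (interior_subset hu)).deriv]
    exact hpos u
  have hsurj : (fun u : ℝ => u - ∑ i, a i / (u - l i)) '' s = Set.univ := by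
    rw [Set.eq_univ_iff_forall]
    intro t
    obtain ⟨M, hM⟩ : ∃ M : ℝ, ∀ i, l i < M := by
      obtain ⟨M, hM⟩ := (Set.finite_range l).bddAbove
      exact ⟨M + 1, fun i => by have := hM ⟨i, rfl⟩; linarith⟩
    have hA : 0 ≤ ∑ i, a i := Finset.sum_nonneg fun i _ => (ha i).le
    have hhi : ∃ u ∈ s, t ≤ u - ∑ i, a i / (u - l i) := by
      refine ⟨max (M + 1) (t + ∑ i, a i), fun i => lt_of_lt_of_le (by linarith [hM i])
        (le_max_left _ _), ?_⟩
      have : ∑ i, a i / (max (M + 1) (t + ∑ i, a i) - l i) ≤ ∑ i, a i := by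
        refine Finset.sum_le_sum fun i _ => div_le_self (ha i).le ?_
        have := le_max_left (M + 1) (t + ∑ i, a i)
        linarith [hM i]
      linarith [le_max_right (M + 1) (t + ∑ i, a i)]
    have hlo : ∃ u ∈ s, u - ∑ i, a i / (u - l i) ≤ t := by
      rcases isEmpty_or_nonempty (Fin m) with he | he
      · exact ⟨t, fun i => he.elim i, by simp⟩
      · obtain ⟨k, hk⟩ := Finite.exists_max l
        have hden : 0 < |l k + 1 - t| + 1 := by positivity
        set d := min 1 (a k / (|l k + 1 - t| + 1)) with hdd
        have hdpos : 0 < d := lt_min one_pos (div_pos (ha k) hden)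
        have hin : ∀ i, l i < l k + d := fun i => by linarith [hk i]
        refine ⟨l k + d, hin, ?_⟩
        have h1 : a k / (l k + d - l k) ≤ ∑ i, a i / (l k + d - l i) :=
          Finset.single_le_sum (f := fun i => a i / (l k + d - l i))
            (fun i _ => div_nonneg (ha i).le (by linarith [hin i])) (Finset.mem_univ k)
        have h2 : |l k + 1 - t| + 1 ≤ a k / (l k + d - l k) := by
          rw [add_sub_cancel_left, le_div_iff₀ hdpos]
          have := min_le_right 1 (a k / (|l k + 1 - t| + 1))
          rw [← hdd, le_div_iff₀ hden] at this
          linarith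
        have h3 : d ≤ 1 := min_le_left _ _
        linarith [le_abs_self (l k + 1 - t)]
    obtain ⟨u, hu, hu'⟩ := hlo
    obtain ⟨v, hv, hv'⟩ := hhi
    exact hconv.isPreconnected.intermediate_value hu hv hcont ⟨hu', hv'⟩
  have key := lintegral_image_eq_lintegral_abs_deriv_mul hso.measurableSet
    (fun u hu => (hd u hu).hasDerivWithinAt) hmono.injOn F
  rw [hsurj, Measure.restrict_univ] at key
  rw [key]
  refine lintegral_congr fun u => ?_
  rw [abs_of_pos (hpos u)]

end GUEGap

namespace GUEGap
open scoped ComplexOrder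

lemma spectral_form {m : ℕ} {A : Matrix (Fin m) (Fin m) ℂ} (hA : A.IsHermitian) :
    ∃ U : Matrix (Fin m) (Fin m) ℂ, U * Uᴴ = 1 ∧
      A = U * diagonal (fun i => (hA.eigenvalues i : ℂ)) * Uᴴ := by
  refine ⟨hA.eigenvectorUnitary, ?_, ?_⟩
  · have := (Matrix.mem_unitaryGroup_iff).1 hA.eigenvectorUnitary.2
    simpa [star_eq_conjTranspose] using this
  · conv_lhs => rw [hA.spectral_theorem, Unitary.conjStarAlgAut_apply]
    rfl

lemma posDef_conj_iff {m : ℕ} {U D : Matrix (Fin m) (Fin m) ℂ} (hU : U * Uᴴ = 1) :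
    (U * D * Uᴴ).PosDef ↔ D.PosDef := by
  have : IsUnit U := IsUnit.of_mul_eq_one _ hU
  have h := this.posDef_star_right_conjugate_iff (x := D)
  rwa [star_eq_conjTranspose] at h

lemma u_sub_conj {m : ℕ} {U : Matrix (Fin m) (Fin m) ℂ} (hU : U * Uᴴ = 1) (l : Fin m → ℝ) (u : ℝ) :
    (u : ℂ) • (1 : Matrix (Fin m) (Fin m) ℂ) - U * diagonal (fun i => (l i : ℂ)) * Uᴴ =
      U * diagonal (fun i => ((u - l i : ℝ) : ℂ)) * Uᴴ := by
  have : (diagonal (fun i => ((u - l i : ℝ) : ℂ)) : Matrix (Fin m) (Fin m) ℂ) =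
      (u : ℂ) • 1 - diagonal (fun i => (l i : ℂ)) := by
    ext i j
    by_cases h : i = j
    · subst h; simp
    · simp [h]
  rw [this, mul_sub, sub_mul, mul_smul_comm, mul_one, smul_mul_assoc, hU]

lemma u_sub_posDef {m : ℕ} {U : Matrix (Fin m) (Fin m) ℂ} (hU : U * Uᴴ = 1) (l : Fin m → ℝ)
    (u : ℝ) :
    ((u : ℂ) • (1 : Matrix (Fin m) (Fin m) ℂ) - U * diagonal (fun i => (l i : ℂ)) * Uᴴ).PosDef ↔
      ∀ i, l i < u := by
  rw [u_sub_conj hU, posDef_conj_iff hU, posDef_diagonal_iff]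
  exact forall_congr' fun i => by rw [Complex.zero_lt_real, sub_pos]

lemma nsq_unitary {m : ℕ} {U : Matrix (Fin m) (Fin m) ℂ} (hU : Uᴴ * U = 1) (z : Fin m → ℂ) :
    nsq (U *ᵥ z) = nsq z := by
  have : star (U *ᵥ z) ⬝ᵥ (U *ᵥ z) = star z ⬝ᵥ z := by
    rw [star_mulVec, dotProduct_mulVec, vecMul_vecMul, hU, vecMul_one]
  rw [star_dot_self, star_dot_self] at this
  exact_mod_cast this

lemma oned_matrix {m : ℕ} {U : Matrix (Fin m) (Fin m) ℂ} (hU : U * Uᴴ = 1) (l : Fin m → ℝ)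
    (w : Fin m → ℂ) (hw : ∀ i, (Uᴴ *ᵥ w) i ≠ 0) (F : ℝ → ENNReal)
    (A : Matrix (Fin m) (Fin m) ℂ) (hA : A = U * diagonal (fun i => (l i : ℂ)) * Uᴴ) :
    ∫⁻ h, F h = ∫⁻ u in {u : ℝ | ((u : ℂ) • 1 - A).PosDef},
      ENNReal.ofReal (1 + nsq (((u : ℂ) • 1 - A)⁻¹ *ᵥ w)) *
        F (u - (star w ⬝ᵥ (((u : ℂ) • 1 - A)⁻¹ *ᵥ w)).re) := by
  subst hA
  have hU' : Uᴴ * U = 1 := mul_eq_one_comm.1 hU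
  rw [oned_real l (fun i => ‖(Uᴴ *ᵥ w) i‖ ^ 2) (fun i => by have := hw i; positivity) F]
  have hset : {u : ℝ | ((u : ℂ) • (1 : Matrix (Fin m) (Fin m) ℂ) -
      U * diagonal (fun i => (l i : ℂ)) * Uᴴ).PosDef} = {u : ℝ | ∀ i, l i < u} := by
    ext u; exact u_sub_posDef hU l u
  have hso : MeasurableSet {u : ℝ | ∀ i, l i < u} := by
    have : {u : ℝ | ∀ i, l i < u} = ⋂ i, Set.Ioi (l i) := by ext; simp
    rw [this]
    exact MeasurableSet.iInter fun i => measurableSet_Ioi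
  rw [hset]
  refine setLIntegral_congr_fun hso fun u hu => ?_
  have hinv : ((u : ℂ) • (1 : Matrix (Fin m) (Fin m) ℂ) -
      U * diagonal (fun i => (l i : ℂ)) * Uᴴ)⁻¹ =
      U * diagonal (fun i => (((u - l i)⁻¹ : ℝ) : ℂ)) * Uᴴ := by
    rw [u_sub_conj hU]
    refine inv_eq_right_inv ?_
    calc _ = U * diagonal (fun i => ((u - l i : ℝ) : ℂ)) * (Uᴴ * U) *
          diagonal (fun i => (((u - l i)⁻¹ : ℝ) : ℂ)) * Uᴴ := by simp only [Matrix.mul_assoc]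
      _ = 1 := by
        rw [hU', mul_one, Matrix.mul_assoc U, diagonal_mul_diagonal]
        have : (fun i => ((u - l i : ℝ) : ℂ) * (((u - l i)⁻¹ : ℝ) : ℂ)) = fun _ => 1 := by
          funext i
          rw [← Complex.ofReal_mul, mul_inv_cancel₀ (sub_pos.2 (hu i)).ne', Complex.ofReal_one]
        rw [this, diagonal_one, mul_one, hU]
  have e1 : ∑ i, ‖(Uᴴ *ᵥ w) i‖ ^ 2 / (u - l i) ^ 2 = nsq (((u : ℂ) • (1 : Matrix (Fin m) (Fin m) ℂ) -
      U * diagonal (fun i => (l i : ℂ)) * Uᴴ)⁻¹ *ᵥ w) := by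
    rw [hinv, ← mulVec_mulVec, ← mulVec_mulVec, nsq_unitary hU', nsq]
    refine Finset.sum_congr rfl fun i _ => ?_
    rw [mulVec_diagonal, norm_mul, Complex.norm_real, mul_pow, Real.norm_eq_abs, sq_abs, inv_pow,
      div_eq_inv_mul]
  have e2 : ∑ i, ‖(Uᴴ *ᵥ w) i‖ ^ 2 / (u - l i) =
      (star w ⬝ᵥ (((u : ℂ) • (1 : Matrix (Fin m) (Fin m) ℂ) -
      U * diagonal (fun i => (l i : ℂ)) * Uᴴ)⁻¹ *ᵥ w)).re := by
    have : star w ⬝ᵥ ((U * diagonal (fun i => (((u - l i)⁻¹ : ℝ) : ℂ)) * Uᴴ) *ᵥ w) =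
        star (Uᴴ *ᵥ w) ⬝ᵥ (diagonal (fun i => (((u - l i)⁻¹ : ℝ) : ℂ)) *ᵥ (Uᴴ *ᵥ w)) := by
      rw [star_mulVec, conjTranspose_conjTranspose, ← dotProduct_mulVec, mulVec_mulVec,
        mulVec_mulVec, Matrix.mul_assoc]
    rw [hinv, this, dotProduct, Complex.re_sum]
    refine Finset.sum_congr rfl fun i _ => ?_
    rw [mulVec_diagonal, Pi.star_apply, mul_left_comm, RCLike.star_def, Complex.conj_mul']
    rw [← Complex.ofReal_pow, ← Complex.ofReal_mul, Complex.ofReal_re, div_eq_inv_mul]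
  rw [e1, e2]

lemma ae_generic {m : ℕ} {U : Matrix (Fin m) (Fin m) ℂ} (hU : U * Uᴴ = 1) :
    ∀ᵐ w : Fin m → ℂ, ∀ i, (Uᴴ *ᵥ w) i ≠ 0 := by
  rw [ae_all_iff]
  intro i
  let f : (Fin m → ℂ) →ₗ[ℝ] ℂ :=
    ((LinearMap.proj i : (Fin m → ℂ) →ₗ[ℂ] ℂ) ∘ₗ (Matrix.mulVecLin Uᴴ)).restrictScalars ℝ
  have hf : ∀ w, f w = (Uᴴ *ᵥ w) i := fun w => rfl
  have h0 : volume ((LinearMap.ker f : Submodule ℝ (Fin m → ℂ)) : Set (Fin m → ℂ)) = 0 := by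
    refine Measure.addHaar_submodule _ _ ?_
    intro htop
    have : U *ᵥ (Pi.single i 1) ∈ LinearMap.ker f := htop ▸ Submodule.mem_top
    rw [LinearMap.mem_ker, hf, mulVec_mulVec, mul_eq_one_comm.1 hU] at this
    simp at this
  rw [ae_iff]
  convert h0 using 2
  ext w
  simp [hf]

end GUEGap

namespace GUEGap
open scoped ComplexOrder

instance matBorel {m n : ℕ} : BorelSpace (Matrix (Fin m) (Fin n) ℂ) :=
  inferInstanceAs (BorelSpace (Fin m → Fin n → ℂ))

instance matSCT {m n : ℕ} : SecondCountableTopology (Matrix (Fin m) (Fin n) ℂ) :=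
  inferInstanceAs (SecondCountableTopology (Fin m → Fin n → ℂ))

lemma lint_linear {E : Type*} [NormedAddCommGroup E] [NormedSpace ℝ E] [MeasurableSpace E]
    [BorelSpace E] [FiniteDimensional ℝ E] (μ : Measure E) [μ.IsAddHaarMeasure]
    (f : E →ₗ[ℝ] E) (hf : LinearMap.det f ≠ 0) (g : E → ENNReal) (hg : Measurable g) :
    ∫⁻ x, g (f x) ∂μ = ENNReal.ofReal |(LinearMap.det f)⁻¹| * ∫⁻ x, g x ∂μ := by
  have hfm : Measurable f := f.continuous_of_finiteDimensional.measurable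
  rw [← lintegral_map hg hfm, Measure.map_linearMap_addHaar_eq_smul_addHaar μ hf,
    lintegral_smul_measure, smul_eq_mul]

/-- Congruence by `L` on coordinates. -/
noncomputable def congC {m : ℕ} (L : Matrix (Fin m) (Fin m) ℂ) : HC m →ₗ[ℝ] HC m where
  toFun X := coord (L * herm X * Lᴴ)
  map_add' X Y := by rw [herm_add, mul_add, add_mul, coord_add]
  map_smul' c X := by
    rw [herm_smul, mul_smul_comm, smul_mul_assoc, coord_smul]; rfl

lemma herm_congC {m : ℕ} (L : Matrix (Fin m) (Fin m) ℂ) (X : HC m) :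
    herm (congC L X) = L * herm X * Lᴴ :=
  herm_coord (by
    have := (herm_isHermitian X).eq
    rw [IsHermitian, conjTranspose_mul, conjTranspose_mul, this, conjTranspose_conjTranspose,
      Matrix.mul_assoc])

lemma congC_det_ne {m : ℕ} (L M : Matrix (Fin m) (Fin m) ℂ) (h : M * L = 1) :
    LinearMap.det (congC L) ≠ 0 := by
  have : congC M ∘ₗ congC L = LinearMap.id := by
    refine LinearMap.ext fun X => ?_
    have h2 : Lᴴ * Mᴴ = 1 := by rw [← conjTranspose_mul, h, conjTranspose_one]
    have : herm (congC M (congC L X)) = herm X := by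
      rw [herm_congC, herm_congC]
      calc _ = (M * L) * herm X * (Lᴴ * Mᴴ) := by simp only [Matrix.mul_assoc]
        _ = _ := by rw [h, h2, one_mul, mul_one]
    have := congrArg coord this
    rwa [coord_herm, coord_herm] at this
  have h3 := congrArg LinearMap.det this
  rw [LinearMap.det_comp, LinearMap.det_id] at h3
  exact right_ne_zero_of_mul_eq_one h3

lemma isClosed_posSemidef {m : ℕ} : IsClosed {N : Matrix (Fin m) (Fin m) ℂ | N.PosSemidef} := by
  have : {N : Matrix (Fin m) (Fin m) ℂ | N.PosSemidef} =
      {N | Nᴴ = N} ∩ ⋂ x : Fin m → ℂ, {N | 0 ≤ star x ⬝ᵥ (N *ᵥ x)} := by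
    ext N
    simp only [posSemidef_iff_dotProduct_mulVec, Set.mem_setOf_eq, Set.mem_inter_iff,
      Set.mem_iInter]
    rfl
  rw [this]
  refine (isClosed_eq (by fun_prop) (by fun_prop)).inter (isClosed_iInter fun x => ?_)
  exact isClosed_le continuous_const (by fun_prop)

lemma measurableSet_posDef {m : ℕ} : MeasurableSet {N : Matrix (Fin m) (Fin m) ℂ | N.PosDef} := by
  have : {N : Matrix (Fin m) (Fin m) ℂ | N.PosDef} =
      {N | N.PosSemidef} ∩ {N | N.det = 0}ᶜ := by
    ext N
    simp only [Set.mem_inter_iff, Set.mem_compl_iff, Set.mem_setOf_eq]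
    constructor
    · intro h
      exact ⟨h.posSemidef, h.det_pos.ne'⟩
    · rintro ⟨h, h'⟩
      exact (h.posDef_iff_isUnit).2 ((isUnit_iff_isUnit_det _).2 (isUnit_iff_ne_zero.2 h'))
  rw [this]
  refine isClosed_posSemidef.measurableSet.inter (IsClosed.measurableSet ?_).compl
  exact isClosed_eq (by fun_prop) (by fun_prop)

/-- The weight `1[N > 0] |det N|²`. -/
noncomputable def pw {m : ℕ} (N : Matrix (Fin m) (Fin m) ℂ) : ENNReal :=
  {N : Matrix (Fin m) (Fin m) ℂ | N.PosDef}.indicator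
    (fun N => ENNReal.ofReal (Complex.normSq N.det)) N

lemma measurable_pw {m : ℕ} : Measurable (pw (m := m)) := by
  refine Measurable.indicator ?_ measurableSet_posDef
  refine ENNReal.measurable_ofReal.comp (Continuous.measurable ?_)
  exact Complex.continuous_normSq.comp (by fun_prop)

lemma continuous_blk {α : Type*} [TopologicalSpace α] {m : ℕ} {a : α → ℂ} {r c : α → Fin m → ℂ}
    {D : α → Matrix (Fin m) (Fin m) ℂ} (ha : Continuous a) (hr : Continuous r) (hc : Continuous c)
    (hD : Continuous D) : Continuous fun x => blk (a x) (r x) (c x) (D x) := by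
  refine continuous_pi fun i => continuous_pi fun j => ?_
  refine Fin.cases ?_ (fun i => ?_) i <;> refine Fin.cases ?_ (fun j => ?_) j
  · exact ha
  · exact (continuous_apply j).comp hr
  · exact (continuous_apply i).comp hc
  · exact (continuous_apply j).comp ((continuous_apply i).comp hD)

lemma continuous_nsq {m : ℕ} : Continuous (nsq (m := m)) := by
  unfold nsq; fun_prop

lemma continuous_Lz {m : ℕ} : Continuous (Lz (m := m)) := by
  have h1 : Continuous (sz (m := m)) :=
    Real.continuous_sqrt.comp (continuous_const.add continuous_nsq)
  have h2 : Continuous fun z : Fin m → ℂ => 1 / (sz z + 1) :=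
    continuous_const.div (h1.add continuous_const) fun z => by have := sz_pos z; positivity
  have h3 : Continuous (pz (m := m)) := by
    refine continuous_pi fun i => continuous_pi fun j => ?_
    simp only [pz, vecMulVec_apply]
    fun_prop
  exact continuous_const.add ((Complex.continuous_ofReal.comp h2).smul h3)

lemma measurable_matrix_inv {m : ℕ} : Measurable fun A : Matrix (Fin m) (Fin m) ℂ => A⁻¹ := by
  simp only [Matrix.inv_def, Ring.inverse_eq_inv']
  refine measurable_pi_lambda _ fun i => measurable_pi_lambda _ fun j => ?_
  simp only [Matrix.smul_apply, smul_eq_mul]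
  refine Measurable.mul ?_ ?_
  · exact (Continuous.measurable (by fun_prop)).inv
  · refine Continuous.measurable ?_
    have : Continuous fun A : Matrix (Fin m) (Fin m) ℂ => A.adjugate := by fun_prop
    exact (continuous_apply j).comp ((continuous_apply i).comp this)

lemma pw_of_pos {m : ℕ} {N : Matrix (Fin m) (Fin m) ℂ} (h : N.PosDef) :
    pw N = ENNReal.ofReal (Complex.normSq N.det) := by
  unfold pw; rw [Set.indicator_of_mem (by exact h)]

lemma pw_of_not {m : ℕ} {N : Matrix (Fin m) (Fin m) ℂ} (h : ¬ N.PosDef) : pw N = 0 := by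
  unfold pw; rw [Set.indicator_of_notMem (by exact h)]

lemma lint_complex {m : ℕ} (N : Matrix (Fin m) (Fin m) ℂ) (hdet : N.det ≠ 0)
    (g : (Fin m → ℂ) → ENNReal) (hg : Measurable g) :
    ∫⁻ w, g w = ENNReal.ofReal (Complex.normSq N.det) * ∫⁻ z, g (N *ᵥ z) := by
  have hd : LinearMap.det ((Matrix.mulVecLin N).restrictScalars ℝ) = Complex.normSq N.det := by
    rw [LinearMap.det_restrictScalars, Algebra.norm_complex_eq]
    rw [show LinearMap.det N.mulVecLin = N.det from LinearMap.det_toLin' N]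
    rfl
  have hd0 : Complex.normSq N.det ≠ 0 := by simpa using hdet
  have hlin := lint_linear volume ((Matrix.mulVecLin N).restrictScalars ℝ)
          (by rw [hd]; exact hd0) g hg
  have : ∫⁻ z, g (N *ᵥ z) = ∫⁻ z, g ((Matrix.mulVecLin N).restrictScalars ℝ z) := rfl
  rw [this, hlin, ← mul_assoc, ← ENNReal.ofReal_mul (Complex.normSq_nonneg _), hd,
    abs_of_nonneg (inv_nonneg.2 (Complex.normSq_nonneg _)), mul_inv_cancel₀ hd0,
    ENNReal.ofReal_one, one_mul]

lemma measurable_os_integrand {m : ℕ} (Ψ : Matrix (Fin (m + 1)) (Fin (m + 1)) ℂ → ENNReal)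
    (hm : Measurable Ψ) : Measurable fun p : (ℝ × (Fin m → ℂ)) × Matrix (Fin m) (Fin m) ℂ =>
      ENNReal.ofReal (1 + nsq p.1.2) * Ψ (bd p.1.1 ((p.1.1 : ℂ) • 1 - Lz p.1.2 * p.2 * Lz p.1.2)) := by
  refine Measurable.mul ?_ ?_
  · exact ENNReal.measurable_ofReal.comp
      (measurable_const.add (continuous_nsq.measurable.comp (measurable_snd.comp measurable_fst)))
  · refine hm.comp (Continuous.measurable ?_)
    have := (continuous_Lz (m := m)).comp (continuous_snd.comp
      (continuous_fst (X := ℝ × (Fin m → ℂ)) (Y := Matrix (Fin m) (Fin m) ℂ)))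
    simp only [Function.comp_def] at this
    refine continuous_blk ?_ ?_ ?_ ?_ <;> fun_prop

lemma os_inner {m : ℕ} (Ψ : Matrix (Fin (m + 1)) (Fin (m + 1)) ℂ → ENNReal) (hΨ : UInv Ψ)
    (A : Matrix (Fin m) (Fin m) ℂ) (u : ℝ)
    (N : Matrix (Fin m) (Fin m) ℂ) (hN : N = (u : ℂ) • 1 - A) (hu' : N.PosDef)
    (hGm : Measurable fun w : Fin m → ℂ => ENNReal.ofReal (1 + nsq (N⁻¹ *ᵥ w)) *
        Ψ (hblk (u - (star w ⬝ᵥ (N⁻¹ *ᵥ w)).re) w A)) :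
    ∫⁻ w, ENNReal.ofReal (1 + nsq (N⁻¹ *ᵥ w)) *
        Ψ (hblk (u - (star w ⬝ᵥ (N⁻¹ *ᵥ w)).re) w A) =
      pw N * ∫⁻ z : Fin m → ℂ, (ENNReal.ofReal (1 + nsq z) *
        Ψ (bd u ((u : ℂ) • 1 - Lz z * N * Lz z))) := by
  have hdet : N.det ≠ 0 := hu'.det_pos.ne'
  have hNu : IsUnit N.det := isUnit_iff_ne_zero.2 hdet
  rw [pw_of_pos hu', lint_complex N hdet _ hGm]
  congr 1
  refine lintegral_congr fun z => ?_
  rw [← deflate Ψ hΨ u z N hu'.isHermitian]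
  have e2 : N⁻¹ *ᵥ (N *ᵥ z) = z := by
    rw [mulVec_mulVec, nonsing_inv_mul _ hNu, one_mulVec]
  have e3 : (u : ℂ) • 1 - N = A := by rw [hN]; abel
  have e4 : star (N *ᵥ z) ⬝ᵥ z = star z ⬝ᵥ (N *ᵥ z) := by
    rw [← star_vecMul_of_conj hu'.isHermitian.eq, ← dotProduct_mulVec]
  rw [e2, e3, e4]

/-- integrand after the one-dimensional substitution -/
noncomputable def osG {m : ℕ} (Ψ : Matrix (Fin (m + 1)) (Fin (m + 1)) ℂ → ENNReal)
    (A : Matrix (Fin m) (Fin m) ℂ) (w : Fin m → ℂ) (u : ℝ) : ENNReal :=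
  ENNReal.ofReal (1 + nsq (((u : ℂ) • 1 - A)⁻¹ *ᵥ w)) *
        Ψ (hblk (u - (star w ⬝ᵥ (((u : ℂ) • 1 - A)⁻¹ *ᵥ w)).re) w A)

lemma measurable_osG {m : ℕ} (Ψ : Matrix (Fin (m + 1)) (Fin (m + 1)) ℂ → ENNReal)
    (hm : Measurable Ψ) (A : Matrix (Fin m) (Fin m) ℂ) :
    Measurable (Function.uncurry (osG Ψ A)) := by
  have hNc : Continuous fun u : ℝ => (u : ℂ) • (1 : Matrix (Fin m) (Fin m) ℂ) - A := by fun_prop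
  have hNi : Measurable fun u : ℝ => ((u : ℂ) • (1 : Matrix (Fin m) (Fin m) ℂ) - A)⁻¹ :=
    measurable_matrix_inv.comp hNc.measurable
  have h1 : Measurable fun p : (Fin m → ℂ) × ℝ =>
      (((p.2 : ℂ) • (1 : Matrix (Fin m) (Fin m) ℂ) - A)⁻¹ *ᵥ p.1) := by
    have hc : Continuous fun q : Matrix (Fin m) (Fin m) ℂ × (Fin m → ℂ) => q.1 *ᵥ q.2 := by
      fun_prop
    exact hc.measurable.comp ((hNi.comp measurable_snd).prodMk measurable_fst)
  refine Measurable.mul ?_ ?_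
  · exact ENNReal.measurable_ofReal.comp
      (measurable_const.add (continuous_nsq.measurable.comp h1))
  · refine hm.comp ?_
    have hc : Continuous fun q : (Fin m → ℂ) × (Fin m → ℂ) × ℝ =>
        hblk (q.2.2 - (star q.2.1 ⬝ᵥ q.1).re) q.2.1 A := by
      refine continuous_blk ?_ ?_ ?_ ?_ <;> fun_prop
    exact hc.measurable.comp (h1.prodMk measurable_id)

/-- The one step formula for a fixed corner. -/
lemma os1 {m : ℕ} (Ψ : Matrix (Fin (m + 1)) (Fin (m + 1)) ℂ → ENNReal) (hΨ : UInv Ψ)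
    (hm : Measurable Ψ) (A : Matrix (Fin m) (Fin m) ℂ) (hA : A.IsHermitian) :
    ∫⁻ w : Fin m → ℂ, ∫⁻ h : ℝ, Ψ (hblk h w A) =
      ∫⁻ u : ℝ, pw ((u : ℂ) • 1 - A) * ∫⁻ z : Fin m → ℂ, (ENNReal.ofReal (1 + nsq z) *
        Ψ (bd u ((u : ℂ) • 1 - Lz z * ((u : ℂ) • 1 - A) * Lz z))) := by
  obtain ⟨U, hU, hAU⟩ := spectral_form hA
  have hNc : Continuous fun u : ℝ => (u : ℂ) • (1 : Matrix (Fin m) (Fin m) ℂ) - A := by fun_prop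
  have hsm : MeasurableSet {u : ℝ | ((u : ℂ) • 1 - A).PosDef} := hNc.measurable measurableSet_posDef
  have s1 : ∫⁻ w : Fin m → ℂ, ∫⁻ h : ℝ, Ψ (hblk h w A) = ∫⁻ w : Fin m → ℂ,
      ∫⁻ u in {u : ℝ | ((u : ℂ) • 1 - A).PosDef}, osG Ψ A w u := by
    refine lintegral_congr_ae ?_
    filter_upwards [ae_generic hU] with w hw
    exact oned_matrix hU _ w hw (fun h => Ψ (hblk h w A)) A hAU
  rw [s1, lintegral_lintegral_swap (measurable_osG Ψ hm A).aemeasurable,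
    ← lintegral_indicator hsm]
  refine lintegral_congr fun u => ?_
  by_cases hu : ((u : ℂ) • 1 - A).PosDef
  · rw [Set.indicator_of_mem (by exact hu)]
    have hg : Measurable fun w => osG Ψ A w u :=
      (measurable_osG Ψ hm A).of_uncurry_right
    have h2 := os_inner Ψ hΨ A u ((u : ℂ) • 1 - A) rfl hu
    simp only [osG] at hg ⊢
    exact h2 hg
  · rw [Set.indicator_of_notMem (by exact hu), pw_of_not hu, zero_mul]

end GUEGap

namespace GUEGap
open scoped ComplexOrder

lemma herm_coord_one_sub {m : ℕ} (u : ℝ) (X : HC m) :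
    herm (u • coord (1 : Matrix (Fin m) (Fin m) ℂ) - X) = (u : ℂ) • 1 - herm X := by
  rw [herm_sub, herm_smul, herm_coord isHermitian_one]

lemma pw_congr {m : ℕ} (z : Fin m → ℂ) (N : Matrix (Fin m) (Fin m) ℂ) :
    pw N = ENNReal.ofReal ((Complex.normSq (Lz z).det ^ 2)⁻¹) * pw (Lz z * N * (Lz z)ᴴ) := by
  have hu : IsUnit (Lz z) := IsUnit.of_mul_eq_one _ (Lz_mul_Liz z)
  have h := hu.posDef_star_right_conjugate_iff (x := N)
  rw [star_eq_conjTranspose] at h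
  have hd : (Lz z).det ≠ 0 := by
    intro h0
    have := congrArg Matrix.det (Lz_mul_Liz z)
    simp [h0] at this
  by_cases hN : N.PosDef
  · rw [pw_of_pos hN, pw_of_pos (h.2 hN), ← ENNReal.ofReal_mul (by positivity)]
    congr 1
    rw [det_mul, det_mul, det_conjTranspose, Complex.normSq_mul, Complex.normSq_mul,
      RCLike.star_def, Complex.normSq_conj]
    have : Complex.normSq (Lz z).det ≠ 0 := by simpa using hd
    field_simp
  · rw [pw_of_not hN, pw_of_not (fun h' => hN (h.1 h')), mul_zero]

/-- scaling factor of the congruence by `Lz z` -/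
noncomputable def tz {m : ℕ} (z : Fin m → ℂ) : ENNReal :=
  ENNReal.ofReal |(LinearMap.det (congC (Lz z)))⁻¹|

lemma tz_spec {m : ℕ} (z : Fin m → ℂ) (g : HC m → ENNReal) (hg : Measurable g) :
    ∫⁻ Y, g (congC (Lz z) Y) = tz z * ∫⁻ Y, g Y :=
  lint_linear volume _ (congC_det_ne _ _ (Liz_mul_Lz z)) g hg

lemma continuous_coord {m : ℕ} : Continuous (coord (m := m)) := by
  refine continuous_pi fun i => continuous_pi fun j => ?_
  simp only [coord]
  split_ifs
  · exact Complex.continuous_im.comp ((continuous_apply j).comp (continuous_apply i))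
  · exact Complex.continuous_re.comp ((continuous_apply j).comp (continuous_apply i))

lemma measurable_tz {m : ℕ} : Measurable (tz (m := m)) := by
  set B : Set (HC m) := Metric.closedBall 0 1
  set g : HC m → ENNReal := B.indicator 1 with hgd
  have hg : Measurable g := measurable_one.indicator Metric.isClosed_closedBall.measurableSet
  have h0 : ∫⁻ Y, g Y = volume B := by
    rw [hgd, lintegral_indicator_one Metric.isClosed_closedBall.measurableSet]
  have hpos : volume B ≠ 0 := (Metric.measure_closedBall_pos volume _ one_pos).ne'
  have hfin : volume B ≠ ⊤ := measure_closedBall_lt_top.ne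
  have : (tz (m := m)) = fun z => (∫⁻ Y, g (congC (Lz z) Y)) / volume B := by
    funext z
    rw [tz_spec z g hg, h0, ENNReal.mul_div_cancel_right hpos hfin]
  rw [this]
  refine Measurable.div_const ?_ _
  refine Measurable.lintegral_prod_right' (f := fun p : (Fin m → ℂ) × HC m =>
    g (congC (Lz p.1) p.2)) ?_
  refine hg.comp (Continuous.measurable ?_)
  refine continuous_coord.comp ?_
  have h1 := (continuous_Lz (m := m)).comp (continuous_fst (X := Fin m → ℂ) (Y := HC m))
  have h2 := (continuous_herm (m := m)).comp (continuous_snd (X := Fin m → ℂ) (Y := HC m))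
  simp only [Function.comp_def] at h1 h2
  fun_prop

/-- constant of the one step formula -/
noncomputable def kap (m : ℕ) : ENNReal :=
  ∫⁻ z : Fin m → ℂ, ENNReal.ofReal (1 + nsq z) *
    (ENNReal.ofReal ((Complex.normSq (Lz z).det ^ 2)⁻¹) * tz z)

lemma measurable_bd {m : ℕ} (u : ℝ) :
    Measurable (fun D : Matrix (Fin m) (Fin m) ℂ => bd u D) :=
  (continuous_blk continuous_const continuous_const continuous_const continuous_id).measurable

lemma lint_sub_one {m : ℕ} (u : ℝ) (f : Matrix (Fin m) (Fin m) ℂ → ENNReal) :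
    ∫⁻ X : HC m, f ((u : ℂ) • 1 - herm X) = ∫⁻ X, f (herm X) := by
  rw [← lintegral_sub_left_eq_self (fun X : HC m => f (herm X))
    (u • coord (1 : Matrix (Fin m) (Fin m) ℂ))]
  simp only [herm_coord_one_sub]

lemma os_inner2 {m : ℕ} (Ψ : Matrix (Fin (m + 1)) (Fin (m + 1)) ℂ → ENNReal)
    (hm : Measurable Ψ) (u : ℝ) (z : Fin m → ℂ) :
    ∫⁻ X : HC m, pw ((u : ℂ) • 1 - herm X) * (ENNReal.ofReal (1 + nsq z) *
        Ψ (bd u ((u : ℂ) • 1 - Lz z * ((u : ℂ) • 1 - herm X) * Lz z))) =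
    (ENNReal.ofReal (1 + nsq z) *
    (ENNReal.ofReal ((Complex.normSq (Lz z).det ^ 2)⁻¹) * tz z)) *
      ∫⁻ X : HC m, pw ((u : ℂ) • 1 - herm X) * Ψ (bd u (herm X)) := by
  have e1 := lint_sub_one u (fun N => pw N * (ENNReal.ofReal (1 + nsq z) *
        Ψ (bd u ((u : ℂ) • 1 - Lz z * N * Lz z))))
  have e2 := lint_sub_one u (fun N => pw N * Ψ (bd u ((u : ℂ) • 1 - N)))
  simp only [sub_sub_cancel] at e2
  set g : HC m → ENNReal := fun Y => pw (herm Y) * Ψ (bd u ((u : ℂ) • 1 - herm Y)) with hg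
  have hgm : Measurable g := by
    refine (measurable_pw.comp measurable_herm).mul (hm.comp ((measurable_bd u).comp ?_))
    refine Continuous.measurable ?_
    exact continuous_const.sub continuous_herm
  rw [e1, e2]
  have e3 := tz_spec z g hgm
  have e4 : ∀ X : HC m, pw (herm X) * (ENNReal.ofReal (1 + nsq z) *
        Ψ (bd u ((u : ℂ) • 1 - Lz z * herm X * Lz z))) =
        (ENNReal.ofReal (1 + nsq z) * ENNReal.ofReal ((Complex.normSq (Lz z).det ^ 2)⁻¹)) *
          g (congC (Lz z) X) := by
    intro X
    rw [hg]
    simp only [herm_congC]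
    rw [pw_congr z (herm X)]
    rw [Lz_conj]
    ring
  simp only [e4]
  rw [lintegral_const_mul' _ _ (ENNReal.mul_ne_top ENNReal.ofReal_ne_top ENNReal.ofReal_ne_top),
    e3]
  ring

lemma pw_ne_top {m : ℕ} (N : Matrix (Fin m) (Fin m) ℂ) : pw N ≠ ⊤ := by
  by_cases h : N.PosDef
  · rw [pw_of_pos h]; exact ENNReal.ofReal_ne_top
  · rw [pw_of_not h]; exact ENNReal.zero_ne_top

/-- the integrand in the one step formula -/
noncomputable def osK {m : ℕ} (Ψ : Matrix (Fin (m + 1)) (Fin (m + 1)) ℂ → ENNReal)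
    (u : ℝ) (X : HC m) (z : Fin m → ℂ) : ENNReal :=
  pw ((u : ℂ) • 1 - herm X) * (ENNReal.ofReal (1 + nsq z) *
        Ψ (bd u ((u : ℂ) • 1 - Lz z * ((u : ℂ) • 1 - herm X) * Lz z)))

lemma measurable_osK {m : ℕ} (Ψ : Matrix (Fin (m + 1)) (Fin (m + 1)) ℂ → ENNReal)
    (hm : Measurable Ψ) {α : Type*} [TopologicalSpace α] [MeasurableSpace α]
    [OpensMeasurableSpace α]
    (f : α → ℝ) (g : α → HC m) (h : α → (Fin m → ℂ)) (hf : Continuous f) (hg : Continuous g)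
    (hh : Continuous h) :
    Measurable fun p : α => osK Ψ (f p) (g p) (h p) := by
  have h2 := (continuous_herm (m := m)).comp hg
  have h1 := (continuous_Lz (m := m)).comp hh
  have h3 := (continuous_nsq (m := m)).comp hh
  simp only [Function.comp_def] at h1 h2 h3
  have hc0 : Continuous fun p : α => ((f p : ℝ) : ℂ) • 1 - herm (g p) := by
    fun_prop
  refine (measurable_pw.comp hc0.measurable).mul (Measurable.mul ?_ ?_)
  · exact ENNReal.measurable_ofReal.comp (measurable_const.add h3.measurable)
  · refine hm.comp (Continuous.measurable ?_)
    refine continuous_blk ?_ ?_ ?_ ?_ <;> fun_prop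

lemma measurable_osR {m : ℕ} (Ψ : Matrix (Fin (m + 1)) (Fin (m + 1)) ℂ → ENNReal)
    (hm : Measurable Ψ) : Measurable fun p : ℝ × HC m =>
      pw ((p.1 : ℂ) • 1 - herm p.2) * Ψ (bd p.1 (herm p.2)) := by
  have h2 := (continuous_herm (m := m)).comp (continuous_snd (X := ℝ) (Y := HC m))
  simp only [Function.comp_def] at h2
  have hc0 : Continuous fun p : ℝ × HC m => (p.1 : ℂ) • 1 - herm p.2 := by
    fun_prop
  refine (measurable_pw.comp hc0.measurable).mul (hm.comp (Continuous.measurable ?_))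
  refine continuous_blk ?_ ?_ ?_ ?_ <;> fun_prop

theorem one_step {m : ℕ} (Ψ : Matrix (Fin (m + 1)) (Fin (m + 1)) ℂ → ENNReal) (hΨ : UInv Ψ)
    (hm : Measurable Ψ) :
    ∫⁻ X : HC (m + 1), Ψ (herm X) =
      kap m * ∫⁻ u : ℝ, ∫⁻ X : HC m, pw ((u : ℂ) • 1 - herm X) * Ψ (bd u (herm X)) := by
  have hF : Measurable fun p : ℝ × (Fin m → ℂ) × HC m => Ψ (hblk p.1 p.2.1 (herm p.2.2)) := by
    refine hm.comp (Continuous.measurable ?_)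
    have h2 := (continuous_herm (m := m)).comp
      ((continuous_snd (X := Fin m → ℂ) (Y := HC m)).comp (continuous_snd (X := ℝ)))
    simp only [Function.comp_def] at h2
    refine continuous_blk ?_ ?_ ?_ ?_ <;> fun_prop
  have s1 : ∫⁻ X : HC (m + 1), Ψ (herm X) =
      ∫⁻ p : ℝ × (Fin m → ℂ) × HC m, Ψ (hblk p.1 p.2.1 (herm p.2.2)) := by
    have := (joinC_measurePreserving m).lintegral_comp (hm.comp measurable_herm)
    simp only [Function.comp_apply, herm_joinC] at this
    exact this.symm
  have s2 : ∫⁻ p : ℝ × (Fin m → ℂ) × HC m, Ψ (hblk p.1 p.2.1 (herm p.2.2)) =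
      ∫⁻ X : HC m, ∫⁻ w : Fin m → ℂ, ∫⁻ h : ℝ, Ψ (hblk h w (herm X)) := by
    rw [Measure.volume_eq_prod, lintegral_prod_symm' _ hF, Measure.volume_eq_prod,
      lintegral_prod_symm']
    exact hF.lintegral_prod_left'
  have s3 : ∀ X : HC m, ∫⁻ w : Fin m → ℂ, ∫⁻ h : ℝ, Ψ (hblk h w (herm X)) =
      ∫⁻ u : ℝ, ∫⁻ z, osK Ψ u X z := by
    intro X
    rw [os1 Ψ hΨ hm _ (herm_isHermitian _)]
    refine lintegral_congr fun u => ?_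
    exact (lintegral_const_mul' _ _ (pw_ne_top _)).symm
  have s4 : ∀ u : ℝ, ∫⁻ z : Fin m → ℂ, ∫⁻ X : HC m, osK Ψ u X z =
      kap m * ∫⁻ X : HC m, pw ((u : ℂ) • 1 - herm X) * Ψ (bd u (herm X)) := by
    intro u
    unfold osK
    simp only [os_inner2 Ψ hm u]
    rw [lintegral_mul_const, kap]
    refine Measurable.mul ?_ (Measurable.mul ?_ measurable_tz)
    · exact ENNReal.measurable_ofReal.comp (measurable_const.add continuous_nsq.measurable)
    · refine ENNReal.measurable_ofReal.comp (((Complex.continuous_normSq.comp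
        (continuous_Lz.matrix_det)).pow 2).measurable.inv)
  rw [s1, s2]
  simp only [s3]
  rw [lintegral_lintegral_swap]
  swap
  · have : Measurable fun p : (HC m × ℝ) × (Fin m → ℂ) => osK Ψ p.1.2 p.1.1 p.2 :=
      measurable_osK Ψ hm _ _ _ (by fun_prop) (by fun_prop) (by fun_prop)
    exact this.lintegral_prod_right'.aemeasurable
  rw [← lintegral_const_mul'']
  swap
  · exact (measurable_osR Ψ hm).lintegral_prod_right'.aemeasurable
  refine lintegral_congr fun u => ?_
  rw [← s4 u, lintegral_lintegral_swap]
  have : Measurable fun p : HC m × (Fin m → ℂ) => osK Ψ u p.1 p.2 :=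
      measurable_osK Ψ hm _ _ _ (by fun_prop) (by fun_prop) (by fun_prop)
  exact this.aemeasurable

end GUEGap

namespace GUEGap
open scoped ComplexOrder

/-- Squared Vandermonde. -/
noncomputable def vd2 {m : ℕ} (y : Fin m → ℝ) : ℝ := (vandermonde y).det ^ 2

/-- real diagonal matrix -/
noncomputable def dg {m : ℕ} (y : Fin m → ℝ) : Matrix (Fin m) (Fin m) ℂ :=
  diagonal fun i => (y i : ℂ)

lemma vd2_nonneg {m : ℕ} (y : Fin m → ℝ) : 0 ≤ vd2 y := sq_nonneg _

lemma vd2_cons {m : ℕ} (u : ℝ) (y : Fin m → ℝ) :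
    vd2 (Fin.cons u y : Fin (m + 1) → ℝ) = (∏ j, (u - y j)) ^ 2 * vd2 y := by
  have h : (∏ j, (u - y j)) ^ 2 = (∏ j, (y j - u)) ^ 2 := by
    rw [← Finset.prod_pow, ← Finset.prod_pow]
    exact Finset.prod_congr rfl fun j _ => by ring
  rw [vd2, vd2, det_vandermonde, det_vandermonde, Fin.prod_univ_succ, Fin.prod_Ioi_zero, mul_pow, h]
  simp only [Fin.cons_succ, Fin.cons_zero, Fin.prod_Ioi_succ]

lemma vd2_perm {m : ℕ} (y : Fin m → ℝ) (σ : Equiv.Perm (Fin m)) : vd2 (y ∘ σ) = vd2 y := by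
  have : vandermonde (y ∘ σ) = (vandermonde y).submatrix σ id := by
    ext i j; simp [vandermonde_apply]
  rw [vd2, this, det_permute, mul_pow, vd2]
  rcases Int.units_eq_one_or (Equiv.Perm.sign σ) with h | h <;> simp [h]

lemma continuous_vd2 {m : ℕ} : Continuous (vd2 (m := m)) := by
  unfold vd2
  simp only [det_vandermonde]
  fun_prop

lemma continuous_dg {m : ℕ} : Continuous (dg (m := m)) := by
  refine continuous_pi fun i => continuous_pi fun j => ?_
  by_cases h : i = j
  · subst h; simp only [dg, diagonal_apply_eq]; fun_prop
  · simp only [dg, diagonal_apply_ne _ h]; fun_prop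

lemma bd_dg {m : ℕ} (u : ℝ) (y : Fin m → ℝ) : bd u (dg y) = dg (Fin.cons u y : Fin (m + 1) → ℝ) := by
  ext i j
  refine Fin.cases ?_ (fun i => ?_) i <;> refine Fin.cases ?_ (fun j => ?_) j <;>
    simp [bd, dg, diagonal_apply, Fin.succ_ne_zero, (Fin.succ_ne_zero _).symm]

lemma bd_conj {m : ℕ} (u : ℝ) (U B : Matrix (Fin m) (Fin m) ℂ) :
    bd u (U * B * Uᴴ) = blk 1 0 0 U * bd u B * (blk 1 0 0 U)ᴴ := by
  rw [bd, bd, blk_conjTranspose, blk_mul, blk_mul]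
  congr 1 <;> simp

lemma blk_unitary {m : ℕ} (U : Matrix (Fin m) (Fin m) ℂ) (hU : U * Uᴴ = 1) :
    blk 1 0 0 U * (blk 1 0 0 U)ᴴ = 1 := by
  rw [blk_conjTranspose, blk_mul, ← blk_one, hU]
  congr 1 <;> simp

lemma pw_conj {m : ℕ} (U N : Matrix (Fin m) (Fin m) ℂ) (hU : U * Uᴴ = 1) :
    pw (U * N * Uᴴ) = pw N := by
  by_cases h : N.PosDef
  · rw [pw_of_pos h, pw_of_pos ((posDef_conj_iff hU).2 h), det_mul, det_mul, mul_right_comm,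
      ← det_mul, hU, det_one, one_mul]
  · rw [pw_of_not h, pw_of_not (fun h' => h ((posDef_conj_iff hU).1 h'))]

lemma uinv_step {m : ℕ} (Ψ : Matrix (Fin (m + 1)) (Fin (m + 1)) ℂ → ENNReal) (hΨ : UInv Ψ) (u : ℝ) :
    UInv fun B : Matrix (Fin m) (Fin m) ℂ => pw ((u : ℂ) • 1 - B) * Ψ (bd u B) := by
  intro U B hU
  have : (u : ℂ) • 1 - U * B * Uᴴ = U * ((u : ℂ) • 1 - B) * Uᴴ := by
    rw [mul_sub, sub_mul, mul_smul_comm, mul_one, smul_mul_assoc, hU]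
  simp only
  rw [this, pw_conj _ _ hU, bd_conj, hΨ _ _ (blk_unitary U hU)]

/-- The region where the zeroth coordinate is the strict maximum. -/
def Om (m : ℕ) : Set (Fin (m + 1) → ℝ) := {l | ∀ j : Fin m, l j.succ < l 0}

lemma isOpen_Om (m : ℕ) : IsOpen (Om m) := by
  have : Om m = ⋂ j : Fin m, {l | l j.succ < l 0} := by ext; simp [Om]
  rw [this]
  exact isOpen_iInter_of_finite fun j => isOpen_lt (by fun_prop) (by fun_prop)

lemma pw_dg {m : ℕ} (u : ℝ) (y : Fin m → ℝ) [Decidable (∀ j, y j < u)] :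
    pw ((u : ℂ) • 1 - dg y) = if ∀ j, y j < u then ENNReal.ofReal ((∏ j, (u - y j)) ^ 2) else 0 := by
  have h1 : (1 : Matrix (Fin m) (Fin m) ℂ) * (1 : Matrix (Fin m) (Fin m) ℂ)ᴴ = 1 := by simp
  have h2 := u_sub_posDef h1 y u
  have h3 := u_sub_conj h1 y u
  simp only [conjTranspose_one, mul_one, one_mul] at h2 h3
  rw [dg]
  by_cases h : ∀ j, y j < u
  · rw [if_pos h, pw_of_pos (h2.2 h), h3, det_diagonal, ← Complex.ofReal_prod,
      Complex.normSq_ofReal, sq]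
  · rw [if_neg h, pw_of_not (fun h' => h (h2.1 h'))]

lemma lint_cons {m : ℕ} (f : (Fin (m + 1) → ℝ) → ENNReal) (hf : Measurable f) :
    ∫⁻ l, f l = ∫⁻ u : ℝ, ∫⁻ y : Fin m → ℝ, f (Fin.cons u y) := by
  have e := (volume_preserving_piFinSuccAbove (fun _ : Fin (m + 1) => ℝ) 0).symm
  rw [← e.lintegral_comp hf, Measure.volume_eq_prod]
  refine (lintegral_prod _ ((hf.comp e.measurable).aemeasurable)).trans ?_
  refine lintegral_congr fun u => lintegral_congr fun y => ?_
  simp [MeasurableEquiv.piFinSuccAbove, Fin.insertNthEquiv, Fin.insertNth_zero]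

/-- The Weyl integration formula property. -/
def Weyl (m : ℕ) : Prop := ∃ κ : ENNReal, ∀ Ψ : Matrix (Fin m) (Fin m) ℂ → ENNReal, UInv Ψ →
  Measurable Ψ → ∫⁻ X : HC m, Ψ (herm X) = κ * ∫⁻ y : Fin m → ℝ, ENNReal.ofReal (vd2 y) * Ψ (dg y)

/-- The ordered Weyl integration formula property. -/
def WeylO (m : ℕ) : Prop := ∃ κ : ENNReal,
  ∀ Ψ : Matrix (Fin (m + 1)) (Fin (m + 1)) ℂ → ENNReal, UInv Ψ →
  Measurable Ψ → ∫⁻ X : HC (m + 1), Ψ (herm X) = κ * ∫⁻ l in Om m, ENNReal.ofReal (vd2 l) * Ψ (dg l)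

lemma weylO_of_weyl {m : ℕ} (h : Weyl m) : WeylO m := by
  classical
  obtain ⟨κ, hκ⟩ := h
  refine ⟨kap m * κ, fun Ψ hΨ hm => ?_⟩
  have hmeas : Measurable fun l : Fin (m + 1) → ℝ => ENNReal.ofReal (vd2 l) * Ψ (dg l) :=
    (ENNReal.measurable_ofReal.comp continuous_vd2.measurable).mul
      (hm.comp continuous_dg.measurable)
  have hmeas2 : Measurable ((Om m).indicator
      fun l : Fin (m + 1) → ℝ => ENNReal.ofReal (vd2 l) * Ψ (dg l)) :=
    hmeas.indicator (isOpen_Om m).measurableSet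
  rw [one_step Ψ hΨ hm, mul_assoc]
  congr 1
  rw [← lintegral_indicator (isOpen_Om m).measurableSet, lint_cons _ hmeas2]
  rw [← lintegral_const_mul]
  swap
  · have : Measurable fun p : ℝ × (Fin m → ℝ) => (Om m).indicator
      (fun l : Fin (m + 1) → ℝ => ENNReal.ofReal (vd2 l) * Ψ (dg l)) (Fin.cons p.1 p.2) := by
      refine hmeas2.comp (Continuous.measurable ?_)
      refine continuous_pi fun i => ?_
      refine Fin.cases ?_ (fun i => ?_) i
      · simp only [Fin.cons_zero]; fun_prop
      · simp only [Fin.cons_succ]; fun_prop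
    exact this.lintegral_prod_right'
  refine lintegral_congr fun u => ?_
  have hm' : Measurable fun B : Matrix (Fin m) (Fin m) ℂ => pw ((u : ℂ) • 1 - B) * Ψ (bd u B) := by
    refine (measurable_pw.comp (Continuous.measurable ?_)).mul (hm.comp (measurable_bd u))
    fun_prop
  rw [hκ (fun B => pw ((u : ℂ) • 1 - B) * Ψ (bd u B)) (uinv_step Ψ hΨ u) hm']
  congr 1
  refine lintegral_congr fun y => ?_
  rw [bd_dg, pw_dg]
  by_cases hy : ∀ j, y j < u
  · rw [if_pos hy, Set.indicator_of_mem (by simpa [Om] using hy), vd2_cons,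
      ENNReal.ofReal_mul (sq_nonneg _)]
    ring
  · rw [if_neg hy, Set.indicator_of_notMem (by simpa [Om] using hy)]
    simp

end GUEGap

namespace GUEGap
open scoped ComplexOrder

/-- region where coordinate `i` is the strict maximum -/
def Omi {m : ℕ} (i : Fin (m + 1)) : Set (Fin (m + 1) → ℝ) := {l | ∀ k, k ≠ i → l k < l i}

lemma Omi_zero (m : ℕ) : Omi (0 : Fin (m + 1)) = Om m := by
  ext l
  constructor
  · intro h j; exact h _ (Fin.succ_ne_zero j)
  · intro h k hk
    obtain ⟨j, rfl⟩ := Fin.exists_succ_eq.2 hk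
    exact h j

lemma measurableSet_Omi {m : ℕ} (i : Fin (m + 1)) : MeasurableSet (Omi i) := by
  have : Omi i = ⋂ k, ⋂ (_ : k ≠ i), {l | l k < l i} := by ext; simp [Omi]
  rw [this]
  refine MeasurableSet.iInter fun k => MeasurableSet.iInter fun _ => ?_
  exact measurableSet_lt (by fun_prop) (by fun_prop)

lemma null_eq {m : ℕ} (i j : Fin m) (hij : i ≠ j) :
    volume {l : Fin m → ℝ | l i = l j} = 0 := by
  let f : (Fin m → ℝ) →ₗ[ℝ] ℝ := LinearMap.proj (R := ℝ) (φ := fun _ : Fin m => ℝ) i - LinearMap.proj j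
  have h : {l : Fin m → ℝ | l i = l j} = (LinearMap.ker f : Set (Fin m → ℝ)) := by
    ext l; simp [f, sub_eq_zero]
  rw [h]
  refine Measure.addHaar_submodule _ _ ?_
  intro h
  rw [LinearMap.ker_eq_top] at h
  have := congrArg (fun g => g (Pi.single i 1)) h
  simp [f, hij] at this

lemma ae_inj (m : ℕ) : ∀ᵐ l : Fin m → ℝ, Function.Injective l := by
  have : ∀ i j : Fin m, i ≠ j → ∀ᵐ l : Fin m → ℝ, l i ≠ l j := by
    intro i j hij
    rw [ae_iff]; simpa using null_eq i j hij
  have h2 : ∀ᵐ l : Fin m → ℝ, ∀ i j : Fin m, i ≠ j → l i ≠ l j := by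
    rw [ae_all_iff]; intro i; rw [ae_all_iff]; intro j
    by_cases hij : i = j
    · simp [hij]
    · filter_upwards [this i j hij] with l hl _ using hl
  filter_upwards [h2] with l hl i j hij
  by_contra h; exact hl i j h hij

lemma perm_mp {m : ℕ} (σ : Equiv.Perm (Fin m)) :
    MeasurePreserving (fun l : Fin m → ℝ => l ∘ σ) volume volume := by
  have := (volume_measurePreserving_piCongrLeft (fun _ : Fin m => ℝ) σ).symm
  convert this using 1
  ext l i; rfl

lemma lint_symm {m : ℕ} (f : (Fin (m + 1) → ℝ) → ENNReal) (hf : Measurable f)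
    (hs : ∀ l (σ : Equiv.Perm (Fin (m + 1))), f (l ∘ σ) = f l) :
    ∫⁻ l, f l = (m + 1 : ENNReal) * ∫⁻ l in Om m, f l := by
  have h1 : (⋃ i : Fin (m + 1), Omi i) =ᵐ[volume] (Set.univ : Set (Fin (m + 1) → ℝ)) := by
    rw [Filter.eventuallyEq_set]
    filter_upwards [ae_inj (m + 1)] with l hl
    simp only [Set.mem_iUnion, Set.mem_univ, iff_true]
    obtain ⟨i, hi⟩ := Finite.exists_max l
    exact ⟨i, fun k hk => lt_of_le_of_ne (hi k) (fun h => hk (hl h))⟩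
  rw [← setLIntegral_univ, ← setLIntegral_congr h1, lintegral_iUnion measurableSet_Omi]
  · rw [tsum_fintype]
    have : ∀ i : Fin (m + 1), ∫⁻ l in Omi i, f l = ∫⁻ l in Om m, f l := by
      intro i
      rw [← Omi_zero, ← (perm_mp (Equiv.swap 0 i)).setLIntegral_comp_preimage (measurableSet_Omi 0) hf]
      simp only [hs]
      congr 2
      ext l
      simp only [Omi, Set.mem_setOf_eq, Set.mem_preimage, Function.comp_apply, Equiv.swap_apply_left]
      constructor
      · intro h k hk
        refine h _ fun h' => hk ?_
        rw [Equiv.swap_apply_eq_iff] at h'; simpa using h'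
      · intro h k hk
        have := h (Equiv.swap 0 i k) (fun h' => hk (by
          rw [Equiv.swap_apply_eq_iff] at h'; simpa using h'))
        simpa using this
    simp [this]
  · intro i j hij
    rw [Function.onFun, Set.disjoint_left]
    intro l h1 h2
    exact absurd (h1 j hij.symm) (not_lt.2 (h2 i hij).le)

lemma dg_perm {m : ℕ} {β : Type*} (Ψ : Matrix (Fin m) (Fin m) ℂ → β) (hΨ : UInv Ψ) (y : Fin m → ℝ)
    (σ : Equiv.Perm (Fin m)) : Ψ (dg (y ∘ σ)) = Ψ (dg y) := by
  have hU : (σ.permMatrix ℂ) * (σ.permMatrix ℂ)ᴴ = 1 := by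
    rw [conjTranspose_permMatrix, ← permMatrix_mul]; simp
  rw [← hΨ _ (dg y) hU]
  congr 1
  rw [conjTranspose_permMatrix, PEquiv.toMatrix_toPEquiv_mul, PEquiv.mul_toMatrix_toPEquiv]
  ext i j
  have : (Equiv.symm σ⁻¹) j = σ j := rfl
  simp [dg, diagonal_apply, this]

lemma weyl_zero : Weyl 0 := by
  refine ⟨1, fun Ψ _ _ => ?_⟩
  have h1 : (volume : Measure (HC 0)) = Measure.dirac default := Measure.pi_of_empty _ _
  have h2 : (volume : Measure (Fin 0 → ℝ)) = Measure.dirac default := Measure.pi_of_empty _ _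
  rw [h1, h2, lintegral_dirac, lintegral_dirac, one_mul]
  rw [show herm (default : HC 0) = dg default from Subsingleton.elim _ _]
  simp [vd2]

lemma weyl_succ {m : ℕ} (h : Weyl m) : Weyl (m + 1) := by
  obtain ⟨κ, hκ⟩ := weylO_of_weyl h
  refine ⟨κ / (m + 1 : ENNReal), fun Ψ hΨ hm => ?_⟩
  have hmeas : Measurable fun l : Fin (m + 1) → ℝ => ENNReal.ofReal (vd2 l) * Ψ (dg l) :=
    (ENNReal.measurable_ofReal.comp continuous_vd2.measurable).mul
      (hm.comp continuous_dg.measurable)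
  rw [hκ Ψ hΨ hm, lint_symm _ hmeas fun l σ => by rw [vd2_perm, dg_perm Ψ hΨ], ← mul_assoc,
    ENNReal.div_mul_cancel (by simp) (by finiteness)]

lemma weylO_all (m : ℕ) : WeylO m := by
  have : ∀ m, Weyl m := fun m => by
    induction m with
    | zero => exact weyl_zero
    | succ m ih => exact weyl_succ ih
  exact weylO_of_weyl (this m)

end GUEGap

namespace GUEGap
open scoped ComplexOrder

/-- Gaussian weight on eigenvalues -/
noncomputable def ew {m : ℕ} (l : Fin m → ℝ) : ℝ := Real.exp (-(∑ i, l i ^ 2) / 2)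

lemma ew_pos {m : ℕ} (l : Fin m → ℝ) : 0 < ew l := Real.exp_pos _

lemma continuous_ew {m : ℕ} : Continuous (ew (m := m)) := by unfold ew; fun_prop

lemma int_pow_gauss (k : ℕ) : Integrable fun s : ℝ => s ^ k * Real.exp (-s ^ 2 / 2) := by
  have := integrable_rpow_mul_exp_neg_mul_sq (b := 1 / 2) (by norm_num) (s := k)
    (by have : (0 : ℝ) ≤ k := by positivity
        linarith)
  refine this.congr (Filter.Eventually.of_forall fun s => ?_)
  simp only [Real.rpow_natCast]
  congr 2; ring

lemma int_poly {m : ℕ} (p : MvPolynomial (Fin m) ℝ) :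
    Integrable fun l : Fin m → ℝ => MvPolynomial.eval l p * ew l := by
  induction p using MvPolynomial.induction_on' with
  | monomial a c =>
    have h : Integrable (fun l : Fin m → ℝ => ∏ i, (l i ^ a i * Real.exp (-(l i) ^ 2 / 2))) :=
      Integrable.fintype_prod (f := fun i s => s ^ a i * Real.exp (-s ^ 2 / 2)) fun i => int_pow_gauss _
    refine (h.const_mul c).congr (Filter.Eventually.of_forall fun l => ?_)
    simp only [MvPolynomial.eval_monomial, ew, Finset.prod_mul_distrib, ← Real.exp_sum,
      Finsupp.prod_pow, ← Finset.sum_div, Finset.sum_neg_distrib]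
    ring
  | add p q hp hq =>
    refine (hp.add hq).congr (Filter.Eventually.of_forall fun l => ?_)
    simp [add_mul]

lemma int_poly1 (p : Polynomial ℝ) :
    Integrable fun s : ℝ => p.eval s * Real.exp (-s ^ 2 / 2) := by
  induction p using Polynomial.induction_on' with
  | monomial a c =>
    refine ((int_pow_gauss a).const_mul c).congr (Filter.Eventually.of_forall fun l => ?_)
    simp [Polynomial.eval_monomial, mul_assoc]
  | add p q hp hq =>
    refine (hp.add hq).congr (Filter.Eventually.of_forall fun l => ?_)
    simp [add_mul]

lemma hasDeriv_path {m : ℕ} (γ : ℝ → Fin m → ℝ) (i : Fin m) (s : ℝ)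
    (h : ∀ k, HasDerivAt (fun t => γ t k) (if k = i then 1 else 0) s) (p : MvPolynomial (Fin m) ℝ) :
    HasDerivAt (fun t => MvPolynomial.eval (γ t) p) (MvPolynomial.eval (γ s) (MvPolynomial.pderiv i p)) s := by
  induction p using MvPolynomial.induction_on with
  | C a =>
    simp only [MvPolynomial.eval_C, MvPolynomial.pderiv_C, map_zero]
    exact hasDerivAt_const s a
  | add p q hp hq =>
    simp only [map_add]
    exact hp.add hq
  | mul_X p k hp =>
    have := hp.mul (h k)
    simp only [Derivation.leibniz, MvPolynomial.eval_mul, MvPolynomial.eval_X, smul_eq_mul,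
      MvPolynomial.eval_add, MvPolynomial.pderiv_X, Pi.single_apply]
    refine this.congr_deriv ?_
    split_ifs with h1 <;> simp <;> ring

lemma insertNth_deriv {m : ℕ} (i : Fin (m + 1)) (y : Fin m → ℝ) (s : ℝ) (k : Fin (m + 1)) :
    HasDerivAt (fun t => (i.insertNth t y : Fin (m + 1) → ℝ) k) (if k = i then 1 else 0) s := by
  rcases Fin.eq_self_or_eq_succAbove i k with h | ⟨j, rfl⟩
  · subst h
    simp only [Fin.insertNth_apply_same, if_true]
    exact hasDerivAt_id s
  · simpa [Fin.succAbove_ne] using hasDerivAt_const s (y j)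

lemma ew_insertNth {m : ℕ} (i : Fin (m + 1)) (y : Fin m → ℝ) (s : ℝ) :
    ew (i.insertNth s y : Fin (m + 1) → ℝ) = ew y * Real.exp (-s ^ 2 / 2) := by
  rw [ew, ew, ← Real.exp_add, Fin.sum_univ_succAbove _ i]
  simp only [Fin.insertNth_apply_same, Fin.insertNth_apply_succAbove]
  congr 1; ring

lemma int_slice {m : ℕ} (i : Fin (m + 1)) (y : Fin m → ℝ) (p : MvPolynomial (Fin (m + 1)) ℝ) :
    Integrable fun s : ℝ => MvPolynomial.eval (i.insertNth s y : Fin (m + 1) → ℝ) p *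
      ew (i.insertNth s y : Fin (m + 1) → ℝ) := by
  have := (int_poly1 (MvPolynomial.aeval
    (i.insertNth Polynomial.X (fun j => Polynomial.C (y j)) : Fin (m + 1) → Polynomial ℝ) p)).const_mul (ew y)
  refine this.congr (Filter.Eventually.of_forall fun s => ?_)
  simp only [ew_insertNth]
  clear this
  have h : Polynomial.eval s (MvPolynomial.aeval
    (i.insertNth Polynomial.X (fun j => Polynomial.C (y j)) : Fin (m + 1) → Polynomial ℝ) p) =
    MvPolynomial.eval (i.insertNth s y : Fin (m + 1) → ℝ) p := by
    induction p using MvPolynomial.induction_on with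
    | C a => simp
    | add p q hp hq => simp [hp, hq]
    | mul_X p k hp =>
      simp only [map_mul, MvPolynomial.aeval_X, Polynomial.eval_mul, hp, MvPolynomial.eval_X]
      congr 1
      rcases Fin.eq_self_or_eq_succAbove i k with h | ⟨j, rfl⟩
      · subst h; simp
      · simp
  rw [h]; ring

lemma slice_deriv {m : ℕ} (i : Fin (m + 1)) (y : Fin m → ℝ) (p : MvPolynomial (Fin (m + 1)) ℝ) (s : ℝ) :
    HasDerivAt (fun s : ℝ => MvPolynomial.eval (i.insertNth s y : Fin (m + 1) → ℝ) p *
      ew (i.insertNth s y : Fin (m + 1) → ℝ))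
      (MvPolynomial.eval (i.insertNth s y : Fin (m + 1) → ℝ)
        (MvPolynomial.pderiv i p - MvPolynomial.X i * p) * ew (i.insertNth s y : Fin (m + 1) → ℝ)) s := by
  have h1 := hasDeriv_path (fun s => (i.insertNth s y : Fin (m + 1) → ℝ)) i s
    (insertNth_deriv i y s) p
  have h2 : HasDerivAt (fun s : ℝ => ew (i.insertNth s y : Fin (m + 1) → ℝ))
      (-s * ew (i.insertNth s y : Fin (m + 1) → ℝ)) s := by
    simp only [ew_insertNth]
    have h3 : HasDerivAt (fun s : ℝ => -s ^ 2 / 2) (-s) s := by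
      refine ((hasDerivAt_pow 2 s).neg.div_const 2).congr_deriv ?_
      simp; ring
    refine (h3.exp.const_mul (ew y)).congr_deriv ?_
    ring
  refine (h1.mul h2).congr_deriv ?_
  simp only [map_sub, map_mul, MvPolynomial.eval_X, Fin.insertNth_apply_same]
  ring

lemma ibp {m : ℕ} (i : Fin (m + 1)) (p : MvPolynomial (Fin (m + 1)) ℝ)
    (hp : ∀ l : Fin (m + 1) → ℝ, (∃ j : Fin m, l 0 = l j.succ) → MvPolynomial.eval l p = 0) :
    ∫ l in Om m, MvPolynomial.eval l (MvPolynomial.pderiv i p - MvPolynomial.X i * p) * ew l = 0 := by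
  classical
  obtain ⟨q, hq⟩ : ∃ q, q = MvPolynomial.pderiv i p - MvPolynomial.X i * p := ⟨_, rfl⟩
  rw [← hq]
  have hO : MeasurableSet (Om m) := (isOpen_Om m).measurableSet
  rw [← integral_indicator hO]
  have e := (volume_preserving_piFinSuccAbove (fun _ : Fin (m + 1) => ℝ) i).symm
  have hI : Integrable ((Om m).indicator fun l => MvPolynomial.eval l q * ew l) :=
    (int_poly q).indicator hO
  rw [← e.integral_comp (MeasurableEquiv.measurableEmbedding _), Measure.volume_eq_prod]
  have hI2 := (e.integrable_comp_emb (MeasurableEquiv.measurableEmbedding _)).2 hI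
  rw [Measure.volume_eq_prod] at hI2
  refine (integral_prod_symm _ hI2).trans ?_
  refine (integral_congr_ae (Filter.Eventually.of_forall fun y => ?_)).trans (integral_zero _ _)
  change ∫ s : ℝ, (Om m).indicator (fun l => MvPolynomial.eval l q * ew l) (i.insertNth s y) = 0
  have hind : (fun s : ℝ => (Om m).indicator (fun l => MvPolynomial.eval l q * ew l) (i.insertNth s y)) =
      ((fun s : ℝ => (i.insertNth s y : Fin (m + 1) → ℝ)) ⁻¹' (Om m)).indicator
        fun s => MvPolynomial.eval (i.insertNth s y : Fin (m + 1) → ℝ) q *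
          ew (i.insertNth s y : Fin (m + 1) → ℝ) := by
    ext s; simp [Set.indicator_apply]
  rw [hind]
  have hc : Continuous fun s : ℝ => (i.insertNth s y : Fin (m + 1) → ℝ) :=
    continuous_pi fun k => continuous_iff_continuousAt.2 fun s => (insertNth_deriv i y s k).continuousAt
  rw [integral_indicator ((isOpen_Om m).preimage hc).measurableSet]
  have hd := slice_deriv i y p
  rw [← hq] at hd
  have hi1 := int_slice i y p
  have hi2 := int_slice i y q
  have cIoi : ∀ a : ℝ, MvPolynomial.eval (i.insertNth a y : Fin (m + 1) → ℝ) p = 0 →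
      ∫ s in Set.Ioi a, MvPolynomial.eval (i.insertNth s y : Fin (m + 1) → ℝ) q *
          ew (i.insertNth s y : Fin (m + 1) → ℝ) = 0 := by
    intro a ha
    rw [integral_Ioi_of_hasDerivAt_of_tendsto' (fun x _ => hd x) hi2.integrableOn
      (tendsto_zero_of_hasDerivAt_of_integrableOn_Ioi (a := a) (fun x _ => hd x) hi2.integrableOn
        hi1.integrableOn), ha]
    simp
  have cIio : ∀ a : ℝ, MvPolynomial.eval (i.insertNth a y : Fin (m + 1) → ℝ) p = 0 →
      ∫ s in Set.Iio a, MvPolynomial.eval (i.insertNth s y : Fin (m + 1) → ℝ) q *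
          ew (i.insertNth s y : Fin (m + 1) → ℝ) = 0 := by
    intro a ha
    rw [← integral_Iic_eq_integral_Iio, integral_Iic_of_hasDerivAt_of_tendsto' (fun x _ => hd x) hi2.integrableOn
      (tendsto_zero_of_hasDerivAt_of_integrableOn_Iic (a := a) (fun x _ => hd x) hi2.integrableOn
        hi1.integrableOn), ha]
    simp
  obtain rfl | ⟨j, rfl⟩ := Fin.eq_zero_or_eq_succ i
  · rcases isEmpty_or_nonempty (Fin m) with hm | hm
    · have : (fun s : ℝ => ((0 : Fin (m + 1)).insertNth s y : Fin (m + 1) → ℝ)) ⁻¹' (Om m) = Set.univ := by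
        ext s; simp [Om]
      rw [this, setIntegral_univ]
      exact integral_eq_zero_of_hasDerivAt_of_integrable hd hi2 hi1
    · obtain ⟨j, hj⟩ := Finite.exists_max y
      have : (fun s : ℝ => ((0 : Fin (m + 1)).insertNth s y : Fin (m + 1) → ℝ)) ⁻¹' (Om m) =
          Set.Ioi (y j) := by
        ext s
        simp only [Om, Set.mem_preimage, Set.mem_ofPred_eq, Fin.insertNth_zero, Fin.cons_succ,
          Fin.cons_zero, Set.mem_Ioi]
        exact ⟨fun h => h j, fun h k => (hj k).trans_lt h⟩
      rw [this]
      exact cIoi _ (hp _ ⟨j, by simp⟩)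
  · have h0 : ∃ a : ℝ, ∀ s : ℝ, (j.succ.insertNth s y : Fin (m + 1) → ℝ) 0 = a := by
      obtain ⟨k, hk⟩ := Fin.exists_succAbove_eq (Fin.succ_ne_zero j).symm
      refine ⟨y k, fun s => ?_⟩
      rw [← hk]; simp
    obtain ⟨a, ha⟩ := h0
    have hk : ∀ k : Fin m, k ≠ j → ∃ b : ℝ, ∀ s : ℝ, (j.succ.insertNth s y : Fin (m + 1) → ℝ) k.succ = b := by
      intro k hk
      obtain ⟨k', hk'⟩ := Fin.exists_succAbove_eq (x := k.succ) (y := j.succ) (by simpa using hk)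
      refine ⟨y k', fun s => ?_⟩
      rw [← hk']; simp
    choose! b hb using hk
    by_cases hab : ∀ k, k ≠ j → b k < a
    · have : (fun s : ℝ => (j.succ.insertNth s y : Fin (m + 1) → ℝ)) ⁻¹' (Om m) = Set.Iio a := by
        ext s
        simp only [Om, Set.mem_preimage, Set.mem_ofPred_eq, Set.mem_Iio, ha]
        constructor
        · intro h; simpa using h j
        · intro h k
          by_cases hk : k = j
          · subst hk; simpa using h
          · rw [hb k hk]; exact hab k hk
      rw [this]
      exact cIio _ (hp _ ⟨j, by rw [ha]; simp⟩)
    · have : (fun s : ℝ => (j.succ.insertNth s y : Fin (m + 1) → ℝ)) ⁻¹' (Om m) = ∅ := by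
        push Not at hab
        obtain ⟨k, hk, hk2⟩ := hab
        ext s
        simp only [Om, Set.mem_preimage, Set.mem_ofPred_eq, ha, Set.mem_empty_iff_false, iff_false]
        intro h
        have := h k
        rw [hb k hk] at this
        linarith
      rw [this]; simp

end GUEGap

namespace GUEGap
open scoped ComplexOrder
open MvPolynomial (pderiv)

/-- abbreviation for the polynomial ring -/
abbrev Pol (m : ℕ) := MvPolynomial (Fin (m + 1)) ℝ

lemma pd_prod {n : ℕ} {ι : Type*} [DecidableEq ι] (i : Fin n) (s : Finset ι) (f : ι → MvPolynomial (Fin n) ℝ) :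
    pderiv i (∏ j ∈ s, f j) = ∑ j ∈ s, (∏ k ∈ s.erase j, f k) * pderiv i (f j) := by
  induction s using Finset.induction_on with
  | empty => simp
  | insert a s ha ih =>
    rw [Finset.prod_insert ha, Finset.sum_insert ha, Derivation.leibniz, ih, Finset.erase_insert ha,
      smul_eq_mul, smul_eq_mul, add_comm, Finset.mul_sum]
    congr 1
    refine Finset.sum_congr rfl fun j hj => ?_
    have : a ≠ j := fun h => ha (h ▸ hj)
    rw [Finset.erase_insert_of_ne this, Finset.prod_insert (by simp [ha])]
    ring

lemma pd_log {n : ℕ} {ι : Type*} (i : Fin n) (s : Finset ι) (f : ι → MvPolynomial (Fin n) ℝ)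
    (l : Fin n → ℝ) (h : ∀ j ∈ s, MvPolynomial.eval l (f j) ≠ 0) :
    MvPolynomial.eval l (pderiv i (∏ j ∈ s, f j)) = MvPolynomial.eval l (∏ j ∈ s, f j) *
      ∑ j ∈ s, MvPolynomial.eval l (pderiv i (f j)) / MvPolynomial.eval l (f j) := by
  classical
  rw [pd_prod, map_sum, Finset.mul_sum]
  refine Finset.sum_congr rfl fun j hj => ?_
  rw [← Finset.mul_prod_erase s f hj, map_mul, map_mul]
  have := h j hj
  field_simp

/-- `X 0 - X j` -/
noncomputable def fj {m : ℕ} (j : Fin m) : Pol m := MvPolynomial.X 0 - MvPolynomial.X j.succ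
/-- squared Vandermonde of the lower variables -/
noncomputable def Apol (m : ℕ) : Pol m :=
  ∏ i : Fin m, ∏ j ∈ Finset.Ioi i, (MvPolynomial.X j.succ - MvPolynomial.X i.succ) ^ 2
/-- squared Vandermonde -/
noncomputable def PP (m : ℕ) : Pol m := (∏ j : Fin m, fj j ^ 2) * Apol m
/-- `PP / fj^2` -/
noncomputable def Pjj {m : ℕ} (j : Fin m) : Pol m := (∏ k ∈ Finset.univ.erase j, fj k ^ 2) * Apol m
/-- `PP / fj` -/
noncomputable def Pj {m : ℕ} (j : Fin m) : Pol m := fj j * Pjj j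
/-- sum of `Pjj` -/
noncomputable def QP (m : ℕ) : Pol m := ∑ j : Fin m, Pjj j
/-- first Stein polynomial -/
noncomputable def RR (m : ℕ) : Pol m := pderiv 0 (PP m) - MvPolynomial.X 0 * PP m
/-- polynomial for `D^2 P` -/
noncomputable def DP2 (m : ℕ) : Pol m := pderiv 0 (RR m) - MvPolynomial.X 0 * RR m + PP m + 2 * QP m

lemma fj_Pj {m : ℕ} (j : Fin m) : fj j * Pj j = PP m := by
  rw [Pj, Pjj, PP, ← Finset.mul_prod_erase _ _ (Finset.mem_univ j)]; ring

lemma pd_fj0 {m : ℕ} (j : Fin m) : pderiv 0 (fj j) = 1 := by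
  simp [fj, MvPolynomial.pderiv_X, Pi.single_apply]

lemma pd_fj {m : ℕ} (i j : Fin m) : pderiv i.succ (fj j) = if j = i then -1 else 0 := by
  simp [fj, MvPolynomial.pderiv_X, Pi.single_apply, (Fin.succ_ne_zero i).symm]
  split_ifs <;> simp

lemma pd_A0 (m : ℕ) : pderiv 0 (Apol m) = 0 := by
  rw [Apol, pd_prod]
  refine Finset.sum_eq_zero fun j _ => ?_
  rw [pd_prod, Finset.sum_eq_zero, mul_zero]
  intro k _
  simp [Derivation.leibniz_pow, MvPolynomial.pderiv_X, Pi.single_apply]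

lemma pd_PP (m : ℕ) : pderiv 0 (PP m) = ∑ j : Fin m, 2 * Pj j := by
  rw [PP, Derivation.leibniz, pd_A0, smul_zero, zero_add, pd_prod, smul_eq_mul, Finset.mul_sum]
  refine Finset.sum_congr rfl fun j _ => ?_
  rw [Derivation.leibniz_pow, pd_fj0, Pj, Pjj]
  simp
  ring

lemma Pj_van {m : ℕ} (j k : Fin m) (l : Fin (m + 1) → ℝ) (h : l 0 = l k.succ) :
    MvPolynomial.eval l (Pj j) = 0 := by
  by_cases hjk : j = k
  · subst hjk; simp [Pj, fj, h]
  · rw [Pj, Pjj, ← Finset.mul_prod_erase _ _ (Finset.mem_erase.2 ⟨Ne.symm hjk, Finset.mem_univ k⟩)]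
    simp [fj, h]

lemma PP_van {m : ℕ} (k : Fin m) (l : Fin (m + 1) → ℝ) (h : l 0 = l k.succ) :
    MvPolynomial.eval l (PP m) = 0 := by
  rw [← fj_Pj k, map_mul, Pj_van k k l h, mul_zero]

lemma RR_van {m : ℕ} (k : Fin m) (l : Fin (m + 1) → ℝ) (h : l 0 = l k.succ) :
    MvPolynomial.eval l (RR m) = 0 := by
  rw [RR, pd_PP, map_sub, map_mul, PP_van k l h, map_sum, Finset.sum_eq_zero]
  · simp
  · intro j _; rw [map_mul, Pj_van j k l h, mul_zero]

/-- sum of inverse gaps -/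
noncomputable def Ssum {m : ℕ} (l : Fin (m + 1) → ℝ) : ℝ := ∑ j : Fin m, 1 / (l 0 - l j.succ)
/-- sum of inverse squared gaps -/
noncomputable def Qsum {m : ℕ} (l : Fin (m + 1) → ℝ) : ℝ := ∑ j : Fin m, 1 / (l 0 - l j.succ) ^ 2
/-- the drift -/
noncomputable def Dd {m : ℕ} (l : Fin (m + 1) → ℝ) : ℝ := l 0 - 2 * Ssum l

lemma eval_PP {m : ℕ} (l : Fin (m + 1) → ℝ) : MvPolynomial.eval l (PP m) = vd2 l := by
  obtain ⟨u, y, rfl⟩ : ∃ u y, l = Fin.cons u y := ⟨l 0, Fin.tail l, (Fin.cons_self_tail l).symm⟩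
  rw [vd2_cons, vd2, det_vandermonde, PP, Apol]
  simp [fj, Finset.prod_pow, MvPolynomial.eval_prod]

lemma eval_fj {m : ℕ} (j : Fin m) (l : Fin (m + 1) → ℝ) : MvPolynomial.eval l (fj j) = l 0 - l j.succ := by
  simp [fj]


lemma eval_Pj {m : ℕ} (l : Fin (m + 1) → ℝ) (hl : ∀ j : Fin m, l 0 - l j.succ ≠ 0) (j : Fin m) : MvPolynomial.eval l (Pj j) = vd2 l / (l 0 - l j.succ) := by
  rw [← eval_PP, ← fj_Pj j, map_mul, eval_fj]
  field_simp [hl j]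

lemma eval_Pjj {m : ℕ} (l : Fin (m + 1) → ℝ) (hl : ∀ j : Fin m, l 0 - l j.succ ≠ 0) (j : Fin m) : MvPolynomial.eval l (Pjj j) = vd2 l / (l 0 - l j.succ) ^ 2 := by
  have := eval_Pj l hl j
  rw [Pj, map_mul, eval_fj] at this
  have h := hl j
  field_simp at this ⊢
  linarith

lemma eval_QP {m : ℕ} (l : Fin (m + 1) → ℝ) (hl : ∀ j : Fin m, l 0 - l j.succ ≠ 0) : MvPolynomial.eval l (QP m) = vd2 l * Qsum l := by
  rw [QP, map_sum, Qsum, Finset.mul_sum]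
  exact Finset.sum_congr rfl fun j _ => by rw [eval_Pjj l hl]; ring

lemma eval_dPP {m : ℕ} (l : Fin (m + 1) → ℝ) (hl : ∀ j : Fin m, l 0 - l j.succ ≠ 0) : MvPolynomial.eval l (pderiv 0 (PP m)) = 2 * vd2 l * Ssum l := by
  rw [pd_PP, map_sum, Ssum, Finset.mul_sum]
  exact Finset.sum_congr rfl fun j _ => by rw [map_mul, eval_Pj l hl]; simp; ring

lemma eval_RR {m : ℕ} (l : Fin (m + 1) → ℝ) (hl : ∀ j : Fin m, l 0 - l j.succ ≠ 0) : MvPolynomial.eval l (RR m) = - (Dd l * vd2 l) := by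
  rw [RR, map_sub, eval_dPP l hl, map_mul, eval_PP, MvPolynomial.eval_X, Dd]; ring

lemma eval_d0Pj {m : ℕ} (l : Fin (m + 1) → ℝ) (hl : ∀ j : Fin m, l 0 - l j.succ ≠ 0) (j : Fin m) : MvPolynomial.eval l (pderiv 0 (Pj j)) =
    vd2 l * (2 * Ssum l / (l 0 - l j.succ) - 1 / (l 0 - l j.succ) ^ 2) := by
  have h1 := congrArg (fun p => MvPolynomial.eval l (pderiv 0 p)) (fj_Pj j)
  simp only [Derivation.leibniz, pd_fj0, smul_eq_mul, map_add, map_mul, eval_fj, eval_dPP l hl,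
    eval_Pj l hl, map_one] at h1
  have h := hl j
  field_simp at h1 ⊢
  linarith

lemma eval_DP2 {m : ℕ} (l : Fin (m + 1) → ℝ) (hl : ∀ j : Fin m, l 0 - l j.succ ≠ 0) : MvPolynomial.eval l (DP2 m) = Dd l ^ 2 * vd2 l := by
  have h : MvPolynomial.eval l (pderiv 0 (pderiv 0 (PP m))) = vd2 l * (4 * Ssum l ^ 2 - 2 * Qsum l) := by
    rw [pd_PP]
    simp only [map_sum, Derivation.leibniz, smul_eq_mul, map_add, map_mul, eval_d0Pj l hl]
    have : ∀ j : Fin m, MvPolynomial.eval l 2 * (vd2 l * (2 * Ssum l / (l 0 - l j.succ) - 1 / (l 0 - l j.succ) ^ 2))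
      + MvPolynomial.eval l (Pj j) * MvPolynomial.eval l (pderiv 0 (2 : Pol m)) =
      (4 * vd2 l * Ssum l) * (1 / (l 0 - l j.succ)) - 2 * vd2 l * (1 / (l 0 - l j.succ) ^ 2) := by
      intro j
      have h2 : pderiv 0 (2 : Pol m) = 0 := by
        rw [show (2 : Pol m) = MvPolynomial.C 2 from rfl, MvPolynomial.pderiv_C]
      rw [h2]; simp; ring
    rw [Finset.sum_congr rfl fun j _ => this j, Finset.sum_sub_distrib, ← Finset.mul_sum, ← Finset.mul_sum,
      ← Ssum, ← Qsum]
    ring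
  have h3 : MvPolynomial.eval l (pderiv 0 (RR m)) = vd2 l * (4 * Ssum l ^ 2 - 2 * Qsum l) - vd2 l
      - l 0 * (2 * vd2 l * Ssum l) := by
    rw [RR, map_sub, map_sub, h, Derivation.leibniz]
    simp [eval_dPP l hl, eval_PP]
    ring
  rw [DP2]
  simp only [map_add, map_sub, map_mul, h3, eval_RR l hl, eval_PP, eval_QP l hl, MvPolynomial.eval_X]
  simp [Dd]
  ring

lemma pdA {m : ℕ} (l : Fin (m + 1) → ℝ) (hl : Function.Injective l) (j : Fin m) :
    MvPolynomial.eval l (pderiv j.succ (Apol m)) = MvPolynomial.eval l (Apol m) *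
      ∑ k ∈ Finset.univ.erase j, 2 / (l j.succ - l k.succ) := by
  have hne : ∀ a b : Fin m, a ≠ b → l a.succ - l b.succ ≠ 0 := fun a b h h' =>
    h (Fin.succ_injective _ (hl (sub_eq_zero.1 h')))
  have hne2 : ∀ a : Fin m, ∀ b ∈ Finset.Ioi a, MvPolynomial.eval l
      ((MvPolynomial.X b.succ - MvPolynomial.X a.succ : Pol m) ^ 2) ≠ 0 := by
    intro a b hb
    have := hne b a (Finset.mem_Ioi.1 hb).ne'
    simpa using this
  rw [Apol, pd_log _ _ _ _ (fun a _ => by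
    rw [map_prod]; exact Finset.prod_ne_zero_iff.2 (hne2 a))]
  congr 1
  have h1 : ∀ a : Fin m, MvPolynomial.eval l (pderiv j.succ (∏ b ∈ Finset.Ioi a,
      (MvPolynomial.X b.succ - MvPolynomial.X a.succ : Pol m) ^ 2)) / MvPolynomial.eval l (∏ b ∈ Finset.Ioi a,
      (MvPolynomial.X b.succ - MvPolynomial.X a.succ : Pol m) ^ 2) =
      ∑ b, if a < b then ((if b = j then 2 / (l b.succ - l a.succ) else 0) +
        (if a = j then 2 / (l a.succ - l b.succ) else 0)) else 0 := by
    intro a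
    have h0 : MvPolynomial.eval l (∏ b ∈ Finset.Ioi a,
      (MvPolynomial.X b.succ - MvPolynomial.X a.succ : Pol m) ^ 2) ≠ 0 := by
      rw [map_prod]; exact Finset.prod_ne_zero_iff.2 (hne2 a)
    rw [pd_log _ _ _ _ (hne2 a), mul_div_cancel_left₀ _ h0, ← Finset.sum_filter]
    have : Finset.filter (fun b => a < b) Finset.univ = Finset.Ioi a := by ext; simp
    rw [this]
    refine Finset.sum_congr rfl fun b hb => ?_
    have h2 := hne b a (Finset.mem_Ioi.1 hb).ne'
    have h3 := hne a b (Finset.mem_Ioi.1 hb).ne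
    have h4 : l a.succ - l b.succ = - (l b.succ - l a.succ) := by ring
    simp only [Derivation.leibniz_pow, map_sub, MvPolynomial.pderiv_X, Pi.single_apply, map_pow,
      MvPolynomial.eval_X, h4, Fin.succ_inj]
    have : b ≠ a := (Finset.mem_Ioi.1 hb).ne'
    clear h4
    by_cases hb : b = j
    · subst hb
      rw [if_pos rfl, if_neg this.symm, if_pos rfl, if_neg this.symm]
      simp
      field_simp
    · by_cases ha : a = j
      · subst ha
        rw [if_neg this, if_pos rfl, if_neg this, if_pos rfl]
        simp
        field_simp
        ring
      · rw [if_neg hb, if_neg ha, if_neg hb, if_neg ha]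
        simp
  simp only [h1]
  have h5 : ∀ a b : Fin m, (if a < b then ((if b = j then 2 / (l b.succ - l a.succ) else 0) +
        (if a = j then 2 / (l a.succ - l b.succ) else 0)) else 0) =
      (if b = j then (if a < j then 2 / (l j.succ - l a.succ) else 0) else 0) +
      (if a = j then (if j < b then 2 / (l j.succ - l b.succ) else 0) else 0) := by
    intro a b
    split_ifs <;> simp_all
  simp only [h5, Finset.sum_add_distrib]
  rw [Finset.sum_comm (f := fun a b => if a = j then (if j < b then 2 / (l j.succ - l b.succ) else 0) else 0)]
  simp only [Finset.sum_ite_eq', Finset.mem_univ, if_true]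
  rw [← Finset.sum_add_distrib, ← Finset.sum_erase (a := j) _ (by simp)]
  refine Finset.sum_congr rfl fun k hk => ?_
  have := (Finset.mem_erase.1 hk).1
  rcases lt_or_gt_of_ne this with h | h
  · simp [h, h.not_gt]
  · simp [h, h.not_gt]

lemma eval_djPj {m : ℕ} (l : Fin (m + 1) → ℝ) (hl : Function.Injective l) (j : Fin m) :
    MvPolynomial.eval l (pderiv j.succ (Pj j)) = vd2 l * (- 1 / (l 0 - l j.succ) ^ 2 +
      ∑ k ∈ Finset.univ.erase j, 2 / ((l 0 - l j.succ) * (l j.succ - l k.succ))) := by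
  have hl0 : ∀ j : Fin m, l 0 - l j.succ ≠ 0 := fun j h => (Fin.succ_ne_zero j) (hl (sub_eq_zero.1 h)).symm
  have h1 : pderiv j.succ (Pj j) = - Pjj j + fj j * (∏ k ∈ Finset.univ.erase j, fj k ^ 2) *
      pderiv j.succ (Apol m) := by
    have h2 : pderiv j.succ (∏ k ∈ Finset.univ.erase j, fj k ^ 2) = 0 := by
      rw [pd_prod]
      refine Finset.sum_eq_zero fun k hk => ?_
      rw [Derivation.leibniz_pow, pd_fj, if_neg (Finset.mem_erase.1 hk).1]
      simp
    rw [Pj, Derivation.leibniz, pd_fj, if_pos rfl, Pjj, Derivation.leibniz, h2]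
    simp only [smul_eq_mul]
    ring
  rw [h1, map_add, map_neg, eval_Pjj l hl0, map_mul, pdA l hl j, ← mul_assoc, ← map_mul, mul_assoc (fj j),
    ← Pjj, ← Pj, eval_Pj l hl0, mul_add, Finset.mul_sum, Finset.mul_sum]
  congr 1
  · ring
  · refine Finset.sum_congr rfl fun k hk => ?_
    have h3 := hl0 j
    have h4 : l j.succ - l k.succ ≠ 0 := fun h' =>
      (Finset.mem_erase.1 hk).1 (Fin.succ_injective _ (hl (sub_eq_zero.1 h'))).symm
    field_simp

lemma eval_sum_c {m : ℕ} (l : Fin (m + 1) → ℝ) (hl : Function.Injective l) :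
    ∑ j : Fin m, MvPolynomial.eval l (pderiv j.succ (Pj j) - MvPolynomial.X j.succ * Pj j) =
      vd2 l * (Ssum l ^ 2 - 2 * Qsum l - l 0 * Ssum l + m) := by
  have hl0 : ∀ j : Fin m, l 0 - l j.succ ≠ 0 := fun j h => (Fin.succ_ne_zero j) (hl (sub_eq_zero.1 h)).symm
  have hne : ∀ a b : Fin m, a ≠ b → l a.succ - l b.succ ≠ 0 := fun a b h h' =>
    h (Fin.succ_injective _ (hl (sub_eq_zero.1 h')))
  have h1 : ∀ j : Fin m, MvPolynomial.eval l (pderiv j.succ (Pj j) - MvPolynomial.X j.succ * Pj j) =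
      vd2 l * (- (1 / (l 0 - l j.succ) ^ 2) - l 0 * (1 / (l 0 - l j.succ)) + 1 +
      ∑ k ∈ Finset.univ.erase j, 2 / ((l 0 - l j.succ) * (l j.succ - l k.succ))) := by
    intro j
    rw [map_sub, eval_djPj l hl j, map_mul, MvPolynomial.eval_X, eval_Pj l hl0]
    have := hl0 j
    field_simp
    ring
  have h2 : ∑ j : Fin m, ∑ k ∈ Finset.univ.erase j, 2 / ((l 0 - l j.succ) * (l j.succ - l k.succ)) =
      Ssum l ^ 2 - Qsum l := by
    have e1 : ∀ g : Fin m → Fin m → ℝ, ∑ j, ∑ k ∈ Finset.univ.erase j, g j k =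
        ∑ j, ∑ k, if j = k then 0 else g j k := by
      intro g
      refine Finset.sum_congr rfl fun j _ => ?_
      rw [← Finset.sum_erase (s := Finset.univ) (a := j) (f := fun k => if j = k then 0 else g j k) (by simp)]
      refine Finset.sum_congr rfl fun k hk => ?_
      rw [if_neg (Finset.mem_erase.1 hk).1.symm]
    have e2 : ∑ j : Fin m, ∑ k ∈ Finset.univ.erase j, 2 / ((l 0 - l j.succ) * (l j.succ - l k.succ)) =
        ∑ j : Fin m, ∑ k : Fin m, if j = k then 0 else 1 / (l 0 - l j.succ) * (1 / (l 0 - l k.succ)) := by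
      rw [e1]
      have e3 : ∀ g : Fin m → Fin m → ℝ, ∑ j, ∑ k, g j k = ∑ j, ∑ k, (g j k + g k j) / 2 := by
        intro g
        have : ∑ j, ∑ k, (g j k + g k j) / 2 = (∑ j, ∑ k, g j k + ∑ j, ∑ k, g k j) / 2 := by
          simp only [← Finset.sum_div, Finset.sum_add_distrib]
        rw [this, Finset.sum_comm (f := fun j k => g k j)]
        ring
      rw [e3]
      refine Finset.sum_congr rfl fun j _ => Finset.sum_congr rfl fun k _ => ?_
      by_cases hjk : j = k
      · simp [hjk]
      · rw [if_neg hjk, if_neg (Ne.symm hjk), if_neg hjk]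
        have a1 := hl0 j
        have a2 := hl0 k
        have a3 := hne j k hjk
        have a4 : l k.succ - l j.succ = - (l j.succ - l k.succ) := by ring
        rw [a4]
        field_simp
        ring
    rw [e2, Ssum, Qsum, sq, Finset.sum_mul_sum, ← Finset.sum_sub_distrib]
    refine Finset.sum_congr rfl fun j _ => ?_
    rw [← Finset.add_sum_erase _ _ (Finset.mem_univ j), ← Finset.add_sum_erase (a := j) (s := Finset.univ)
      (f := fun k => 1 / (l 0 - l j.succ) * (1 / (l 0 - l k.succ))) (Finset.mem_univ j)]
    rw [Finset.sum_congr rfl fun k hk => if_neg (Finset.mem_erase.1 hk).1.symm]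
    rw [if_pos rfl, one_div_mul_one_div, ← sq]
    ring
  rw [Finset.sum_congr rfl fun j _ => h1 j, ← Finset.mul_sum, Finset.sum_add_distrib, h2,
    Finset.sum_add_distrib, Finset.sum_sub_distrib, Finset.sum_neg_distrib, ← Finset.mul_sum, ← Ssum, ← Qsum]
  simp
  left; ring

end GUEGap

namespace GUEGap
open scoped ComplexOrder
open MvPolynomial (pderiv)

/-- weighted integral of a polynomial over the ordered chamber -/
noncomputable def IP (m : ℕ) : Pol m →ₗ[ℝ] ℝ where
  toFun p := ∫ l in Om m, MvPolynomial.eval l p * ew l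
  map_add' p q := by
    rw [← integral_add (int_poly p).integrableOn (int_poly q).integrableOn]
    simp only [map_add, add_mul]
  map_smul' c p := by
    rw [RingHom.id_apply, smul_eq_mul, ← integral_const_mul]
    simp only [MvPolynomial.smul_eval, mul_assoc]

lemma IP_apply {m : ℕ} (p : Pol m) : IP m p = ∫ l in Om m, MvPolynomial.eval l p * ew l := rfl

lemma IP_ibp {m : ℕ} (i : Fin (m + 1)) (p : Pol m)
    (hp : ∀ (k : Fin m) (l : Fin (m + 1) → ℝ), l 0 = l k.succ → MvPolynomial.eval l p = 0) :
    IP m (pderiv i p - MvPolynomial.X i * p) = 0 :=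
  ibp i p fun l ⟨k, hk⟩ => hp k l hk

lemma IP_nonneg {m : ℕ} (p : Pol m) (hp : ∀ l ∈ Om m, 0 ≤ MvPolynomial.eval l p) : 0 ≤ IP m p :=
  setIntegral_nonneg (isOpen_Om m).measurableSet fun l hl => mul_nonneg (hp l hl) (ew_pos l).le

lemma om_ne {m : ℕ} {l : Fin (m + 1) → ℝ} (hl : l ∈ Om m) (j : Fin m) : l 0 - l j.succ ≠ 0 :=
  (sub_pos.2 (hl j)).ne'

lemma stein_a {m : ℕ} (w : Pol m) :
    IP m (pderiv 0 w * RR m) + IP m (w * DP2 m) - IP m (w * PP m) - 2 * IP m (w * QP m) = 0 := by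
  have h := IP_ibp 0 (w * RR m) fun k l hk => by rw [map_mul, RR_van k l hk, mul_zero]
  have e : pderiv 0 (w * RR m) - MvPolynomial.X 0 * (w * RR m) =
      pderiv 0 w * RR m + w * DP2 m - w * PP m - (2 : ℝ) • (w * QP m) := by
    rw [Derivation.leibniz, DP2, smul_eq_mul, smul_eq_mul, MvPolynomial.smul_eq_C_mul,
      show (MvPolynomial.C 2 : Pol m) = 2 from rfl]
    ring
  rw [e] at h
  simpa using h

lemma stein_b {m : ℕ} (w : Pol m) :
    IP m (pderiv 0 w * PP m) + IP m (w * RR m) = 0 := by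
  have h := IP_ibp 0 (w * PP m) fun k l hk => by rw [map_mul, PP_van k l hk, mul_zero]
  have e : pderiv 0 (w * PP m) - MvPolynomial.X 0 * (w * PP m) =
      pderiv 0 w * PP m + w * RR m := by
    rw [Derivation.leibniz, RR, smul_eq_mul, smul_eq_mul]
    ring
  rw [e] at h
  simpa using h

lemma stein_c {m : ℕ} (w : Pol m) (hw : ∀ j : Fin m, pderiv j.succ w = 0) :
    IP m (w * DP2 m) - IP m (w * MvPolynomial.X 0 ^ 2 * PP m) + 4 * m * IP m (w * PP m)
      - 8 * IP m (w * QP m) = 0 := by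
  have h : ∀ j : Fin m, IP m (w * (pderiv j.succ (Pj j) - MvPolynomial.X j.succ * Pj j)) = 0 := by
    intro j
    have h := IP_ibp j.succ (w * Pj j) fun k l hk => by rw [map_mul, Pj_van j k l hk, mul_zero]
    have e : pderiv j.succ (w * Pj j) - MvPolynomial.X j.succ * (w * Pj j) =
      w * (pderiv j.succ (Pj j) - MvPolynomial.X j.succ * Pj j) := by
      rw [Derivation.leibniz, hw, smul_eq_mul, smul_eq_mul]
      ring
    rwa [e] at h
  have h2 : IP m (∑ j : Fin m, w * (pderiv j.succ (Pj j) - MvPolynomial.X j.succ * Pj j)) = 0 := by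
    rw [map_sum]; exact Finset.sum_eq_zero fun j _ => h j
  have h3 : IP m (w * DP2 m - w * MvPolynomial.X 0 ^ 2 * PP m + (4 * m : ℝ) • (w * PP m) - (8 : ℝ) • (w * QP m)) =
      IP m ((4 : ℝ) • ∑ j : Fin m, w * (pderiv j.succ (Pj j) - MvPolynomial.X j.succ * Pj j)) := by
    rw [IP_apply, IP_apply]
    refine integral_congr_ae ?_
    rw [Filter.EventuallyEq, ae_restrict_iff' (isOpen_Om m).measurableSet]
    filter_upwards [ae_inj (m + 1)] with l hl hO
    congr 1
    have h5 := eval_sum_c l hl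
    rw [MvPolynomial.smul_eval, map_sum]
    simp only [map_mul (MvPolynomial.eval l) w]
    rw [← Finset.mul_sum, h5]
    simp only [map_add, map_sub, MvPolynomial.smul_eval, map_mul, map_pow, eval_PP, eval_DP2 l (om_ne hO),
      eval_QP l (om_ne hO), MvPolynomial.eval_X, Dd]
    ring
  rw [map_smul, h2, smul_zero] at h3
  simpa using h3

lemma stein_main {m : ℕ} (w : Pol m) (hw : ∀ j : Fin m, pderiv j.succ w = 0) :
    4 * (m + 1) * IP m (w * PP m) - IP m (w * MvPolynomial.X 0 ^ 2 * PP m) - 3 * IP m (w * DP2 m)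
      + 4 * IP m (pderiv 0 (pderiv 0 w) * PP m) = 0 := by
  have h1 := stein_a w
  have h2 := stein_b (pderiv 0 w)
  have h3 := stein_c w hw
  linarith

lemma stein_Q {m : ℕ} (w : Pol m) :
    2 * IP m (w * QP m) = IP m (w * DP2 m) - IP m (w * PP m) - IP m (pderiv 0 (pderiv 0 w) * PP m) := by
  have h1 := stein_a w
  have h2 := stein_b (pderiv 0 w)
  linarith

/-- moments of the top eigenvalue (unnormalised) -/
noncomputable def UU (m k : ℕ) : ℝ := IP m (MvPolynomial.X 0 ^ k * PP m)

lemma UU_nonneg (m k : ℕ) : 0 ≤ UU m (2 * k) :=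
  IP_nonneg _ fun l _ => by
    rw [map_mul, eval_PP, map_pow, pow_mul]
    exact mul_nonneg (pow_nonneg (by rw [MvPolynomial.eval_X]; positivity) _) (vd2_nonneg l)

lemma DP2_nonneg (m k : ℕ) : 0 ≤ IP m (MvPolynomial.X 0 ^ (2 * k) * DP2 m) :=
  IP_nonneg _ fun l hl => by
    rw [map_mul, eval_DP2 l (om_ne hl), map_pow, pow_mul]
    exact mul_nonneg (pow_nonneg (by rw [MvPolynomial.eval_X]; positivity) _)
      (mul_nonneg (sq_nonneg _) (vd2_nonneg l))

lemma pdX0 {m : ℕ} (k : ℕ) (j : Fin m) : pderiv j.succ (MvPolynomial.X 0 ^ k : Pol m) = 0 := by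
  simp [Derivation.leibniz_pow, MvPolynomial.pderiv_X, Pi.single_apply, (Fin.succ_ne_zero j).symm]

lemma mom_D (m : ℕ) : 3 * IP m (DP2 m) = 4 * (m + 1) * UU m 0 - UU m 2 := by
  have h := stein_main (m := m) (MvPolynomial.X 0 ^ 0) (pdX0 0)
  simp only [UU]
  simp at h ⊢
  linarith

lemma mom2 (m : ℕ) : UU m 2 ≤ 4 * (m + 1) * UU m 0 := by
  have := DP2_nonneg m 0
  have h := mom_D m
  simp at this
  linarith

lemma mom4 (m : ℕ) : UU m 4 ≤ 4 * (m + 1) * UU m 2 + 8 * UU m 0 := by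
  have h := stein_main (m := m) (MvPolynomial.X 0 ^ 2) (pdX0 2)
  have h2 := DP2_nonneg m 1
  have e : pderiv 0 (pderiv 0 (MvPolynomial.X 0 ^ 2 : Pol m)) * PP m = (2 : ℝ) • (MvPolynomial.X 0 ^ 0 * PP m) := by
    simp [Derivation.leibniz_pow, MvPolynomial.smul_eq_C_mul]
    left
    rw [show (2 : Pol m) = MvPolynomial.C 2 from rfl, MvPolynomial.pderiv_C]; simp
  rw [e, map_smul, smul_eq_mul, ← pow_add] at h
  simp only [UU]
  simp only [Nat.reduceAdd, mul_one] at h h2 ⊢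
  linarith

lemma mom_Q (m : ℕ) : IP m (MvPolynomial.X 0 ^ 4 * QP m) ≤ 48 * (m + 1) ^ 3 * UU m 0 := by
  have h := stein_main (m := m) (MvPolynomial.X 0 ^ 4) (pdX0 4)
  have h3 := stein_Q (m := m) (MvPolynomial.X 0 ^ 4)
  have e : pderiv 0 (pderiv 0 (MvPolynomial.X 0 ^ 4 : Pol m)) * PP m = (12 : ℝ) • (MvPolynomial.X 0 ^ 2 * PP m) := by
    simp [Derivation.leibniz_pow, MvPolynomial.smul_eq_C_mul]
    rw [show (MvPolynomial.C 12 : Pol m) = 12 from rfl,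
      show pderiv 0 (4 : Pol m) = 0 by rw [show (4 : Pol m) = MvPolynomial.C 4 from rfl, MvPolynomial.pderiv_C]]
    ring
  rw [e, map_smul, smul_eq_mul] at h h3
  rw [← pow_add] at h
  have h4 := mom4 m
  have h2 := mom2 m
  have h6 := UU_nonneg m 3
  have h44 := UU_nonneg m 2
  have h22 := UU_nonneg m 1
  have h00 := UU_nonneg m 0
  simp only [UU, Nat.reduceAdd, Nat.reduceMul, mul_zero, mul_one] at h h2 h3 h4 h6 h44 h22 h00 ⊢
  generalize IP m (MvPolynomial.X 0 ^ 4 * QP m) = a at *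
  generalize IP m (MvPolynomial.X 0 ^ 4 * DP2 m) = b at *
  generalize IP m (MvPolynomial.X 0 ^ 4 * PP m) = c at *
  generalize IP m (MvPolynomial.X 0 ^ 2 * PP m) = d at *
  generalize IP m (MvPolynomial.X 0 ^ 0 * PP m) = z at *
  generalize IP m (MvPolynomial.X 0 ^ 6 * PP m) = f at *
  have hn : (1 : ℝ) ≤ m + 1 := by simp
  generalize (m + 1 : ℝ) = n at *
  have k1 : 6 * a ≤ 4 * n * c + 48 * d := by linarith
  have k2 : n * c ≤ n * (4 * n * (4 * n * z) + 8 * z) :=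
    mul_le_mul_of_nonneg_left (h4.trans (by nlinarith)) (by linarith)
  have k3 : n * z ≤ n ^ 3 * z := mul_le_mul_of_nonneg_right (by nlinarith [mul_nonneg (by linarith : (0 : ℝ) ≤ n) (by nlinarith : (0 : ℝ) ≤ n ^ 2 - 1)]) h00
  nlinarith

end GUEGap

namespace GUEGap
open scoped ComplexOrder
open MvPolynomial (pderiv)

lemma lint_cons2 {m : ℕ} (f : (Fin (m + 1) → ℝ) → ENNReal) (hf : Measurable f) :
    ∫⁻ l, f l = ∫⁻ y : Fin m → ℝ, ∫⁻ u : ℝ, f (Fin.cons u y) := by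
  have e := (volume_preserving_piFinSuccAbove (fun _ : Fin (m + 1) => ℝ) 0).symm
  rw [← e.lintegral_comp hf, Measure.volume_eq_prod]
  refine (lintegral_prod_symm _ ((hf.comp e.measurable).aemeasurable)).trans ?_
  refine lintegral_congr fun u => lintegral_congr fun y => ?_
  simp [MeasurableEquiv.piFinSuccAbove, Fin.insertNthEquiv, Fin.insertNth_zero]

lemma tail_eq (F F' : ℝ → ℝ) (h : ∀ x, HasDerivAt F (F' x) x) (h1 : Integrable F) (h2 : Integrable F') (t : ℝ) :
    F t = ∫ u in Set.Ioi t, - F' u := by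
  rw [integral_neg, integral_Ioi_of_hasDerivAt_of_tendsto' (fun x _ => h x) h2.integrableOn
      (tendsto_zero_of_hasDerivAt_of_integrableOn_Ioi (a := t) (fun x _ => h x) h2.integrableOn
        h1.integrableOn)]
  ring

/-- evaluation with weight -/
noncomputable def ev {m : ℕ} (p : Pol m) (u : ℝ) (y : Fin m → ℝ) : ℝ :=
  MvPolynomial.eval (Fin.cons u y : Fin (m + 1) → ℝ) p * ew (Fin.cons u y : Fin (m + 1) → ℝ)

lemma ins0 {m : ℕ} (s : ℝ) (y : Fin m → ℝ) :
    ((0 : Fin (m + 1)).insertNth s y : Fin (m + 1) → ℝ) = Fin.cons s y := by simp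

lemma ev_int {m : ℕ} (p : Pol m) (y : Fin m → ℝ) : Integrable fun u => ev p u y := by
  have := int_slice 0 y p
  simp only [ins0] at this
  exact this

lemma ev_deriv {m : ℕ} (p : Pol m) (y : Fin m → ℝ) (u : ℝ) :
    HasDerivAt (fun u => ev p u y) (ev (pderiv 0 p - MvPolynomial.X 0 * p) u y) u := by
  have := slice_deriv 0 y p u
  simp only [ins0] at this
  exact this

lemma ev_tail {m : ℕ} (p : Pol m) (y : Fin m → ℝ) (t : ℝ) :
    ev p t y = ∫ u in Set.Ioi t, - ev (pderiv 0 p - MvPolynomial.X 0 * p) u y :=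
  tail_eq _ _ (ev_deriv p y) (ev_int p y) (ev_int _ y) t

lemma opp_1d {m : ℕ} (y : Fin m → ℝ) (M v ε : ℝ) (hv : 0 ≤ v) (hε : 0 ≤ ε) :
    ∫⁻ u in {u | M < u ∧ v ≤ u ∧ u ≤ (1 + ε) * v}, ENNReal.ofReal (ev (PP m) u y) ≤
      ENNReal.ofReal ε * ∫⁻ u in Set.Ioi M, ENNReal.ofReal |ev (MvPolynomial.X 0 * RR m) u y| := by
  obtain ⟨J, hJ⟩ : ∃ J, J = ∫ u in Set.Ioi (max v M), |ev (RR m) u y| := ⟨_, rfl⟩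
  have hJ0 : 0 ≤ J := hJ ▸ integral_nonneg fun _ => abs_nonneg _
  have hi := (ev_int (RR m) y).abs
  have h1 : ∀ t, M < t → v ≤ t → ev (PP m) t y ≤ J := by
    intro t h1 h2
    rw [ev_tail, hJ]
    calc _ ≤ ∫ u in Set.Ioi t, |ev (RR m) u y| := by
          refine integral_mono ((ev_int _ y).neg.integrableOn) hi.integrableOn fun u => ?_
          exact neg_le_abs _
      _ ≤ _ := by
          refine setIntegral_mono_set hi.integrableOn (Filter.Eventually.of_forall fun _ => abs_nonneg _) ?_
          exact (Set.Ioi_subset_Ioi (max_le h2 h1.le)).eventuallyLE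
  have h2 : v * J ≤ ∫ u in Set.Ioi (max v M), |ev (MvPolynomial.X 0 * RR m) u y| := by
    rw [hJ, ← integral_const_mul]
    refine setIntegral_mono_on (hi.const_mul v).integrableOn (ev_int _ y).abs.integrableOn measurableSet_Ioi
      fun u hu => ?_
    have hu' : v < u := (le_max_left _ _).trans_lt hu
    rw [show ev (MvPolynomial.X 0 * RR m) u y = u * ev (RR m) u y by simp [ev, mul_assoc], abs_mul]
    exact mul_le_mul_of_nonneg_right (hu'.le.trans (le_abs_self u)) (abs_nonneg _)
  calc _ ≤ ∫⁻ u in {u | M < u ∧ v ≤ u ∧ u ≤ (1 + ε) * v}, ENNReal.ofReal J := by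
        refine setLIntegral_mono measurable_const fun u hu => ENNReal.ofReal_le_ofReal (h1 u hu.1 hu.2.1)
    _ ≤ ENNReal.ofReal J * ENNReal.ofReal (ε * v) := by
        rw [setLIntegral_const]
        gcongr
        calc _ ≤ volume (Set.Icc v ((1 + ε) * v)) := measure_mono fun u hu => ⟨hu.2.1, hu.2.2⟩
          _ = _ := by rw [Real.volume_Icc]; congr 1; ring
    _ = ENNReal.ofReal ε * ENNReal.ofReal (v * J) := by
        rw [← ENNReal.ofReal_mul hJ0, ← ENNReal.ofReal_mul hε]; congr 1; ring
    _ ≤ ENNReal.ofReal ε * ENNReal.ofReal (∫ u in Set.Ioi (max v M), |ev (MvPolynomial.X 0 * RR m) u y|) := by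
        gcongr
    _ ≤ _ := by
        rw [ofReal_integral_eq_lintegral_ofReal (ev_int _ y).abs.integrableOn
          (Filter.Eventually.of_forall fun _ => abs_nonneg _)]
        gcongr
        exact le_max_right _ _

lemma Apol_nonneg {m : ℕ} (l : Fin (m + 1) → ℝ) : 0 ≤ MvPolynomial.eval l (Apol m) := by
  rw [Apol, map_prod]
  refine Finset.prod_nonneg fun i _ => ?_
  rw [map_prod]
  exact Finset.prod_nonneg fun j _ => by rw [map_pow]; positivity

lemma Pjj_nonneg {m : ℕ} (l : Fin (m + 1) → ℝ) (j : Fin m) : 0 ≤ MvPolynomial.eval l (Pjj j) := by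
  rw [Pjj, map_mul, map_prod]
  exact mul_nonneg (Finset.prod_nonneg fun k _ => by rw [map_pow]; positivity) (Apol_nonneg l)

lemma dPjj_nonneg {m : ℕ} (l : Fin (m + 1) → ℝ) (hl : l ∈ Om m) (j : Fin m) :
    0 ≤ MvPolynomial.eval l (pderiv 0 (Pjj j)) := by
  rw [Pjj, Derivation.leibniz, pd_A0, smul_zero, zero_add, smul_eq_mul, map_mul, pd_prod, map_sum]
  refine mul_nonneg (Apol_nonneg l) (Finset.sum_nonneg fun k _ => ?_)
  rw [map_mul, map_prod, Derivation.leibniz_pow, pd_fj0]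
  refine mul_nonneg (Finset.prod_nonneg fun k _ => by rw [map_pow]; positivity) ?_
  simp [eval_fj]
  exact (hl k).le

lemma same_1d {m : ℕ} (y : Fin m → ℝ) (M ε : ℝ) (j : Fin m) (hM : ∀ k, y k ≤ M) (hj : 0 < y j) (hε : 0 ≤ ε) :
    ∫⁻ u in {u | M < u ∧ u ≤ (1 + ε) * y j}, ENNReal.ofReal (ev (PP m) u y) ≤
      ENNReal.ofReal (ε ^ 3) * ∫⁻ u in Set.Ioi M, ENNReal.ofReal (ev (MvPolynomial.X 0 ^ 4 * Pjj j) u y) := by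
  obtain ⟨b, hb⟩ : ∃ b, b = y j := ⟨_, rfl⟩
  rw [← hb] at hj ⊢
  have hbM : b ≤ M := hb ▸ hM j
  obtain ⟨J, hJ⟩ : ∃ J, J = ∫ u in Set.Ioi M, ev (MvPolynomial.X 0 * Pjj j) u y := ⟨_, rfl⟩
  have hev : ∀ (u : ℝ) k, ev (MvPolynomial.X 0 ^ k * Pjj j) u y = u ^ k * ev (Pjj j) u y := by
    intro u k; simp [ev, mul_assoc]
  have hpos : ∀ u, 0 ≤ ev (Pjj j) u y := fun u => mul_nonneg (Pjj_nonneg _ j) (ew_pos _).le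
  have hi := ev_int (MvPolynomial.X 0 * Pjj j) y
  have hi4 := ev_int (MvPolynomial.X 0 ^ 4 * Pjj j) y
  have hnn : ∀ u ∈ Set.Ioi M, 0 ≤ ev (MvPolynomial.X 0 * Pjj j) u y := by
    intro u hu
    have := hev u 1
    rw [pow_one, pow_one] at this
    rw [this]
    exact mul_nonneg (by have := Set.mem_Ioi.1 hu; linarith) (hpos u)
  have hJ0 : 0 ≤ J := hJ ▸ setIntegral_nonneg measurableSet_Ioi hnn
  have h1 : ∀ t, M < t → ev (Pjj j) t y ≤ J := by
    intro t h1
    rw [ev_tail, hJ]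
    calc _ ≤ ∫ u in Set.Ioi t, ev (MvPolynomial.X 0 * Pjj j) u y := by
          refine setIntegral_mono_on ((ev_int _ y).neg.integrableOn) hi.integrableOn measurableSet_Ioi
            fun u hu => ?_
          have hO : (Fin.cons u y : Fin (m + 1) → ℝ) ∈ Om m := fun k => by
            have := Set.mem_Ioi.1 hu
            simpa using (hM k).trans_lt (h1.trans this)
          have := mul_nonneg (dPjj_nonneg _ hO j) (ew_pos (Fin.cons u y : Fin (m + 1) → ℝ)).le
          simp only [ev, map_sub, sub_mul]
          linarith
      _ ≤ _ := by
          refine setIntegral_mono_set hi.integrableOn ?_ ?_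
          · exact (ae_restrict_iff' measurableSet_Ioi).2 (Filter.Eventually.of_forall hnn)
          · exact (Set.Ioi_subset_Ioi h1.le).eventuallyLE
  have h3 : ∀ t, M < t → t ≤ (1 + ε) * b → ev (PP m) t y ≤ (ε * b) ^ 2 * J := by
    intro t ht1 ht2
    have : ev (PP m) t y = (t - b) ^ 2 * ev (Pjj j) t y := by
      rw [ev, ev, ← fj_Pj j, Pj, map_mul, map_mul, eval_fj]
      simp [hb]; ring
    rw [this]
    refine mul_le_mul ?_ (h1 t ht1) (hpos t) (by positivity)
    exact pow_le_pow_left₀ (by linarith) (by linarith) 2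
  have h2 : b ^ 3 * J ≤ ∫ u in Set.Ioi M, ev (MvPolynomial.X 0 ^ 4 * Pjj j) u y := by
    rw [hJ, ← integral_const_mul]
    refine setIntegral_mono_on (hi.const_mul _).integrableOn hi4.integrableOn measurableSet_Ioi
      fun u hu => ?_
    have hu' : b < u := hbM.trans_lt hu
    have := hev u 1
    rw [pow_one, pow_one] at this
    rw [this, hev, show u ^ 4 * ev (Pjj j) u y = u ^ 3 * (u * ev (Pjj j) u y) by ring]
    exact mul_le_mul_of_nonneg_right (pow_le_pow_left₀ hj.le hu'.le 3) (mul_nonneg (by linarith) (hpos u))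
  calc _ ≤ ∫⁻ u in {u | M < u ∧ u ≤ (1 + ε) * b}, ENNReal.ofReal ((ε * b) ^ 2 * J) := by
        refine setLIntegral_mono measurable_const fun u hu => ENNReal.ofReal_le_ofReal (h3 u hu.1 hu.2)
    _ ≤ ENNReal.ofReal ((ε * b) ^ 2 * J) * ENNReal.ofReal (ε * b) := by
        rw [setLIntegral_const]
        gcongr
        calc _ ≤ volume (Set.Icc b ((1 + ε) * b)) := measure_mono fun u hu => ⟨hbM.trans hu.1.le, hu.2⟩
          _ = _ := by rw [Real.volume_Icc]; congr 1; ring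
    _ = ENNReal.ofReal (ε ^ 3) * ENNReal.ofReal (b ^ 3 * J) := by
        rw [← ENNReal.ofReal_mul (by positivity), ← ENNReal.ofReal_mul (by positivity)]; congr 1; ring
    _ ≤ ENNReal.ofReal (ε ^ 3) * ENNReal.ofReal (∫ u in Set.Ioi M, ev (MvPolynomial.X 0 ^ 4 * Pjj j) u y) := by
        gcongr
    _ = _ := by
        rw [ofReal_integral_eq_lintegral_ofReal hi4.integrableOn]
        exact Filter.Eventually.of_forall fun u => by
          simp only [hev]; exact mul_nonneg (by positivity) (hpos u)

/-- the bad event in the chamber -/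
def EE (m : ℕ) (c : ℝ) : Set (Fin (m + 1) → ℝ) :=
  {l | (∀ k, |l k| ≤ l 0) ∧ ∃ j : Fin m, l 0 ≤ c * |l j.succ|}

lemma measurableSet_EE (m : ℕ) (c : ℝ) : MeasurableSet (EE m c) := by
  have : EE m c = (⋂ k, {l | |l k| ≤ l 0}) ∩ ⋃ j : Fin m, {l | l 0 ≤ c * |l j.succ|} := by
    ext; simp [EE]
  rw [this]
  refine (MeasurableSet.iInter fun k => ?_).inter (MeasurableSet.iUnion fun k => ?_)
  · exact (isClosed_le (by fun_prop) (by fun_prop)).measurableSet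
  · exact (isClosed_le (by fun_prop) (by fun_prop)).measurableSet

lemma slice_bound {m : ℕ} (hm : 0 < m) (ε : ℝ) (hε : 0 ≤ ε) (y : Fin m → ℝ) :
    ∫⁻ u in {u | (Fin.cons u y : Fin (m + 1) → ℝ) ∈ Om m ∩ EE m (1 + ε)}, ENNReal.ofReal (ev (PP m) u y) ≤
      ∫⁻ u in {u | (Fin.cons u y : Fin (m + 1) → ℝ) ∈ Om m},
        (ENNReal.ofReal ε * ENNReal.ofReal |ev (MvPolynomial.X 0 * RR m) u y| +
          ENNReal.ofReal (ε ^ 3) * ENNReal.ofReal (ev (MvPolynomial.X 0 ^ 4 * QP m) u y)) := by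
  haveI : Nonempty (Fin m) := ⟨⟨0, hm⟩⟩
  obtain ⟨j0, hj0⟩ := Finite.exists_max y
  obtain ⟨j1, hj1⟩ := Finite.exists_min y
  have hO : {u | (Fin.cons u y : Fin (m + 1) → ℝ) ∈ Om m} = Set.Ioi (y j0) := by
    ext u
    simp only [Om, Set.mem_ofPred_eq, Fin.cons_succ, Fin.cons_zero, Set.mem_Ioi]
    exact ⟨fun h => h j0, fun h k => (hj0 k).trans_lt h⟩
  rw [hO]
  have hc : ∀ p : Pol m, Measurable fun u => ENNReal.ofReal (ev p u y) := fun p =>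
    ENNReal.measurable_ofReal.comp
      (continuous_iff_continuousAt.2 fun u => (ev_deriv p y u).continuousAt).measurable
  have hc2 : Measurable fun u => ENNReal.ofReal |ev (MvPolynomial.X 0 * RR m) u y| :=
    ENNReal.measurable_ofReal.comp
      (continuous_iff_continuousAt.2 fun u => (ev_deriv _ y u).continuousAt).abs.measurable
  rw [lintegral_add_left (hc2.const_mul _), lintegral_const_mul _ hc2, lintegral_const_mul _ (hc _)]
  have hsub : {u | (Fin.cons u y : Fin (m + 1) → ℝ) ∈ Om m ∩ EE m (1 + ε)} ⊆
      {u | y j0 < u ∧ max 0 (- y j1) ≤ u ∧ u ≤ (1 + ε) * max 0 (- y j1)} ∪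
      ⋃ j : {j : Fin m // 0 < y j}, {u | y j0 < u ∧ u ≤ (1 + ε) * y j} := by
    intro u hu
    obtain ⟨h1, h2, j, h3⟩ := hu
    have h4 : y j0 < u := by simpa using h1 j0
    have h5 : ∀ k, |y k| ≤ u := fun k => by simpa using h2 k.succ
    simp only [Fin.cons_zero, Fin.cons_succ] at h3
    by_cases hj : 0 < y j
    · right
      refine Set.mem_iUnion.2 ⟨⟨j, hj⟩, h4, ?_⟩
      rwa [abs_of_pos hj] at h3
    · left
      push Not at hj
      rw [abs_of_nonpos hj] at h3
      refine ⟨h4, max_le ((abs_nonneg _).trans (h5 j)) ((neg_le_abs _).trans (h5 j1)), h3.trans ?_⟩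
      refine mul_le_mul_of_nonneg_left ((neg_le_neg (hj1 j)).trans (le_max_right _ _)) (by linarith)
  refine (lintegral_mono_set hsub).trans ((lintegral_union_le _ _ _).trans ?_)
  refine add_le_add (opp_1d y _ _ ε (le_max_left _ _) hε) ?_
  refine (lintegral_iUnion_le _ _).trans ?_
  rw [tsum_fintype]
  refine (Finset.sum_le_sum fun j _ => same_1d y (y j0) ε j.1 hj0 j.2 hε).trans ?_
  rw [← Finset.mul_sum]
  gcongr
  calc _ ≤ ∑ j : Fin m, ∫⁻ u in Set.Ioi (y j0), ENNReal.ofReal (ev (MvPolynomial.X 0 ^ 4 * Pjj j) u y) := by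
        rw [← Finset.sum_subtype (Finset.univ.filter fun j => 0 < y j) (by simp)
          (fun j => ∫⁻ u in Set.Ioi (y j0), ENNReal.ofReal (ev (MvPolynomial.X 0 ^ 4 * Pjj j) u y))]
        exact Finset.sum_le_sum_of_subset (Finset.filter_subset _ _)
    _ = _ := by
        rw [← lintegral_finsetSum _ fun j _ => hc _]
        refine lintegral_congr fun u => ?_
        rw [← ENNReal.ofReal_sum_of_nonneg]
        · congr 1
          simp only [ev, QP, Finset.mul_sum, map_sum, Finset.sum_mul]
        · intro j _
          refine mul_nonneg ?_ (ew_pos _).le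
          rw [map_mul, map_pow]
          exact mul_nonneg (by positivity) (Pjj_nonneg _ j)

theorem chamber_bound {m : ℕ} (hm : 0 < m) (ε : ℝ) (hε : 0 ≤ ε) :
    ∫⁻ l in Om m ∩ EE m (1 + ε), ENNReal.ofReal (vd2 l * ew l) ≤
      ENNReal.ofReal (ε * (∫ l in Om m, |MvPolynomial.eval l (MvPolynomial.X 0 * RR m) * ew l|) +
        ε ^ 3 * IP m (MvPolynomial.X 0 ^ 4 * QP m)) := by
  have hO := (isOpen_Om m).measurableSet
  have hE := measurableSet_EE m (1 + ε)
  have hcp : ∀ p : Pol m, Continuous fun l : Fin (m + 1) → ℝ => MvPolynomial.eval l p * ew l := fun p =>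
    (MvPolynomial.continuous_eval p).mul continuous_ew
  rw [IP_apply]
  have hq : ∀ l ∈ Om m, 0 ≤ MvPolynomial.eval l (MvPolynomial.X 0 ^ 4 * QP m) * ew l := by
    intro l _
    refine mul_nonneg ?_ (ew_pos l).le
    rw [map_mul, map_pow, QP, map_sum]
    exact mul_nonneg (by positivity) (Finset.sum_nonneg fun j _ => Pjj_nonneg l j)
  have hI1 := (int_poly (MvPolynomial.X 0 * RR m)).abs
  have hI2 := int_poly (MvPolynomial.X 0 ^ 4 * QP m)
  rw [ENNReal.ofReal_add (mul_nonneg hε (integral_nonneg fun _ => abs_nonneg _))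
    (mul_nonneg (by positivity) (setIntegral_nonneg hO hq)), ENNReal.ofReal_mul hε,
    ENNReal.ofReal_mul (by positivity),
    ofReal_integral_eq_lintegral_ofReal hI1.integrableOn (Filter.Eventually.of_forall fun _ => abs_nonneg _),
    ofReal_integral_eq_lintegral_ofReal hI2.integrableOn
      ((ae_restrict_iff' hO).2 (Filter.Eventually.of_forall hq))]
  have m1 : Measurable fun l : Fin (m + 1) → ℝ =>
      ENNReal.ofReal |MvPolynomial.eval l (MvPolynomial.X 0 * RR m) * ew l| :=
    ENNReal.measurable_ofReal.comp (hcp _).abs.measurable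
  have m2 : Measurable fun l : Fin (m + 1) → ℝ =>
      ENNReal.ofReal (MvPolynomial.eval l (MvPolynomial.X 0 ^ 4 * QP m) * ew l) :=
    ENNReal.measurable_ofReal.comp (hcp _).measurable
  have m3 : Measurable fun l : Fin (m + 1) → ℝ => ENNReal.ofReal (vd2 l * ew l) :=
    ENNReal.measurable_ofReal.comp (continuous_vd2.mul continuous_ew).measurable
  rw [← lintegral_const_mul _ m1, ← lintegral_const_mul _ m2, ← lintegral_add_left (m1.const_mul _),
    ← lintegral_indicator hO, ← lintegral_indicator (hO.inter hE),
    lint_cons2 _ (m3.indicator (hO.inter hE))]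
  have m4 : Measurable fun l : Fin (m + 1) → ℝ =>
      ENNReal.ofReal ε * ENNReal.ofReal |MvPolynomial.eval l (MvPolynomial.X 0 * RR m) * ew l| +
      ENNReal.ofReal (ε ^ 3) * ENNReal.ofReal (MvPolynomial.eval l (MvPolynomial.X 0 ^ 4 * QP m) * ew l) :=
    (m1.const_mul _).add (m2.const_mul _)
  rw [lint_cons2 _ (m4.indicator hO)]
  refine lintegral_mono fun y => ?_
  have hcons : Measurable fun u : ℝ => (Fin.cons u y : Fin (m + 1) → ℝ) := by
    refine Continuous.measurable (continuous_pi fun k => ?_)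
    refine Fin.cases ?_ (fun k => ?_) k
    · simp only [Fin.cons_zero]
      exact continuous_id
    · simp only [Fin.cons_succ]
      exact continuous_const
  have hs := slice_bound hm ε hε y
  have hO' : MeasurableSet {u : ℝ | (Fin.cons u y : Fin (m + 1) → ℝ) ∈ Om m} := hcons hO
  have hOE' : MeasurableSet {u : ℝ | (Fin.cons u y : Fin (m + 1) → ℝ) ∈ Om m ∩ EE m (1 + ε)} :=
    hcons (hO.inter hE)
  rw [← lintegral_indicator hO', ← lintegral_indicator hOE'] at hs
  refine le_trans (le_of_eq ?_) (hs.trans (le_of_eq ?_))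
  · refine lintegral_congr fun u => ?_
    simp only [Set.indicator_apply, ev, eval_PP]
    rfl
  · refine lintegral_congr fun u => ?_
    simp only [Set.indicator_apply, ev]
    rfl

end GUEGap

namespace GUEGap
open scoped ComplexOrder
open MvPolynomial (pderiv)

lemma lint_pi_prod {α : Type*} [MeasurableSpace α] (μ : Measure α) [SigmaFinite μ] (n : ℕ)
    (f : Fin n → α → ENNReal) (hf : ∀ i, Measurable (f i)) :
    ∫⁻ x, ∏ i, f i (x i) ∂(Measure.pi fun _ : Fin n => μ) = ∏ i, ∫⁻ a, f i a ∂μ := by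
  induction n with
  | zero => simp
  | succ n ih =>
    have e := (measurePreserving_piFinSuccAbove (fun _ : Fin (n + 1) => μ) 0).symm
    have hm : Measurable fun x : Fin (n + 1) → α => ∏ i, f i (x i) :=
      Finset.measurable_prod _ fun i _ => (hf i).comp (measurable_pi_apply i)
    rw [← e.lintegral_comp hm]
    refine (lintegral_prod _ ((hm.comp e.measurable).aemeasurable)).trans ?_
    rw [Fin.prod_univ_succ, ← ih _ fun i => hf i.succ, ← lintegral_mul_const _ (hf 0)]
    refine lintegral_congr fun a => ?_
    rw [← lintegral_const_mul]
    · refine lintegral_congr fun y => ?_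
      simp [MeasurableEquiv.piFinSuccAbove, Fin.insertNthEquiv, Fin.prod_univ_succ]
    · exact Finset.measurable_prod _ fun i _ => (hf i.succ).comp (measurable_pi_apply i)

lemma pi_wd {α : Type*} [MeasurableSpace α] (μ : Measure α) [SigmaFinite μ] (n : ℕ)
    (f : α → ENNReal) (hf : Measurable f) [SigmaFinite (μ.withDensity f)] :
    (Measure.pi fun _ : Fin n => μ.withDensity f) =
      (Measure.pi fun _ : Fin n => μ).withDensity fun x => ∏ i, f (x i) := by
  refine Measure.pi_eq fun s hs => ?_
  rw [withDensity_apply _ (MeasurableSet.univ_pi hs), ← lintegral_indicator (MeasurableSet.univ_pi hs)]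
  have : ∀ x : Fin n → α, (Set.univ.pi s).indicator (fun x => ∏ i, f (x i)) x =
      ∏ i, (s i).indicator f (x i) := by
    intro x
    by_cases hx : x ∈ Set.univ.pi s
    · rw [Set.indicator_of_mem hx]
      refine Finset.prod_congr rfl fun i _ => ?_
      rw [Set.indicator_of_mem (hx i (Set.mem_univ i))]
    · rw [Set.indicator_of_notMem hx]
      simp only [Set.mem_pi, Set.mem_univ, true_imp_iff, not_forall] at hx
      obtain ⟨i, hi⟩ := hx
      exact (Finset.prod_eq_zero (Finset.mem_univ i) (Set.indicator_of_notMem hi _)).symm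
  simp only [this]
  rw [lint_pi_prod μ n _ fun i => hf.indicator (hs i)]
  refine Finset.prod_congr rfl fun i _ => ?_
  rw [withDensity_apply _ (hs i), lintegral_indicator (hs i)]

/-- unnormalised complex Gaussian density -/
noncomputable def cdn (z : ℂ) : ENNReal := ENNReal.ofReal (Real.exp (-(Complex.normSq z) / 2))

lemma measurable_cdn : Measurable cdn := by
  refine ENNReal.measurable_ofReal.comp (Continuous.measurable ?_)
  have := Complex.continuous_normSq
  fun_prop

lemma complexGaussian_eq : ∃ c : ENNReal, c ≠ ⊤ ∧ complexGaussian =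
    (volume : Measure ℂ).withDensity fun z => c * cdn z := by
  refine ⟨ENNReal.ofReal (√(2 * Real.pi * (1 : NNReal)))⁻¹ * ENNReal.ofReal (√(2 * Real.pi * (1 : NNReal)))⁻¹,
    ENNReal.mul_ne_top ENNReal.ofReal_ne_top ENNReal.ofReal_ne_top, ?_⟩
  unfold complexGaussian
  rw [gaussianReal_of_var_ne_zero 0 one_ne_zero, prod_withDensity (by fun_prop) (by fun_prop),
    ← Measure.volume_eq_prod]
  have e := Complex.volume_preserving_equiv_real_prod.symm
  refine Measure.ext_of_lintegral _ fun φ hφ => ?_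
  have hmk : Measurable fun p : ℝ × ℝ => Complex.mk p.1 p.2 := e.measurable
  have hφ' : Measurable fun p : ℝ × ℝ => φ (Complex.mk p.1 p.2) := hφ.comp hmk
  have hc := measurable_cdn.const_mul
    (ENNReal.ofReal (√(2 * Real.pi * (1 : NNReal)))⁻¹ * ENNReal.ofReal (√(2 * Real.pi * (1 : NNReal)))⁻¹)
  rw [lintegral_map hφ hmk, lintegral_withDensity_eq_lintegral_mul _ (by fun_prop) hφ',
    lintegral_withDensity_eq_lintegral_mul _ hc hφ, ← e.lintegral_comp (hc.mul hφ)]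
  refine lintegral_congr fun p => ?_
  have hp : Complex.measurableEquivRealProd.symm p = Complex.mk p.1 p.2 := rfl
  simp only [Pi.mul_apply, gaussianPDF, gaussianPDFReal, hp, cdn]
  congr 1
  have h0 : 0 ≤ (√(2 * Real.pi * (1 : NNReal)))⁻¹ := by positivity
  rw [← ENNReal.ofReal_mul (by positivity), ← ENNReal.ofReal_mul h0, ← ENNReal.ofReal_mul (by positivity)]
  congr 1
  have : Real.exp (-Complex.normSq (Complex.mk p.1 p.2) / 2) =
      Real.exp (-(p.1 - 0) ^ 2 / (2 * (1 : NNReal))) * Real.exp (-(p.2 - 0) ^ 2 / (2 * (1 : NNReal))) := by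
    rw [← Real.exp_add]
    congr 1
    simp only [Complex.normSq_mk, NNReal.coe_one]
    ring
  rw [this]
  ring

/-- squared Frobenius norm -/
noncomputable def frob {n : ℕ} (H : Matrix (Fin n) (Fin n) ℂ) : ℝ := ∑ i, ∑ j, Complex.normSq (H i j)

/-- Gaussian weight -/
noncomputable def gw {n : ℕ} (H : Matrix (Fin n) (Fin n) ℂ) : ℝ := Real.exp (-(frob H) / 2)

lemma continuous_frob {n : ℕ} : Continuous (frob (n := n)) := by
  unfold frob
  have := Complex.continuous_normSq
  fun_prop

lemma continuous_gw {n : ℕ} : Continuous (gw (n := n)) := by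
  unfold gw
  have := continuous_frob (n := n)
  fun_prop

lemma gw_pos {n : ℕ} (H : Matrix (Fin n) (Fin n) ℂ) : 0 < gw H := Real.exp_pos _

lemma measurable_gw {n : ℕ} : Measurable fun H : Matrix (Fin n) (Fin n) ℂ => ENNReal.ofReal (gw H) :=
  ENNReal.measurable_ofReal.comp continuous_gw.measurable

instance : IsProbabilityMeasure complexGaussian := by
  unfold complexGaussian
  refine Measure.isProbabilityMeasure_map ?_
  exact (Complex.volume_preserving_equiv_real_prod.symm).measurable.aemeasurable

instance (n : ℕ) : IsProbabilityMeasure (matrixGaussian n) := by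
  exact inferInstanceAs (IsProbabilityMeasure
    (Measure.pi fun _ : Fin n => Measure.pi fun _ : Fin n => complexGaussian))

lemma continuous_hpart {n : ℕ} : Continuous fun G : Matrix (Fin n) (Fin n) ℂ => (1 / 2 : ℂ) • (G + Gᴴ) := by
  fun_prop

instance (n : ℕ) : IsProbabilityMeasure (GUE n) := by
  unfold GUE
  exact Measure.isProbabilityMeasure_map continuous_hpart.measurable.aemeasurable

lemma matrixGaussian_lint (n : ℕ) : ∃ c : ENNReal, ∀ Ψ : Matrix (Fin n) (Fin n) ℂ → ENNReal, Measurable Ψ →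
    ∫⁻ G, Ψ G ∂(matrixGaussian n) =
      c * ∫⁻ G : Fin n → Fin n → ℂ, Ψ G * ENNReal.ofReal (gw (n := n) G) := by
  obtain ⟨c, hct, hc⟩ := complexGaussian_eq
  have hcm := measurable_cdn.const_mul c
  refine ⟨(c ^ n) ^ n, fun Ψ hΨ => ?_⟩
  unfold matrixGaussian
  have h1 : IsProbabilityMeasure ((volume : Measure ℂ).withDensity fun z => c * cdn z) := hc ▸ inferInstance
  have e1 := pi_wd volume n _ hcm
  have h2 : IsProbabilityMeasure ((Measure.pi fun _ : Fin n => (volume : Measure ℂ)).withDensity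
      fun x => ∏ i, c * cdn (x i)) := e1 ▸ inferInstance
  have hm1 : Measurable fun x : Fin n → ℂ => ∏ i, c * cdn (x i) :=
    Finset.measurable_prod _ fun i _ => hcm.comp (measurable_pi_apply i)
  have e2 := pi_wd (Measure.pi fun _ : Fin n => (volume : Measure ℂ)) n _ hm1
  have hm2 : Measurable fun x : Fin n → Fin n → ℂ => ∏ i, ∏ j, c * cdn (x i j) :=
    Finset.measurable_prod _ fun i _ => hm1.comp (measurable_pi_apply i)
  rw [hc, e1, e2]
  refine (lintegral_withDensity_eq_lintegral_mul _ hm2 hΨ).trans ?_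
  have hm3 : Measurable fun G : Fin n → Fin n → ℂ => Ψ G * ENNReal.ofReal (gw (n := n) G) :=
    hΨ.mul measurable_gw
  refine Eq.trans ?_ (lintegral_const_mul _ hm3)
  refine lintegral_congr fun G => ?_
  change (∏ i, ∏ j, c * cdn (G i j)) * Ψ G = _
  simp only [Finset.prod_mul_distrib, Finset.prod_const, Finset.card_univ, Fintype.card_fin]
  rw [mul_assoc, mul_comm (Ψ G)]
  congr 2
  unfold cdn gw frob
  simp only [← ENNReal.ofReal_prod_of_nonneg (fun i _ => (Real.exp_pos _).le), ← Real.exp_sum,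
    neg_div, Finset.sum_div, Finset.sum_neg_distrib]


lemma herm_mul_I_conj {n : ℕ} (X Y : HC n) :
    (herm X + Complex.I • herm Y)ᴴ = herm X - Complex.I • herm Y := by
  rw [conjTranspose_add, conjTranspose_smul, (herm_isHermitian X).eq, (herm_isHermitian Y).eq]
  simp [sub_eq_add_neg]

lemma hpart_herm {n : ℕ} (G : Matrix (Fin n) (Fin n) ℂ) : ((1 / 2 : ℂ) • (G + Gᴴ)).IsHermitian := by
  ext i j
  simp only [conjTranspose_apply, Matrix.smul_apply, Matrix.add_apply, smul_eq_mul, star_mul', star_add, star_star]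
  simp [add_comm]

lemma kpart_herm {n : ℕ} (G : Matrix (Fin n) (Fin n) ℂ) :
    ((-Complex.I / 2 : ℂ) • (G - Gᴴ)).IsHermitian := by
  ext i j
  simp
  ring

/-- decomposition into Hermitian and anti-Hermitian parts -/
noncomputable def hsplit (n : ℕ) : (Fin n → Fin n → ℂ) ≃ₗ[ℝ] HC n × HC n where
  toFun G := (coord ((1 / 2 : ℂ) • (Matrix.of G + (Matrix.of G)ᴴ)),
    coord ((-Complex.I / 2 : ℂ) • (Matrix.of G - (Matrix.of G)ᴴ)))
  map_add' G G' := by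
    ext i j
    · simp [coord]
      split_ifs <;> ring
    · simp [coord]
      split_ifs <;> ring
  map_smul' c G := by
    ext i j
    · simp [coord]
      split_ifs <;> ring
    · simp [coord]
      split_ifs <;> ring
  invFun p := herm p.1 + Complex.I • herm p.2
  left_inv G := by
    change herm (coord ((1 / 2 : ℂ) • (Matrix.of G + (Matrix.of G)ᴴ))) +
      Complex.I • herm (coord ((-Complex.I / 2 : ℂ) • (Matrix.of G - (Matrix.of G)ᴴ))) = Matrix.of G
    rw [herm_coord (hpart_herm _), herm_coord (kpart_herm _)]
    ext i j
    simp only [Matrix.add_apply, Matrix.smul_apply, Matrix.sub_apply, Matrix.of_apply, smul_eq_mul]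
    linear_combination (-(1 / 2 : ℂ) * (G i j - (Matrix.of G)ᴴ i j)) * Complex.I_mul_I
  right_inv p := by
    have h := herm_mul_I_conj p.1 p.2
    have e1 : (1 / 2 : ℂ) • (herm p.1 + Complex.I • herm p.2 + (herm p.1 - Complex.I • herm p.2)) = herm p.1 := by
      ext i j
      simp only [Matrix.add_apply, Matrix.smul_apply, Matrix.sub_apply, smul_eq_mul]
      ring
    have e2 : (-Complex.I / 2 : ℂ) • (herm p.1 + Complex.I • herm p.2 - (herm p.1 - Complex.I • herm p.2)) = herm p.2 := by
      ext i j
      simp only [Matrix.add_apply, Matrix.smul_apply, Matrix.sub_apply, smul_eq_mul]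
      linear_combination (- herm p.2 i j) * Complex.I_mul_I
    change (coord ((1 / 2 : ℂ) • ((herm p.1 + Complex.I • herm p.2) + (herm p.1 + Complex.I • herm p.2)ᴴ)),
      coord ((-Complex.I / 2 : ℂ) • ((herm p.1 + Complex.I • herm p.2) - (herm p.1 + Complex.I • herm p.2)ᴴ))) = p
    rw [h, e1, e2, coord_herm, coord_herm]

lemma herm_hsplit1 {n : ℕ} (G : Fin n → Fin n → ℂ) :
    herm (hsplit n G).1 = (1 / 2 : ℂ) • (Matrix.of G + (Matrix.of G)ᴴ) := herm_coord (hpart_herm _)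

lemma herm_hsplit2 {n : ℕ} (G : Fin n → Fin n → ℂ) :
    herm (hsplit n G).2 = (-Complex.I / 2 : ℂ) • (Matrix.of G - (Matrix.of G)ᴴ) := herm_coord (kpart_herm _)

lemma frob_split {n : ℕ} (G : Fin n → Fin n → ℂ) :
    frob (n := n) G = frob (herm (hsplit n G).1) + frob (herm (hsplit n G).2) := by
  rw [herm_hsplit1, herm_hsplit2]
  unfold frob
  have h2 : ∑ i, ∑ j, Complex.normSq (G i j) = ∑ i, ∑ j, Complex.normSq (G j i) := Finset.sum_comm
  have h3 : ∑ i, ∑ j, Complex.normSq (G i j) =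
      ∑ i, ∑ j, (Complex.normSq (G i j) + Complex.normSq (G j i)) / 2 := by
    simp only [add_div, Finset.sum_add_distrib, ← Finset.sum_div]
    rw [← h2]; ring
  rw [h3, ← Finset.sum_add_distrib]
  refine Finset.sum_congr rfl fun i _ => ?_
  rw [← Finset.sum_add_distrib]
  refine Finset.sum_congr rfl fun j _ => ?_
  simp [Complex.normSq_apply]
  ring

/-- the GUE has density proportional to the Gaussian weight -/
lemma gue_lint (n : ℕ) : ∃ c : ENNReal, ∀ Ψ : Matrix (Fin n) (Fin n) ℂ → ENNReal, Measurable Ψ →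
    ∫⁻ H, Ψ H ∂(GUE n) = c * ∫⁻ X : HC n, Ψ (herm X) * ENNReal.ofReal (gw (herm X)) := by
  obtain ⟨c, hc⟩ := matrixGaussian_lint n
  have hcont : Continuous (hsplit n) := (hsplit n).toLinearMap.continuous_of_finiteDimensional
  let e : (Fin n → Fin n → ℂ) ≃L[ℝ] HC n × HC n := (hsplit n).toContinuousLinearEquiv
  have i1 : ∀ α : Type, ∀ [NormedAddCommGroup α] [NormedSpace ℝ α] [FiniteDimensional ℝ α] [MeasureSpace α]
      [BorelSpace α] [(volume : Measure α).IsAddHaarMeasure],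
      (volume : Measure (Fin n → α)).IsAddHaarMeasure := by
    intro α _ _ _ _ _ _
    infer_instance
  have i2 : (volume : Measure (Fin n → Fin n → ℂ)).IsAddHaarMeasure := i1 _
  have i3 : (volume : Measure (HC n)).IsAddHaarMeasure := i1 (Fin n → ℝ)
  have i4 : (volume : Measure (HC n × HC n)).IsAddHaarMeasure :=
    Measure.prod.instIsAddHaarMeasure _ _
  have hH : (Measure.map e (volume : Measure (Fin n → Fin n → ℂ))).IsAddHaarMeasure :=
    e.isAddHaarMeasure_map _
  have hmap := Measure.isAddLeftInvariant_eq_smul (Measure.map e (volume : Measure (Fin n → Fin n → ℂ)))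
    (volume : Measure (HC n × HC n))
  obtain ⟨d, hd⟩ : ∃ d : NNReal, Measure.map e (volume : Measure (Fin n → Fin n → ℂ)) =
    d • (volume : Measure (HC n × HC n)) := ⟨_, hmap⟩
  refine ⟨c * d * ∫⁻ Y : HC n, ENNReal.ofReal (gw (herm Y)), fun Ψ hΨ => ?_⟩
  have hw : Measurable fun X : HC n => ENNReal.ofReal (gw (herm X)) := measurable_gw.comp measurable_herm
  have hg : Measurable fun X : HC n => Ψ (herm X) * ENNReal.ofReal (gw (herm X)) :=
    (hΨ.comp measurable_herm).mul hw
  have hp : Measurable fun p : HC n × HC n =>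
      (Ψ (herm p.1) * ENNReal.ofReal (gw (herm p.1))) * ENNReal.ofReal (gw (herm p.2)) :=
    (hg.comp measurable_fst).mul (hw.comp measurable_snd)
  have hΨ2 : Measurable fun G : Matrix (Fin n) (Fin n) ℂ => Ψ ((1 / 2 : ℂ) • (G + Gᴴ)) :=
    hΨ.comp continuous_hpart.measurable
  unfold GUE
  rw [lintegral_map hΨ continuous_hpart.measurable, hc _ hΨ2]
  have e1 : ∀ G : Fin n → Fin n → ℂ, Ψ ((1 / 2 : ℂ) • (Matrix.of G + (Matrix.of G)ᴴ)) *
      ENNReal.ofReal (gw (n := n) G) = (fun p : HC n × HC n =>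
      (Ψ (herm p.1) * ENNReal.ofReal (gw (herm p.1))) * ENNReal.ofReal (gw (herm p.2))) (e G) := by
    intro G
    have : e G = hsplit n G := rfl
    simp only [this]
    rw [herm_hsplit1, mul_assoc, ← ENNReal.ofReal_mul (gw_pos _).le, ← herm_hsplit1]
    congr 2
    unfold gw
    rw [← Real.exp_add, frob_split]
    congr 1; ring
  have e2 : ∫⁻ G : Fin n → Fin n → ℂ, Ψ ((1 / 2 : ℂ) • (Matrix.of G + (Matrix.of G)ᴴ)) *
      ENNReal.ofReal (gw (n := n) G) = d * ((∫⁻ X : HC n, Ψ (herm X) * ENNReal.ofReal (gw (herm X))) *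
        ∫⁻ Y : HC n, ENNReal.ofReal (gw (herm Y))) := by
    rw [lintegral_congr e1, ← lintegral_map hp e.continuous.measurable, hd, lintegral_smul_measure,
      Measure.volume_eq_prod, lintegral_prod_mul hg.aemeasurable hw.aemeasurable]
    rfl
  refine (congrArg (c * ·) e2).trans ?_
  ring

end GUEGap

namespace GUEGap
open scoped ComplexOrder
open MvPolynomial (pderiv)

lemma frob_trace {n : ℕ} (H : Matrix (Fin n) (Fin n) ℂ) : frob H = (trace (H * Hᴴ)).re := by
  simp [frob, trace, Matrix.mul_apply, Complex.normSq_apply, Complex.re_sum]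

lemma frob_conj {n : ℕ} (U H : Matrix (Fin n) (Fin n) ℂ) (hU : U * Uᴴ = 1) : frob (U * H * Uᴴ) = frob H := by
  have hU' : Uᴴ * U = 1 := mul_eq_one_comm.1 hU
  rw [frob_trace, frob_trace]
  have : U * H * Uᴴ * (U * H * Uᴴ)ᴴ = U * ((H * Hᴴ) * Uᴴ) := by
    rw [conjTranspose_mul, conjTranspose_mul, conjTranspose_conjTranspose]
    calc _ = U * H * (Uᴴ * U) * (Hᴴ * Uᴴ) := by simp only [Matrix.mul_assoc]
      _ = _ := by rw [hU']; simp only [Matrix.mul_assoc, Matrix.mul_one]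
  rw [this, trace_mul_comm, Matrix.mul_assoc, hU', Matrix.mul_one]

lemma gw_uinv {n : ℕ} : UInv (gw (n := n)) := fun U H hU => by unfold gw; rw [frob_conj U H hU]

lemma gw_dg {n : ℕ} (l : Fin n → ℝ) : gw (dg l) = ew l := by
  unfold gw ew frob dg
  congr 3
  refine Finset.sum_congr rfl fun i _ => ?_
  rw [Finset.sum_eq_single i]
  · simp [Complex.normSq_ofReal, sq]
  · intro j _ hj; simp [diagonal_apply_ne' _ hj]
  · simp

lemma ofReal_UU0 (m : ℕ) : ∫⁻ l in Om m, ENNReal.ofReal (vd2 l * ew l) = ENNReal.ofReal (UU m 0) := by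
  have h := (int_poly (PP m)).integrableOn (s := Om m)
  rw [UU, IP_apply]
  simp only [pow_zero, one_mul]
  rw [ofReal_integral_eq_lintegral_ofReal h]
  · simp only [eval_PP]
  · exact Filter.Eventually.of_forall fun l => mul_nonneg (by rw [eval_PP]; exact vd2_nonneg _) (ew_pos l).le

lemma gue_weyl0 (m : ℕ) : ∃ K : ENNReal, ∀ Ψ : Matrix (Fin (m + 1)) (Fin (m + 1)) ℂ → ENNReal, UInv Ψ →
    Measurable Ψ → ∫⁻ H, Ψ H ∂(GUE (m + 1)) =
      K * ∫⁻ l in Om m, ENNReal.ofReal (vd2 l * ew l) * Ψ (dg l) := by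
  obtain ⟨c, hc⟩ := gue_lint (m + 1)
  obtain ⟨κ, hκ⟩ := weylO_all m
  refine ⟨c * κ, fun Ψ hΨ hm => ?_⟩
  have h := hκ (fun H => Ψ H * ENNReal.ofReal (gw H))
    (fun U H hU => by simp only [hΨ U H hU, gw_uinv U H hU]) (hm.mul measurable_gw)
  rw [hc Ψ hm, h, mul_assoc]
  congr 2
  refine lintegral_congr fun l => ?_
  rw [gw_dg, ENNReal.ofReal_mul (vd2_nonneg _)]
  ring

lemma UU0_pos (m : ℕ) : 0 < UU m 0 := by
  obtain ⟨K, hK⟩ := gue_weyl0 m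
  have h := hK (fun _ => 1) (fun _ _ _ => rfl) measurable_const
  simp only [lintegral_one, measure_univ, mul_one] at h
  rw [ofReal_UU0] at h
  by_contra hn
  rw [ENNReal.ofReal_of_nonpos (not_lt.1 hn), mul_zero] at h
  exact one_ne_zero h

lemma gue_weyl (m : ℕ) (Ψ : Matrix (Fin (m + 1)) (Fin (m + 1)) ℂ → ENNReal) (hΨ : UInv Ψ)
    (hm : Measurable Ψ) : ENNReal.ofReal (UU m 0) * ∫⁻ H, Ψ H ∂(GUE (m + 1)) =
      ∫⁻ l in Om m, ENNReal.ofReal (vd2 l * ew l) * Ψ (dg l) := by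
  obtain ⟨K, hK⟩ := gue_weyl0 m
  have h := hK (fun _ => 1) (fun _ _ _ => rfl) measurable_const
  simp only [lintegral_one, measure_univ, mul_one] at h
  rw [ofReal_UU0] at h
  rw [hK Ψ hΨ hm, ← mul_assoc, mul_comm (ENNReal.ofReal _), ← h, one_mul]

/-- matrices with spectrum in a given set -/
def SP {n : ℕ} (A : Set (Fin n → ℝ)) : Set (Matrix (Fin n) (Fin n) ℂ) :=
  {H | ∃ U, U * Uᴴ = 1 ∧ ∃ y ∈ A, H = U * dg y * Uᴴ}

lemma isCompact_unitary (n : ℕ) : IsCompact {U : Matrix (Fin n) (Fin n) ℂ | U * Uᴴ = 1} := by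
  have hc : IsCompact (Set.univ.pi fun _ : Fin n => Set.univ.pi fun _ : Fin n => Metric.closedBall (0 : ℂ) 1) :=
    isCompact_univ_pi fun _ => isCompact_univ_pi fun _ => isCompact_closedBall _ _
  refine IsCompact.of_isClosed_subset (s := (Set.univ.pi fun _ : Fin n => Set.univ.pi fun _ : Fin n =>
    Metric.closedBall (0 : ℂ) 1)) hc ?_ ?_
  · exact isClosed_eq (by fun_prop) continuous_const
  · intro U hU i _ j _
    rw [mem_closedBall_zero_iff]
    exact entry_norm_bound_of_unitary (Matrix.mem_unitaryGroup_iff.2 hU) i j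

lemma measurableSet_SP {n : ℕ} {A : Set (Fin n → ℝ)} (hA : IsClosed A) : MeasurableSet (SP A) := by
  have : SP A = ⋃ N : ℕ, (fun p : Matrix (Fin n) (Fin n) ℂ × (Fin n → ℝ) => p.1 * dg p.2 * p.1ᴴ) ''
      ({U : Matrix (Fin n) (Fin n) ℂ | U * Uᴴ = 1} ×ˢ (A ∩ Metric.closedBall 0 (N : ℝ))) := by
    ext H
    simp only [Set.mem_iUnion, Set.mem_image, Prod.exists, Set.mem_prod]
    constructor
    · rintro ⟨U, hU, y, hy, rfl⟩
      obtain ⟨N, hN⟩ := exists_nat_ge ‖y‖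
      exact ⟨N, U, y, ⟨hU, hy, by simpa using hN⟩, rfl⟩
    · rintro ⟨N, U, y, ⟨hU, hy, _⟩, rfl⟩
      exact ⟨U, hU, y, hy, rfl⟩
  rw [this]
  refine MeasurableSet.iUnion fun N => IsClosed.measurableSet (IsCompact.isClosed ?_)
  refine ((isCompact_unitary n).prod ((isCompact_closedBall 0 (N : ℝ)).inter_left hA)).image ?_
  have := continuous_dg (m := n)
  fun_prop

lemma SP_conj {n : ℕ} {A : Set (Fin n → ℝ)} {U H : Matrix (Fin n) (Fin n) ℂ} (hU : U * Uᴴ = 1)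
    (h : H ∈ SP A) : U * H * Uᴴ ∈ SP A := by
  obtain ⟨V, hV, y, hy, rfl⟩ := h
  refine ⟨U * V, ?_, y, hy, ?_⟩
  · rw [conjTranspose_mul]
    calc _ = U * (V * Vᴴ) * Uᴴ := by simp only [Matrix.mul_assoc]
      _ = _ := by rw [hV, Matrix.mul_one, hU]
  · rw [conjTranspose_mul]; simp only [Matrix.mul_assoc]

lemma SP_uinv {n : ℕ} (A : Set (Fin n → ℝ)) (U H : Matrix (Fin n) (Fin n) ℂ) (hU : U * Uᴴ = 1) :
    U * H * Uᴴ ∈ SP A ↔ H ∈ SP A := by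
  refine ⟨fun h => ?_, SP_conj hU⟩
  have hU' : Uᴴ * U = 1 := mul_eq_one_comm.1 hU
  have := SP_conj (U := Uᴴ) (by simpa using hU') h
  rw [conjTranspose_conjTranspose] at this
  convert this using 1
  calc H = (Uᴴ * U) * H * (Uᴴ * U) := by rw [hU', Matrix.one_mul, Matrix.mul_one]
    _ = _ := by simp only [Matrix.mul_assoc]

lemma dg_mem_SP {n : ℕ} {A : Set (Fin n → ℝ)} (hA : ∀ y ∈ A, ∀ σ : Equiv.Perm (Fin n), y ∘ σ ∈ A)
    {l : Fin n → ℝ} (h : dg l ∈ SP A) : l ∈ A := by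
  obtain ⟨U, hU, y, hy, h⟩ := h
  have hU' : Uᴴ * U = 1 := mul_eq_one_comm.1 hU
  have hc : (dg l).charpoly = (dg y).charpoly := by
    rw [h]
    have := charpoly_units_conj ⟨U, Uᴴ, hU, hU'⟩ (dg y)
    rwa [← Matrix.coe_units_inv] at this
  have hr : Finset.univ.val.map (fun i => (l i : ℂ)) = Finset.univ.val.map (fun i => (y i : ℂ)) := by
    have := congrArg Polynomial.roots hc
    unfold dg at this
    rw [charpoly_diagonal, charpoly_diagonal] at this
    rw [Polynomial.roots_prod _ _ (Finset.prod_ne_zero_iff.2 fun i _ => Polynomial.X_sub_C_ne_zero _),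
      Polynomial.roots_prod _ _ (Finset.prod_ne_zero_iff.2 fun i _ => Polynomial.X_sub_C_ne_zero _)] at this
    simpa [Polynomial.roots_X_sub_C, Multiset.bind_singleton] using this
  have hr2 : Finset.univ.val.map l = Finset.univ.val.map y := by
    have := congrArg (Multiset.map Complex.re) hr
    simp only [Multiset.map_map] at this
    exact this
  have hp : List.Perm (List.ofFn l) (List.ofFn y) := by
    have e : ∀ f : Fin n → ℝ, Finset.univ.val.map f = (List.ofFn f : Multiset ℝ) := fun f => by simp
    rw [e, e] at hr2
    exact Multiset.coe_eq_coe.1 hr2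
  have hs : l ∘ Tuple.sort l = y ∘ Tuple.sort y :=
    List.ofFn_injective <|
      (((Tuple.sort l).ofFn_comp_perm l).trans (hp.trans ((Tuple.sort y).ofFn_comp_perm y).symm)).eq_of_pairwise'
        (Tuple.monotone_sort l).sortedLE_ofFn.pairwise (Tuple.monotone_sort y).sortedLE_ofFn.pairwise
  have : l = y ∘ ((Tuple.sort l)⁻¹.trans (Tuple.sort y)) := by
    funext i
    have := congrFun hs ((Tuple.sort l)⁻¹ i)
    simpa using this
  rw [this]
  exact hA y hy _

lemma gue_neg (n : ℕ) (S : Set (Matrix (Fin n) (Fin n) ℂ)) (hS : MeasurableSet S) :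
    GUE n {H | -H ∈ S} = GUE n S := by
  have i1 : ∀ α : Type, ∀ [NormedAddCommGroup α] [NormedSpace ℝ α] [FiniteDimensional ℝ α] [MeasureSpace α]
      [BorelSpace α] [(volume : Measure α).IsAddHaarMeasure],
      (volume : Measure (Fin n → α)).IsAddHaarMeasure := by
    intro α _ _ _ _ _ _
    infer_instance
  have i3 : (volume : Measure (HC n)).IsAddHaarMeasure := i1 (Fin n → ℝ)
  obtain ⟨c, hc⟩ := gue_lint n
  have hneg : Measurable fun H : Matrix (Fin n) (Fin n) ℂ => -H := continuous_neg.measurable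
  have hS' : MeasurableSet {H : Matrix (Fin n) (Fin n) ℂ | -H ∈ S} := hneg hS
  rw [← lintegral_indicator_one hS, ← lintegral_indicator_one hS', hc _ (measurable_one.indicator hS),
    hc _ (measurable_one.indicator hS')]
  congr 1
  rw [← lintegral_neg_eq_self (μ := (volume : Measure (HC n)))]
  refine lintegral_congr fun X => ?_
  have h : herm (-X) = - herm X := by
    have := herm_smul (-1) X
    simpa using this
  have h2 : gw (-herm X) = gw (herm X) := by simp [gw, frob]
  rw [h, h2]
  congr 1
  by_cases hX : herm X ∈ S
  · rw [Set.indicator_of_mem hX, Set.indicator_of_mem]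
    · rfl
    · change - -herm X ∈ S
      rwa [neg_neg]
  · rw [Set.indicator_of_notMem hX, Set.indicator_of_notMem]
    change ¬ (- -herm X ∈ S)
    rwa [neg_neg]

/-- spectra with a small relative gap at a positive extreme point -/
def AP (n : ℕ) (c : ℝ) : Set (Fin n → ℝ) :=
  {y | ∃ i, (∀ k, |y k| ≤ y i) ∧ ∃ k, k ≠ i ∧ y i ≤ c * |y k|}

lemma isClosed_AP (n : ℕ) (c : ℝ) : IsClosed (AP n c) := by
  have : AP n c = ⋃ i, ((⋂ k, {y : Fin n → ℝ | |y k| ≤ y i}) ∩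
      ⋃ k, {y : Fin n → ℝ | k ≠ i ∧ y i ≤ c * |y k|}) := by
    ext y
    simp [AP]
  rw [this]
  refine isClosed_iUnion_of_finite fun i => IsClosed.inter (isClosed_iInter fun k => ?_)
    (isClosed_iUnion_of_finite fun k => ?_)
  · exact isClosed_le (by fun_prop) (by fun_prop)
  · by_cases h : k = i
    · simp [h]
    · simp only [ne_eq, h, not_false_eq_true, true_and]
      exact isClosed_le (by fun_prop) (by fun_prop)

lemma AP_perm (n : ℕ) (c : ℝ) : ∀ y ∈ AP n c, ∀ σ : Equiv.Perm (Fin n), y ∘ σ ∈ AP n c := by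
  rintro y ⟨i, h1, k, hk, h2⟩ σ
  refine ⟨σ.symm i, fun k => by simpa using h1 (σ k), σ.symm k, by simpa using hk, by simpa using h2⟩

lemma AP_Om {m : ℕ} {c : ℝ} {l : Fin (m + 1) → ℝ} (hl : l ∈ Om m) (h : l ∈ AP (m + 1) c) : l ∈ EE m c := by
  obtain ⟨i, h1, k, hk, h2⟩ := h
  have hi : i = 0 := by
    by_contra hi
    obtain ⟨j, rfl⟩ := Fin.exists_succ_eq.2 hi
    have := hl j
    have h3 := h1 0
    linarith [le_abs_self (l 0)]
  subst hi
  obtain ⟨j, rfl⟩ := Fin.exists_succ_eq.2 hk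
  exact ⟨h1, j, h2⟩

lemma neg_dg {n : ℕ} (y : Fin n → ℝ) : - dg y = dg (-y) := by
  ext i j
  by_cases h : i = j
  · subst h; simp [dg]
  · simp [dg, h]

lemma event_sub (m : ℕ) (hm : 0 < m) (c : ℝ) (hc : 0 < c) (H : Matrix (Fin (m + 1)) (Fin (m + 1)) ℂ)
    (h : |absSortedEigs H ⟨0, by omega⟩| < c * |absSortedEigs H ⟨1 % (m + 1), Nat.mod_lt _ (by omega)⟩|) :
    H ∈ SP (AP (m + 1) c) ∪ {H | -H ∈ SP (AP (m + 1) c)} := by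
  unfold absSortedEigs at h
  split_ifs at h with hH
  · obtain ⟨U, hU, hE⟩ := spectral_form hH
    obtain ⟨y, hy⟩ : ∃ y, y = hH.eigenvalues := ⟨_, rfl⟩
    rw [← hy] at h hE
    obtain ⟨σ, hσ⟩ : ∃ σ, σ = Tuple.sort fun i => |y i| := ⟨_, rfl⟩
    have hmono : Monotone ((fun i => |y i|) ∘ σ) := hσ ▸ Tuple.monotone_sort _
    rw [← hσ] at h
    obtain ⟨a, ha⟩ : ∃ a, a = Fin.rev (⟨0, by omega⟩ : Fin (m + 1)) := ⟨_, rfl⟩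
    obtain ⟨b, hb⟩ : ∃ b, b = Fin.rev (⟨1 % (m + 1), Nat.mod_lt _ (by omega)⟩ : Fin (m + 1)) := ⟨_, rfl⟩
    have hab : b ≠ a := by
      rw [ha, hb, Ne, Fin.rev_inj, Fin.mk.injEq, Nat.mod_eq_of_lt (by omega)]
      omega
    beta_reduce at h
    rw [← ha, ← hb] at h
    have hmax : ∀ k, |y k| ≤ |y (σ a)| := by
      intro k
      have h3 : σ.symm k ≤ a := by
        rw [ha, Fin.le_def, Fin.val_rev]
        have := (σ.symm k).isLt
        simp only
        omega
      have := hmono h3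
      simpa using this
    have hne : σ b ≠ σ a := fun h => hab (σ.injective h)
    have hE' : H = U * dg y * Uᴴ := hE
    rcases le_total 0 (y (σ a)) with hs | hs
    · left
      refine ⟨U, hU, y, ⟨σ a, fun k => ?_, σ b, hne, ?_⟩, hE'⟩
      · rw [← abs_of_nonneg hs]; exact hmax k
      · rw [abs_of_nonneg hs] at h; exact h.le
    · right
      refine ⟨U, hU, -y, ⟨σ a, fun k => ?_, σ b, hne, ?_⟩, ?_⟩
      · simp only [Pi.neg_apply, abs_neg]
        rw [← abs_of_nonpos hs]; exact hmax k
      · simp only [Pi.neg_apply, abs_neg]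
        rw [abs_of_nonpos hs] at h; exact h.le
      · rw [hE', ← neg_dg]; simp
  · simp at h

lemma gue_event (m : ℕ) (hm : 0 < m) (ε : ℝ) (hε : 0 ≤ ε) :
    ENNReal.ofReal (UU m 0) * GUE (m + 1) {H | |absSortedEigs H ⟨0, by omega⟩| <
      (1 + ε) * |absSortedEigs H ⟨1 % (m + 1), Nat.mod_lt _ (by omega)⟩|} ≤
    2 * ENNReal.ofReal (ε * (∫ l in Om m, |MvPolynomial.eval l (MvPolynomial.X 0 * RR m) * ew l|) +
        ε ^ 3 * IP m (MvPolynomial.X 0 ^ 4 * QP m)) := by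
  have hS := measurableSet_SP (isClosed_AP (m + 1) (1 + ε))
  have h1 : GUE (m + 1) {H | |absSortedEigs H ⟨0, by omega⟩| <
      (1 + ε) * |absSortedEigs H ⟨1 % (m + 1), Nat.mod_lt _ (by omega)⟩|} ≤
      2 * GUE (m + 1) (SP (AP (m + 1) (1 + ε))) := by
    refine (measure_mono fun H hH => event_sub m hm (1 + ε) (by linarith) H hH).trans ?_
    refine (measure_union_le _ _).trans ?_
    rw [gue_neg _ _ hS, two_mul]
  have h2 := gue_weyl m ((SP (AP (m + 1) (1 + ε))).indicator 1)
    (fun U H hU => by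
      by_cases hH : H ∈ SP (AP (m + 1) (1 + ε))
      · rw [Set.indicator_of_mem hH, Set.indicator_of_mem ((SP_uinv _ U H hU).2 hH)]; rfl
      · rw [Set.indicator_of_notMem hH, Set.indicator_of_notMem (mt (SP_uinv _ U H hU).1 hH)])
    (measurable_one.indicator hS)
  rw [lintegral_indicator_one hS] at h2
  refine (mul_le_mul_right h1 _).trans ?_
  rw [mul_left_comm, h2]
  refine mul_le_mul_right ((le_trans ?_) (chamber_bound hm ε hε)) _
  have hO := (isOpen_Om m).measurableSet
  rw [← lintegral_indicator hO, ← lintegral_indicator (hO.inter (measurableSet_EE m (1 + ε)))]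
  refine lintegral_mono fun l => ?_
  by_cases hl : l ∈ Om m
  · rw [Set.indicator_of_mem hl]
    by_cases hd : dg l ∈ SP (AP (m + 1) (1 + ε))
    · have hm2 : l ∈ Om m ∩ EE m (1 + ε) := ⟨hl, AP_Om hl (dg_mem_SP (AP_perm _ _) hd)⟩
      rw [Set.indicator_of_mem hd, Set.indicator_of_mem hm2]
      simp
    · rw [Set.indicator_of_notMem hd]; simp
  · rw [Set.indicator_of_notMem hl]; simp

end GUEGap

namespace GUEGap
open scoped ComplexOrder
open MvPolynomial (pderiv)

lemma int_cons_c {j : ℕ} (f : (Fin (j + 1) → ℂ) → ℝ) :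
    ∫ w, f w = ∫ p : ℂ × (Fin j → ℂ), f (Fin.cons p.1 p.2) := by
  have e := (volume_preserving_piFinSuccAbove (fun _ : Fin (j + 1) => ℂ) 0).symm
  rw [← e.integral_comp (MeasurableEquiv.measurableEmbedding _)]
  refine integral_congr_ae (Filter.Eventually.of_forall fun p => ?_)
  simp [MeasurableEquiv.piFinSuccAbove, Fin.insertNthEquiv, Fin.insertNth_zero]

lemma integrable_cons_c {j : ℕ} (f : (Fin (j + 1) → ℂ) → ℝ)
    (hf : Integrable fun p : ℂ × (Fin j → ℂ) => f (Fin.cons p.1 p.2)) : Integrable f := by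
  have e := (volume_preserving_piFinSuccAbove (fun _ : Fin (j + 1) => ℂ) 0).symm
  rw [← e.integrable_comp_emb (MeasurableEquiv.measurableEmbedding _)]
  refine hf.congr (Filter.Eventually.of_forall fun p => ?_)
  simp [MeasurableEquiv.piFinSuccAbove, Fin.insertNthEquiv, Fin.insertNth_zero]

/-- one-dimensional complex Gaussian moments -/
lemma cmom (k : ℕ) : ∫ z : ℂ, (‖z‖ ^ 2) ^ k * Real.exp (-‖z‖ ^ 2) = Real.pi * k.factorial := by
  have h := Complex.integral_rpow_mul_exp_neg_rpow (p := 2) (q := 2 * k) (by norm_num) (by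
    have : (0 : ℝ) ≤ k := by positivity
    linarith)
  rw [show ((2 * k : ℝ) + 2) / 2 = k + 1 by ring, Real.Gamma_nat_eq_factorial] at h
  rw [show 2 * Real.pi / 2 * (k.factorial : ℝ) = Real.pi * k.factorial by ring] at h
  rw [← h]
  refine integral_congr_ae (Filter.Eventually.of_forall fun z => ?_)
  simp only
  rw [Real.rpow_mul (norm_nonneg _), Real.rpow_natCast, Real.rpow_two]

lemma cmom_int (k : ℕ) : Integrable fun z : ℂ => (‖z‖ ^ 2) ^ k * Real.exp (-‖z‖ ^ 2) := by
  refine Integrable.of_integral_ne_zero ?_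
  rw [cmom]
  positivity

lemma nsq_cons {j : ℕ} (z : ℂ) (w : Fin j → ℂ) : nsq (Fin.cons z w : Fin (j + 1) → ℂ) = ‖z‖ ^ 2 + nsq w := by
  simp [nsq, Fin.sum_univ_succ]

/-- complex Gaussian moments -/
noncomputable def gI (j k : ℕ) : ℝ := ∫ w : Fin j → ℂ, nsq w ^ k * Real.exp (-nsq w)

lemma gmom (j : ℕ) : (∀ k ≤ 2, Integrable fun w : Fin j → ℂ => nsq w ^ k * Real.exp (-nsq w)) ∧
    0 < gI j 0 ∧ gI j 1 = j * gI j 0 ∧ gI j 2 = j * (j + 1) * gI j 0 := by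
  induction j with
  | zero =>
    refine ⟨fun k _ => ?_, ?_, ?_, ?_⟩
    · simp [nsq]
    · simp [gI, nsq]
    · simp [gI, nsq]
    · simp [gI, nsq]
  | succ j ih =>
    obtain ⟨hi, h0, h1, h2⟩ := ih
    have P : ∀ a b : ℕ, b ≤ 2 → Integrable fun p : ℂ × (Fin j → ℂ) =>
        ((‖p.1‖ ^ 2) ^ a * Real.exp (-‖p.1‖ ^ 2)) * (nsq p.2 ^ b * Real.exp (-nsq p.2)) := fun a b hb =>
      (cmom_int a).mul_prod (hi b hb)
    have V : ∀ a b : ℕ, ∫ p : ℂ × (Fin j → ℂ),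
        ((‖p.1‖ ^ 2) ^ a * Real.exp (-‖p.1‖ ^ 2)) * (nsq p.2 ^ b * Real.exp (-nsq p.2)) =
        Real.pi * a.factorial * gI j b := fun a b => by
      rw [← cmom a, gI]
      exact integral_prod_mul (fun z : ℂ => (‖z‖ ^ 2) ^ a * Real.exp (-‖z‖ ^ 2))
        (fun w : Fin j → ℂ => nsq w ^ b * Real.exp (-nsq w))
    have E0 : ∀ p : ℂ × (Fin j → ℂ), nsq (Fin.cons p.1 p.2 : Fin (j + 1) → ℂ) ^ 0 *
        Real.exp (-nsq (Fin.cons p.1 p.2 : Fin (j + 1) → ℂ)) =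
        ((‖p.1‖ ^ 2) ^ 0 * Real.exp (-‖p.1‖ ^ 2)) * (nsq p.2 ^ 0 * Real.exp (-nsq p.2)) := by
      intro p
      rw [nsq_cons, neg_add, Real.exp_add]; ring
    have E1 : ∀ p : ℂ × (Fin j → ℂ), nsq (Fin.cons p.1 p.2 : Fin (j + 1) → ℂ) ^ 1 *
        Real.exp (-nsq (Fin.cons p.1 p.2 : Fin (j + 1) → ℂ)) =
        ((‖p.1‖ ^ 2) ^ 1 * Real.exp (-‖p.1‖ ^ 2)) * (nsq p.2 ^ 0 * Real.exp (-nsq p.2)) +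
        ((‖p.1‖ ^ 2) ^ 0 * Real.exp (-‖p.1‖ ^ 2)) * (nsq p.2 ^ 1 * Real.exp (-nsq p.2)) := by
      intro p
      rw [nsq_cons, neg_add, Real.exp_add]; ring
    have E2 : ∀ p : ℂ × (Fin j → ℂ), nsq (Fin.cons p.1 p.2 : Fin (j + 1) → ℂ) ^ 2 *
        Real.exp (-nsq (Fin.cons p.1 p.2 : Fin (j + 1) → ℂ)) =
        ((‖p.1‖ ^ 2) ^ 2 * Real.exp (-‖p.1‖ ^ 2)) * (nsq p.2 ^ 0 * Real.exp (-nsq p.2)) +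
        2 * (((‖p.1‖ ^ 2) ^ 1 * Real.exp (-‖p.1‖ ^ 2)) * (nsq p.2 ^ 1 * Real.exp (-nsq p.2))) +
        ((‖p.1‖ ^ 2) ^ 0 * Real.exp (-‖p.1‖ ^ 2)) * (nsq p.2 ^ 2 * Real.exp (-nsq p.2)) := by
      intro p
      rw [nsq_cons, neg_add, Real.exp_add]; ring
    have I0 : gI (j + 1) 0 = Real.pi * gI j 0 := by
      rw [gI, int_cons_c, integral_congr_ae (Filter.Eventually.of_forall E0), V]; simp
    have I1 : gI (j + 1) 1 = Real.pi * gI j 0 + Real.pi * gI j 1 := by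
      rw [gI, int_cons_c, integral_congr_ae (Filter.Eventually.of_forall E1),
        integral_add (P 1 0 (by norm_num)) (P 0 1 (by norm_num)), V, V]; simp
    have I2 : gI (j + 1) 2 = Real.pi * 2 * gI j 0 + 2 * (Real.pi * gI j 1) + Real.pi * gI j 2 := by
      have Q : Integrable fun p : ℂ × (Fin j → ℂ) =>
          ((‖p.1‖ ^ 2) ^ 2 * Real.exp (-‖p.1‖ ^ 2)) * (nsq p.2 ^ 0 * Real.exp (-nsq p.2)) +
          2 * (((‖p.1‖ ^ 2) ^ 1 * Real.exp (-‖p.1‖ ^ 2)) * (nsq p.2 ^ 1 * Real.exp (-nsq p.2))) :=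
        (P 2 0 (by norm_num)).add ((P 1 1 (by norm_num)).const_mul 2)
      rw [gI, int_cons_c, integral_congr_ae (Filter.Eventually.of_forall E2),
        integral_add Q (P 0 2 (by norm_num)),
        integral_add (P 2 0 (by norm_num)) ((P 1 1 (by norm_num)).const_mul 2), integral_const_mul, V, V, V]; simp
    refine ⟨fun k hk => integrable_cons_c _ ?_, ?_, ?_, ?_⟩
    · interval_cases k
      · exact (P 0 0 (by norm_num)).congr (Filter.Eventually.of_forall fun p => (E0 p).symm)
      · exact ((P 1 0 (by norm_num)).add (P 0 1 (by norm_num))).congr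
          (Filter.Eventually.of_forall fun p => (E1 p).symm)
      · exact (((P 2 0 (by norm_num)).add ((P 1 1 (by norm_num)).const_mul 2)).add (P 0 2 (by norm_num))).congr
          (Filter.Eventually.of_forall fun p => (E2 p).symm)
    · rw [I0]; positivity
    · rw [I1, I0, h1]; push_cast; ring
    · rw [I2, I0, h1, h2]; push_cast; ring

lemma sqrt_lower (s a : ℝ) (hs : 0 ≤ s) (ha : 0 < a) : (3 * a ^ 2 * s - s ^ 2) / (2 * a ^ 3) ≤ √s := by
  obtain ⟨r, hr⟩ : ∃ r, r = √s := ⟨_, rfl⟩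
  have hr0 : 0 ≤ r := hr ▸ Real.sqrt_nonneg _
  have hs' : s = r ^ 2 := by rw [hr, Real.sq_sqrt hs]
  rw [← hr, hs', div_le_iff₀ (by positivity)]
  have : r * (2 * a ^ 3) - (3 * a ^ 2 * r ^ 2 - (r ^ 2) ^ 2) = r * ((a - r) ^ 2 * (2 * a + r)) := by ring
  have : 0 ≤ r * ((a - r) ^ 2 * (2 * a + r)) := by positivity
  linarith

lemma beta_int (j : ℕ) : Integrable fun w : Fin j → ℂ => √(nsq w) * Real.exp (-nsq w) := by
  obtain ⟨hi, -⟩ := gmom j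
  refine Integrable.mono' ((hi 0 (by norm_num)).add (hi 1 (by norm_num))) ?_ ?_
  · have := continuous_nsq (m := j)
    exact Continuous.aestronglyMeasurable (by fun_prop)
  · refine Filter.Eventually.of_forall fun w => ?_
    have h0 := nsq_nonneg w
    rw [Real.norm_of_nonneg (by positivity)]
    simp only [Pi.add_apply]
    have : √(nsq w) ≤ 1 + nsq w := by
      rw [Real.sqrt_le_left (by linarith)]
      nlinarith
    nlinarith [Real.exp_pos (-nsq w)]

lemma beta_bound (j : ℕ) (hj : 0 < j) (b : ℝ) (hb : b ^ 2 ≤ j - 1) :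
    b * gI j 0 ≤ ∫ w : Fin j → ℂ, √(nsq w) * Real.exp (-nsq w) := by
  obtain ⟨hi, h0, h1, h2⟩ := gmom j
  have hj' : (0 : ℝ) < j := by exact_mod_cast hj
  obtain ⟨a, ha⟩ : ∃ a, a = √(j : ℝ) := ⟨_, rfl⟩
  have ha0 : 0 < a := ha ▸ Real.sqrt_pos.2 hj'
  have ha2 : a ^ 2 = j := by rw [ha, Real.sq_sqrt hj'.le]
  have hI : ∫ w : Fin j → ℂ, (3 / (2 * a) * (nsq w ^ 1 * Real.exp (-nsq w)) -
      1 / (2 * a ^ 3) * (nsq w ^ 2 * Real.exp (-nsq w))) = (a - 1 / (2 * a)) * gI j 0 := by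
    rw [integral_sub ((hi 1 (by norm_num)).const_mul _) ((hi 2 (by norm_num)).const_mul _),
      integral_const_mul, integral_const_mul]
    change _ * gI j 1 - _ * gI j 2 = _
    rw [h1, h2, ← ha2]
    field_simp
    ring
  have hle : (a - 1 / (2 * a)) * gI j 0 ≤ ∫ w : Fin j → ℂ, √(nsq w) * Real.exp (-nsq w) := by
    rw [← hI]
    refine integral_mono (((hi 1 (by norm_num)).const_mul _).sub ((hi 2 (by norm_num)).const_mul _))
      (beta_int j) fun w => ?_
    have := sqrt_lower (nsq w) a (nsq_nonneg w) ha0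
    have h3 := mul_le_mul_of_nonneg_right this (Real.exp_pos (-nsq w)).le
    refine le_trans (le_of_eq ?_) h3
    field_simp
  refine le_trans (mul_le_mul_of_nonneg_right ?_ h0.le) hle
  have hx : 0 ≤ a - 1 / (2 * a) := by
    rw [sub_nonneg, div_le_iff₀ (by positivity)]
    have : (1 : ℝ) ≤ j := by exact_mod_cast hj
    nlinarith
  refine abs_le_of_sq_le_sq' ?_ hx |>.2
  have : (a - 1 / (2 * a)) ^ 2 = a ^ 2 - 1 + (1 / (2 * a)) ^ 2 := by field_simp; ring
  rw [this, ha2]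
  nlinarith [sq_nonneg (1 / (2 * a))]

end GUEGap

namespace GUEGap
open scoped ComplexOrder
open MvPolynomial (pderiv)

lemma frob_hblk {m : ℕ} (h : ℝ) (w : Fin m → ℂ) (D : Matrix (Fin m) (Fin m) ℂ) :
    frob (hblk h w D) = h ^ 2 + 2 * nsq w + frob D := by
  unfold frob hblk nsq
  rw [Fin.sum_univ_succ, Fin.sum_univ_succ]
  simp only [blk_zero_zero, blk_zero_succ, Fin.sum_univ_succ, blk_succ_zero, blk_succ_succ,
    Finset.sum_add_distrib, Pi.star_apply, Complex.normSq_eq_norm_sq, norm_star]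
  simp only [Complex.norm_real, Real.norm_eq_abs, sq_abs]
  ring

lemma gw_joinC {m : ℕ} (p : ℝ × (Fin m → ℂ) × HC m) :
    gw (herm (joinC p)) = Real.exp (-(p.1 ^ 2) / 2) * Real.exp (-nsq p.2.1) * gw (herm p.2.2) := by
  unfold gw
  rw [herm_joinC, frob_hblk, ← Real.exp_add, ← Real.exp_add]
  congr 1
  ring

lemma continuous_gwherm {m : ℕ} : Continuous fun X : HC m => gw (herm X) :=
  continuous_gw.comp continuous_herm

lemma exph_int (k : ℕ) (hk : k ≤ 1) : Integrable fun h : ℝ => h ^ k * Real.exp (-(h ^ 2) / 2) := by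
  interval_cases k
  · refine (integrable_exp_neg_mul_sq (b := 1 / 2) (by norm_num)).congr (Filter.Eventually.of_forall fun h => ?_)
    simp only [pow_zero, one_mul]
    congr 1; ring
  · refine (integrable_mul_exp_neg_mul_sq (b := 1 / 2) (by norm_num)).congr (Filter.Eventually.of_forall fun h => ?_)
    simp only [pow_one]
    congr 2; ring

lemma exph_odd : ∫ h : ℝ, h ^ 1 * Real.exp (-(h ^ 2) / 2) = 0 := by
  have h := integral_neg_eq_self (fun h : ℝ => h ^ 1 * Real.exp (-(h ^ 2) / 2)) volume
  simp only [pow_one, neg_mul, neg_sq, integral_neg] at h ⊢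
  linarith

lemma gwherm_int (m : ℕ) : Integrable fun X : HC m => gw (herm X) := by
  induction m with
  | zero => 
    have : (fun X : HC 0 => gw (herm X)) = fun _ => 1 := by
      funext X; simp [gw, frob]
    rw [this]
    have : IsFiniteMeasure (volume : Measure (HC 0)) := by
      refine ⟨?_⟩
      rw [volume_pi, Measure.pi_univ]; simp
    exact integrable_const _
  | succ m ih =>
    refine ((joinC_measurePreserving m).integrable_comp continuous_gwherm.aestronglyMeasurable).1 ?_
    have h1 := (gmom m).1 0 (by norm_num)
    have := (exph_int 0 (by norm_num)).mul_prod (h1.mul_prod ih)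
    refine this.congr (Filter.Eventually.of_forall fun p => ?_)
    simp only [Function.comp]
    rw [gw_joinC]; ring

/-- total mass of the unnormalised weight -/
noncomputable def WW (m : ℕ) : ℝ := ∫ X : HC m, gw (herm X)

lemma integral_joinC {m : ℕ} (f : HC (m + 1) → ℝ) (hf : Integrable f) :
    Integrable (fun p : (ℝ × (Fin m → ℂ)) × HC m => f (joinC (p.1.1, p.1.2, p.2))) ∧
    ∫ X, f X = ∫ p : (ℝ × (Fin m → ℂ)) × HC m, f (joinC (p.1.1, p.1.2, p.2)) := by
  have h1 : MeasurePreserving (fun p : (ℝ × (Fin m → ℂ)) × HC m => (joinC (p.1.1, p.1.2, p.2) : HC (m + 1)))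
      volume volume :=
    (joinC_measurePreserving m).comp (measurePreserving_prodAssoc volume volume volume)
  refine ⟨(h1.integrable_comp hf.1).2 hf, ?_⟩
  rw [← h1.map_eq, integral_map h1.measurable.aemeasurable]
  rw [h1.map_eq]; exact hf.1

lemma WW_succ (m : ℕ) : WW (m + 1) =
    (∫ h : ℝ, h ^ 0 * Real.exp (-(h ^ 2) / 2)) * gI m 0 * WW m := by
  unfold WW
  rw [(integral_joinC _ (gwherm_int (m + 1))).2, gI, ← integral_prod_mul, ← integral_prod_mul]
  refine integral_congr_ae (Filter.Eventually.of_forall fun p => ?_)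
  simp only [gw_joinC, pow_zero, one_mul]

lemma WW_pos (m : ℕ) : 0 < WW m :=
  integral_pos_of_integrable_nonneg_nonzero continuous_gwherm (gwherm_int m)
    (fun X => (gw_pos (herm X)).le) (gw_pos (herm (0 : HC m))).ne'

lemma congC_mp {m : ℕ} (U : Matrix (Fin m) (Fin m) ℂ) (hU : U * Uᴴ = 1) :
    MeasurePreserving (congC U) volume volume := by
  have i1 : ∀ α : Type, ∀ [NormedAddCommGroup α] [NormedSpace ℝ α] [FiniteDimensional ℝ α] [MeasureSpace α]
      [BorelSpace α] [(volume : Measure α).IsAddHaarMeasure],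
      (volume : Measure (Fin m → α)).IsAddHaarMeasure := by
    intro α _ _ _ _ _ _
    infer_instance
  have i3 : (volume : Measure (HC m)).IsAddHaarMeasure := i1 (Fin m → ℝ)
  have hU' : Uᴴ * U = 1 := mul_eq_one_comm.1 hU
  have hd := congC_det_ne U Uᴴ hU'
  have hc : Measurable (congC U) := (congC U).continuous_of_finiteDimensional.measurable
  have h1 := Measure.map_linearMap_addHaar_eq_smul_addHaar (volume : Measure (HC m)) hd
  have h2 := lint_linear (volume : Measure (HC m)) (congC U) hd (fun X => ENNReal.ofReal (gw (herm X)))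
    (measurable_gw.comp measurable_herm)
  simp only [herm_congC, gw_uinv U _ hU] at h2
  have h3 : ∫⁻ X : HC m, ENNReal.ofReal (gw (herm X)) = ENNReal.ofReal (WW m) := by
    rw [WW, ofReal_integral_eq_lintegral_ofReal (gwherm_int m)
      (Filter.Eventually.of_forall fun X => (gw_pos (herm X)).le)]
  rw [h3] at h2
  have h4 : ENNReal.ofReal |(LinearMap.det (congC U))⁻¹| = 1 := by
    have hz : ENNReal.ofReal (WW m) ≠ 0 := by simpa using WW_pos m
    have := h2.symm
    rwa [ENNReal.mul_eq_right hz ENNReal.ofReal_ne_top] at this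
  refine ⟨hc, ?_⟩
  rw [h1, h4, one_smul]

/-- zeroth coordinate -/
def hd0 {m : ℕ} (q : Fin m → ℂ) : ℂ := if h : 0 < m then q ⟨0, h⟩ else 0

lemma align {m : ℕ} (w : Fin m → ℂ) : ∃ U : Matrix (Fin m) (Fin m) ℂ, U * Uᴴ = 1 ∧
    ∀ p, star w ⬝ᵥ (U *ᵥ p) = (√(nsq w) : ℂ) * hd0 p := by
  by_cases hw : nsq w = 0
  · refine ⟨1, by simp, fun p => ?_⟩
    have : w = 0 := by
      funext i
      have := (Finset.sum_eq_zero_iff_of_nonneg (fun i _ => sq_nonneg ‖w i‖)).1 hw i (Finset.mem_univ _)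
      simpa using this
    simp [this, nsq]
  have hm : 0 < m := by
    rcases Nat.eq_zero_or_pos m with h | h
    · subst h; simp [nsq] at hw
    · exact h
  have hs : 0 < √(nsq w) := Real.sqrt_pos.2 (lt_of_le_of_ne (nsq_nonneg w) (Ne.symm hw))
  obtain ⟨r, hr⟩ : ∃ r, r = √(nsq w) := ⟨_, rfl⟩
  rw [← hr] at hs ⊢
  obtain ⟨b, hb⟩ := Orthonormal.exists_orthonormalBasis_extension_of_card_eq (𝕜 := ℂ)
    (E := EuclideanSpace ℂ (Fin m)) (ι := Fin m) (by simp)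
    (v := fun _ => WithLp.toLp 2 (fun i => (r : ℂ)⁻¹ * w i)) (s := {(⟨0, hm⟩ : Fin m)}) (by
      constructor
      · intro i
        simp only [Set.restrict_apply, EuclideanSpace.norm_eq, norm_mul, mul_pow, ← Finset.mul_sum]
        change √(‖(r : ℂ)⁻¹‖ ^ 2 * nsq w) = 1
        rw [Real.sqrt_mul (by positivity), ← hr, Real.sqrt_sq (norm_nonneg _)]
        simp [abs_of_pos hs, hs.ne']
      · intro i j hij
        exact absurd (Subsingleton.elim i j) hij)
  have hb0 := hb ⟨0, hm⟩ (by simp)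
  refine ⟨Matrix.of fun i k => b k i, ?_, fun p => ?_⟩
  · rw [mul_eq_one_comm]
    ext k l
    rw [Matrix.mul_apply, Matrix.one_apply]
    have := orthonormal_iff_ite.1 b.orthonormal k l
    rw [← this]
    simp [PiLp.inner_apply, conjTranspose_apply, mul_comm]
  · have h1 : star w ⬝ᵥ (Matrix.of (fun i k => b k i) *ᵥ p) =
        ∑ k, (∑ i, star (w i) * b k i) * p k := by
      simp only [dotProduct, mulVec, Finset.mul_sum, Finset.sum_mul, Pi.star_apply]
      rw [Finset.sum_comm]
      simp only [mul_assoc, Matrix.of_apply]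
    have h2 : ∀ k, ∑ i, star (w i) * b k i = if (⟨0, hm⟩ : Fin m) = k then (r : ℂ) else 0 := by
      intro k
      have := orthonormal_iff_ite.1 b.orthonormal ⟨0, hm⟩ k
      rw [hb0] at this
      have h3 : ∑ i, star (w i) * b k i = r * inner ℂ (WithLp.toLp 2 (fun i => (r : ℂ)⁻¹ * w i) : EuclideanSpace ℂ (Fin m)) (b k) := by
        simp only [PiLp.inner_apply, Finset.mul_sum, RCLike.inner_apply, map_mul, map_inv₀, Complex.conj_ofReal]
        refine Finset.sum_congr rfl fun i _ => ?_
        have : (r : ℂ) ≠ 0 := by exact_mod_cast hs.ne'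
        field_simp
        simp [mul_comm]
      rw [h3, this]
      split_ifs <;> simp
    rw [h1]
    simp only [h2, ite_mul, zero_mul, Finset.sum_ite_eq, Finset.mem_univ, if_true]
    simp [hd0, hm]

end GUEGap

namespace GUEGap
open scoped ComplexOrder
open MvPolynomial (pderiv)

/-- sum of squares of a list -/
def sqs : List ℝ → ℝ
  | [] => 0
  | v :: L => v ^ 2 + sqs L

/-- twice the sum of products of consecutive entries -/
def cfs : List ℝ → ℝ
  | [] => 0
  | v :: L => 2 * v * L.headD 0 + cfs L

/-- real quadratic form -/
noncomputable def qf {m : ℕ} (H : Matrix (Fin m) (Fin m) ℂ) (q : Fin m → ℂ) : ℝ := (star q ⬝ᵥ (H *ᵥ q)).re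

lemma qf_hblk {m : ℕ} (h v : ℝ) (w q : Fin m → ℂ) (D : Matrix (Fin m) (Fin m) ℂ) :
    qf (hblk h w D) (Fin.cons (v : ℂ) q : Fin (m + 1) → ℂ) =
      h * v ^ 2 + 2 * v * (star w ⬝ᵥ q).re + qf D q := by
  have h1 : (star q ⬝ᵥ w).re = (star w ⬝ᵥ q).re := by
    rw [star_dotProduct]; simp
  have h2 : star (Fin.cons (v : ℂ) q : Fin (m + 1) → ℂ) ⬝ᵥ (hblk h w D *ᵥ (Fin.cons (v : ℂ) q : Fin (m + 1) → ℂ)) =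
      v * (h * v + star w ⬝ᵥ q) + v * (star q ⬝ᵥ w) + star q ⬝ᵥ (D *ᵥ q) := by
    have e1 : ∑ i, star (q i) * (w i * v + ∑ k, D i k * q k) = v * (star q ⬝ᵥ w) + star q ⬝ᵥ (D *ᵥ q) := by
      simp only [dotProduct, mulVec, mul_add, Finset.sum_add_distrib, Finset.mul_sum, Pi.star_apply]
      congr 1
      refine Finset.sum_congr rfl fun i _ => ?_
      ring
    have e2 : ∀ i, (hblk h w D *ᵥ (Fin.cons (v : ℂ) q : Fin (m + 1) → ℂ)) i.succ = w i * v + ∑ k, D i k * q k := by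
      intro i
      simp [mulVec, dotProduct, Fin.sum_univ_succ, hblk]
    have e3 : (hblk h w D *ᵥ (Fin.cons (v : ℂ) q : Fin (m + 1) → ℂ)) 0 = h * v + star w ⬝ᵥ q := by
      simp [mulVec, dotProduct, Fin.sum_univ_succ, hblk]
    rw [add_assoc, ← e1, dotProduct, Fin.sum_univ_succ, e3]
    simp only [e2, Pi.star_apply, Fin.cons_zero, Fin.cons_succ, Complex.star_def, Complex.conj_ofReal]
  unfold qf
  rw [h2]
  simp only [Complex.add_re, Complex.mul_re, Complex.ofReal_re, Complex.ofReal_im, h1]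
  ring

lemma qf_conj {m : ℕ} (U H : Matrix (Fin m) (Fin m) ℂ) (hU : Uᴴ * U = 1) (q : Fin m → ℂ) :
    qf (U * H * Uᴴ) (U *ᵥ q) = qf H q := by
  unfold qf
  congr 1
  rw [star_mulVec, mulVec_mulVec, Matrix.mul_assoc, hU, Matrix.mul_one, ← mulVec_mulVec,
    ← dotProduct_mulVec, mulVec_mulVec, hU, one_mulVec]

lemma edge (m : ℕ) : ∀ (L : List ℝ) (b : ℝ), (∀ v ∈ L, 0 ≤ v) → L.length ≤ m →
    (∀ j, m < j + L.length → j < m → b * gI j 0 ≤ ∫ w : Fin j → ℂ, √(nsq w) * Real.exp (-nsq w)) →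
    ∀ g : HC m → ℝ, Integrable (fun X => g X * gw (herm X)) →
    (∀ X q, nsq q = sqs L → hd0 q = (L.headD 0 : ℝ) → qf (herm X) q ≤ g X) →
    cfs L * b * WW m ≤ ∫ X, g X * gw (herm X) := by
  induction m with
  | zero =>
    intro L b _ hL _ g hg hq
    have : L = [] := by simpa using hL
    subst this
    simp only [cfs, zero_mul]
    refine integral_nonneg fun X => mul_nonneg ?_ (gw_pos _).le
    have := hq X 0 (by simp [nsq, sqs]) (by simp [hd0])
    simpa [qf] using this
  | succ m ih =>
    intro L b hpos hL hb g hg hq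
    cases L with
    | nil =>
      simp only [cfs, zero_mul]
      refine integral_nonneg fun X => mul_nonneg ?_ (gw_pos _).le
      have := hq X 0 (by simp [nsq, sqs]) (by simp [hd0])
      simpa [qf] using this
    | cons v L =>
      have hv : 0 ≤ v := hpos v (by simp)
      have hh : 0 ≤ L.headD 0 := by
        cases L with
        | nil => simp
        | cons u L => exact hpos u (by simp)
      obtain ⟨u, hu⟩ : ∃ u, u = L.headD 0 := ⟨_, rfl⟩
      rw [← hu] at hh
      obtain ⟨hF, hI⟩ := integral_joinC _ hg
      have hF' : Integrable (fun p : (ℝ × (Fin m → ℂ)) × HC m => g (joinC (p.1.1, p.1.2, p.2)) *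
        gw (herm (joinC (p.1.1, p.1.2, p.2)))) ((volume : Measure (ℝ × (Fin m → ℂ))).prod volume) := hF
      have hI' := hI.trans (integral_prod _ hF')
      rw [hI']
      have hS := hF'.integral_prod_left
      have hae := hF'.prod_right_ae
      obtain ⟨hi, h0, -⟩ := gmom m
      -- lower bound for the sections
      have key : ∀ᵐ t : ℝ × (Fin m → ℂ), 
          WW m * ((cfs L * b) * ((t.1 ^ 0 * Real.exp (-(t.1 ^ 2) / 2)) * (nsq t.2 ^ 0 * Real.exp (-nsq t.2))) +
            v ^ 2 * ((t.1 ^ 1 * Real.exp (-(t.1 ^ 2) / 2)) * (nsq t.2 ^ 0 * Real.exp (-nsq t.2))) +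
            2 * v * u * ((t.1 ^ 0 * Real.exp (-(t.1 ^ 2) / 2)) * (√(nsq t.2) * Real.exp (-nsq t.2)))) ≤
          ∫ X : HC m, g (joinC (t.1, t.2, X)) * gw (herm (joinC (t.1, t.2, X))) := by
        filter_upwards [hae] with t ht
        obtain ⟨U, hU, hUw⟩ := align t.2
        have hU' : Uᴴ * U = 1 := mul_eq_one_comm.1 hU
        have mp := congC_mp U hU
        have ht' := (mp.integrable_comp ht.1).2 ht
        have hE : ∫ X : HC m, g (joinC (t.1, t.2, X)) * gw (herm (joinC (t.1, t.2, X))) =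
            ∫ X : HC m, g (joinC (t.1, t.2, congC U X)) * gw (herm (joinC (t.1, t.2, congC U X))) := by
          conv_lhs => rw [← mp.map_eq]
          rw [integral_map mp.measurable.aemeasurable]
          rw [mp.map_eq]; exact ht.1
        obtain ⟨e, he⟩ : ∃ e, e = Real.exp (-(t.1 ^ 2) / 2) * Real.exp (-nsq t.2) := ⟨_, rfl⟩
        have he0 : 0 < e := by rw [he]; positivity
        have hgw : ∀ X, gw (herm (joinC (t.1, t.2, congC U X))) = e * gw (herm X) := fun X => by
          rw [gw_joinC, he]
          simp only [herm_congC, gw_uinv U _ hU]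
        simp only [Function.comp_def, hgw] at ht' hE
        have ht2 : Integrable fun X : HC m => g (joinC (t.1, t.2, congC U X)) * gw (herm X) := by
          refine (ht'.const_mul e⁻¹).congr (Filter.Eventually.of_forall fun X => ?_)
          simp only
          field_simp
        have hE2 : ∫ X : HC m, g (joinC (t.1, t.2, congC U X)) * (e * gw (herm X)) =
            e * ∫ X : HC m, g (joinC (t.1, t.2, congC U X)) * gw (herm X) := by
          rw [← integral_const_mul]
          refine integral_congr_ae (Filter.Eventually.of_forall fun X => ?_)
          simp only
          ring
        obtain ⟨K, hK⟩ : ∃ K, K = t.1 * v ^ 2 + 2 * v * (√(nsq t.2) * u) := ⟨_, rfl⟩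
        have hintg : Integrable fun X : HC m => (g (joinC (t.1, t.2, congC U X)) - K) * gw (herm X) := by
          refine (ht2.sub ((gwherm_int m).const_mul K)).congr (Filter.Eventually.of_forall fun X => ?_)
          simp only [Pi.sub_apply]
          ring
        have h3 := ih L b (fun x hx => hpos x (by simp [hx])) (by simpa using hL)
          (fun j hj1 hj2 => hb j (by simp; omega) (by omega))
          (fun X => g (joinC (t.1, t.2, congC U X)) - K) hintg (by
            intro X p hp1 hp2
            have h4 := hq (joinC (t.1, t.2, congC U X)) (Fin.cons (v : ℂ) (U *ᵥ p)) (by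
              rw [nsq_cons, nsq_unitary hU', hp1, sqs]; simp) (by simp [hd0])
            rw [herm_joinC, qf_hblk] at h4
            simp only [herm_congC, qf_conj U _ hU'] at h4
            rw [hUw, hp2, ← hu] at h4
            have h5 : ((√(nsq t.2) : ℂ) * (u : ℂ)).re = √(nsq t.2) * u := by
              simp
            rw [h5] at h4
            rw [hK]
            linarith)
        have h4 : ∫ X : HC m, (g (joinC (t.1, t.2, congC U X)) - K) * gw (herm X) =
            (∫ X : HC m, g (joinC (t.1, t.2, congC U X)) * gw (herm X)) - K * WW m := by
          simp only [sub_mul]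
          rw [integral_sub ht2 ((gwherm_int m).const_mul K), integral_const_mul, WW]
        rw [h4] at h3
        rw [hE, hE2]
        have h5 := mul_le_mul_of_nonneg_left (show cfs L * b * WW m + K * WW m ≤
          ∫ X : HC m, g (joinC (t.1, t.2, congC U X)) * gw (herm X) by linarith) he0.le
        refine le_trans (le_of_eq ?_) h5
        rw [he, hK]; ring
      have A : Integrable (fun t : ℝ × (Fin m → ℂ) => (t.1 ^ 0 * Real.exp (-(t.1 ^ 2) / 2)) *
          (nsq t.2 ^ 0 * Real.exp (-nsq t.2))) := (exph_int 0 (by norm_num)).mul_prod (hi 0 (by norm_num))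
      have B : Integrable (fun t : ℝ × (Fin m → ℂ) => (t.1 ^ 1 * Real.exp (-(t.1 ^ 2) / 2)) *
          (nsq t.2 ^ 0 * Real.exp (-nsq t.2))) := (exph_int 1 (by norm_num)).mul_prod (hi 0 (by norm_num))
      have C : Integrable (fun t : ℝ × (Fin m → ℂ) => (t.1 ^ 0 * Real.exp (-(t.1 ^ 2) / 2)) *
          (√(nsq t.2) * Real.exp (-nsq t.2))) := (exph_int 0 (by norm_num)).mul_prod (beta_int m)
      have AB : Integrable (fun t : ℝ × (Fin m → ℂ) => (cfs L * b) * ((t.1 ^ 0 * Real.exp (-(t.1 ^ 2) / 2)) * (nsq t.2 ^ 0 * Real.exp (-nsq t.2))) +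
            v ^ 2 * ((t.1 ^ 1 * Real.exp (-(t.1 ^ 2) / 2)) * (nsq t.2 ^ 0 * Real.exp (-nsq t.2)))) :=
        (A.const_mul (cfs L * b)).add (B.const_mul (v ^ 2))
      have hlow := integral_mono_ae ((AB.add (C.const_mul (2 * v * u))).const_mul (WW m)) hS key
      refine le_trans ?_ hlow
      rw [integral_const_mul]
      have hs := integral_add AB (C.const_mul (2 * v * u))
      have hs2 := integral_add (A.const_mul (cfs L * b)) (B.const_mul (v ^ 2))
      rw [integral_const_mul, integral_const_mul] at hs2
      rw [integral_const_mul, hs2] at hs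
      have A' := integral_prod_mul (μ := (volume : Measure ℝ)) (ν := (volume : Measure (Fin m → ℂ)))
        (fun h : ℝ => h ^ 0 * Real.exp (-(h ^ 2) / 2)) (fun w => nsq w ^ 0 * Real.exp (-nsq w))
      have B' := integral_prod_mul (μ := (volume : Measure ℝ)) (ν := (volume : Measure (Fin m → ℂ)))
        (fun h : ℝ => h ^ 1 * Real.exp (-(h ^ 2) / 2)) (fun w => nsq w ^ 0 * Real.exp (-nsq w))
      have C' := integral_prod_mul (μ := (volume : Measure ℝ)) (ν := (volume : Measure (Fin m → ℂ)))
        (fun h : ℝ => h ^ 0 * Real.exp (-(h ^ 2) / 2)) (fun w => √(nsq w) * Real.exp (-nsq w))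
      have hs' := hs.trans (congrArg₂ (· + ·) (congrArg₂ (· + ·) (congrArg (cfs L * b * ·) A') (congrArg (v ^ 2 * ·) B'))
        (congrArg (2 * v * u * ·) C'))
      refine le_trans ?_ (le_of_eq (congrArg (WW m * ·) hs'.symm))
      simp only [exph_odd, zero_mul, mul_zero, add_zero]
      change _ ≤ WW m * (cfs L * b * (_ * gI m 0) + _)
      rw [WW_succ, cfs, ← hu]
      obtain ⟨G, hG⟩ : ∃ G, G = ∫ h : ℝ, h ^ 0 * Real.exp (-(h ^ 2) / 2) := ⟨_, rfl⟩
      rw [← hG]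
      have hG0 : 0 ≤ G := hG ▸ integral_nonneg fun h => by positivity
      have hbb : u * (b * gI m 0) ≤ u * ∫ w : Fin m → ℂ, √(nsq w) * Real.exp (-nsq w) := by
        cases L with
        | nil => simp at hu; simp [hu]
        | cons x L => exact mul_le_mul_of_nonneg_left (hb m (by simp) (by omega)) hh
      have hW := (WW_pos m).le
      have := mul_le_mul_of_nonneg_left hbb (show 0 ≤ WW m * G * (2 * v) by positivity)
      nlinarith [this]

end GUEGap

namespace GUEGap
open scoped ComplexOrder
open MvPolynomial (pderiv)

/-- positive part of the top of the numerical range -/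
noncomputable def tp {m : ℕ} (H : Matrix (Fin m) (Fin m) ℂ) : ENNReal :=
  ⨆ q : {q : Fin m → ℂ // nsq q ≤ 1}, ENNReal.ofReal (qf H q.1)

lemma continuous_qf {m : ℕ} (q : Fin m → ℂ) : Continuous fun H : Matrix (Fin m) (Fin m) ℂ => qf H q := by
  unfold qf
  fun_prop

lemma measurable_tp {m : ℕ} : Measurable (tp (m := m)) := by
  refine LowerSemicontinuous.measurable ?_
  exact lowerSemicontinuous_iSup fun q =>
    (ENNReal.continuous_ofReal.comp (continuous_qf q.1)).lowerSemicontinuous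

lemma tp_conj_le {m : ℕ} (U H : Matrix (Fin m) (Fin m) ℂ) (hU : U * Uᴴ = 1) : tp (U * H * Uᴴ) ≤ tp H := by
  have hU' : Uᴴ * U = 1 := mul_eq_one_comm.1 hU
  refine iSup_le fun q => ?_
  have h1 : qf (U * H * Uᴴ) q.1 = qf H (Uᴴ *ᵥ q.1) := by
    rw [← qf_conj U H hU' (Uᴴ *ᵥ q.1), mulVec_mulVec, hU, one_mulVec]
  rw [h1]
  exact le_iSup (fun q : {q : Fin m → ℂ // nsq q ≤ 1} => ENNReal.ofReal (qf H q.1))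
    ⟨Uᴴ *ᵥ q.1, by rw [nsq_unitary (by rwa [conjTranspose_conjTranspose])]; exact q.2⟩

lemma tp_uinv {m : ℕ} : UInv (tp (m := m)) := fun U H hU => by
  refine le_antisymm (tp_conj_le U H hU) ?_
  have hU' : Uᴴ * U = 1 := mul_eq_one_comm.1 hU
  have h := tp_conj_le Uᴴ (U * H * Uᴴ) (by rwa [conjTranspose_conjTranspose])
  rw [conjTranspose_conjTranspose] at h
  have h2 : Uᴴ * (U * H * Uᴴ) * U = H := by
    calc _ = (Uᴴ * U) * H * (Uᴴ * U) := by simp only [Matrix.mul_assoc]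
      _ = _ := by rw [hU']; simp
  rwa [h2] at h

lemma qf_dg {m : ℕ} (y : Fin m → ℝ) (q : Fin m → ℂ) : qf (dg y) q = ∑ i, y i * ‖q i‖ ^ 2 := by
  unfold qf dg
  simp only [dotProduct, mulVec_diagonal, Pi.star_apply, Complex.re_sum]
  refine Finset.sum_congr rfl fun i _ => ?_
  rw [← Complex.normSq_eq_norm_sq, Complex.normSq_apply]
  simp
  ring

lemma tp_dg_le {m : ℕ} (y : Fin m → ℝ) (c : ℝ) (hc : 0 ≤ c) (h : ∀ i, y i ≤ c) :
    tp (dg y) ≤ ENNReal.ofReal c := by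
  refine iSup_le fun q => ENNReal.ofReal_le_ofReal ?_
  rw [qf_dg]
  calc ∑ i, y i * ‖q.1 i‖ ^ 2 ≤ ∑ i, c * ‖q.1 i‖ ^ 2 :=
        Finset.sum_le_sum fun i _ => mul_le_mul_of_nonneg_right (h i) (sq_nonneg _)
    _ = c * nsq q.1 := by rw [nsq, Finset.mul_sum]
    _ ≤ c * 1 := mul_le_mul_of_nonneg_left q.2 hc
    _ = c := mul_one c

lemma tp_lt_top {m : ℕ} (X : HC m) : tp (herm X) ≠ ⊤ := by
  obtain ⟨U, hU, hA⟩ := spectral_form (herm_isHermitian X)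
  have h2 : tp (herm X) = tp (dg (herm_isHermitian X).eigenvalues) := by
    conv_lhs => rw [hA]
    exact tp_uinv U _ hU
  rw [h2]
  refine ne_top_of_le_ne_top ENNReal.ofReal_ne_top (tp_dg_le _ (∑ i, |(herm_isHermitian X).eigenvalues i|)
    (Finset.sum_nonneg fun i _ => abs_nonneg _) fun i => ?_)
  exact (le_abs_self _).trans (Finset.single_le_sum (f := fun i => |(herm_isHermitian X).eigenvalues i|)
    (fun i _ => abs_nonneg _) (Finset.mem_univ i))

lemma tp_chamber (m : ℕ) (t : ℝ) (ht : 0 ≤ t) :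
    ENNReal.ofReal (2 * t) * ∫⁻ l in Om m, ENNReal.ofReal (vd2 l * ew l) * tp (dg l) ≤
      ENNReal.ofReal (UU m 2 + t ^ 2 * UU m 0) := by
  have h := (int_poly ((MvPolynomial.X 0 ^ 2 : Pol m) * PP m)).integrableOn (s := Om m)
  have h' := (int_poly (PP m)).integrableOn (s := Om m)
  have e : UU m 2 + t ^ 2 * UU m 0 = ∫ l in Om m, (l 0 ^ 2 + t ^ 2) * (vd2 l * ew l) := by
    unfold UU
    rw [IP_apply, IP_apply, ← integral_const_mul, pow_zero, one_mul, ← integral_add h (h'.const_mul _)]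
    refine integral_congr_ae (Filter.Eventually.of_forall fun l => ?_)
    simp [eval_PP]
    ring
  have hi : Integrable (fun l => (l 0 ^ 2 + t ^ 2) * (vd2 l * ew l)) (volume.restrict (Om m)) := by
    refine (h.add (h'.const_mul (t ^ 2))).congr (Filter.Eventually.of_forall fun l => ?_)
    simp [eval_PP]
    ring
  rw [e, ofReal_integral_eq_lintegral_ofReal hi (Filter.Eventually.of_forall fun l => by
    have := vd2_nonneg l
    have := (ew_pos l).le
    simp only [Pi.zero_apply]
    positivity), ← lintegral_const_mul' _ _ ENNReal.ofReal_ne_top]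
  refine setLIntegral_mono' (isOpen_Om m).measurableSet fun l hl => ?_
  have h1 : tp (dg l) ≤ ENNReal.ofReal (max (l 0) 0) := by
    refine tp_dg_le _ _ (le_max_right _ _) fun i => ?_
    refine Fin.cases (le_max_left _ _) (fun j => ?_) i
    exact (hl j).le.trans (le_max_left _ _)
  have hv := mul_nonneg (vd2_nonneg l) (ew_pos l).le
  calc ENNReal.ofReal (2 * t) * (ENNReal.ofReal (vd2 l * ew l) * tp (dg l)) ≤
      ENNReal.ofReal (2 * t) * (ENNReal.ofReal (vd2 l * ew l) * ENNReal.ofReal (max (l 0) 0)) := by gcongr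
    _ = ENNReal.ofReal (2 * t * ((vd2 l * ew l) * max (l 0) 0)) := by
      rw [ENNReal.ofReal_mul (p := 2 * t) (by positivity), ENNReal.ofReal_mul hv]
    _ ≤ _ := by
      refine ENNReal.ofReal_le_ofReal ?_
      have : 2 * t * max (l 0) 0 ≤ l 0 ^ 2 + t ^ 2 := by
        rcases max_cases (l 0) 0 with ⟨h, _⟩ | ⟨h, _⟩ <;> rw [h]
        · nlinarith [sq_nonneg (l 0 - t)]
        · nlinarith [sq_nonneg (l 0), sq_nonneg t]
      calc 2 * t * ((vd2 l * ew l) * max (l 0) 0) = (2 * t * max (l 0) 0) * (vd2 l * ew l) := by ring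
        _ ≤ _ := mul_le_mul_of_nonneg_right this hv

lemma qf_smul {m : ℕ} (H : Matrix (Fin m) (Fin m) ℂ) (r : ℝ) (q : Fin m → ℂ) :
    qf H ((r : ℂ) • q) = r ^ 2 * qf H q := by
  unfold qf
  rw [mulVec_smul, star_smul, smul_dotProduct, dotProduct_smul]
  simp
  ring

lemma nsq_smul {m : ℕ} (r : ℝ) (q : Fin m → ℂ) : nsq ((r : ℂ) • q) = r ^ 2 * nsq q := by
  simp [nsq, mul_pow, Finset.mul_sum]

lemma qf_le_tp {m : ℕ} (X : HC m) (q : Fin m → ℂ) (s : ℝ) (hs : 0 < s) (hq : nsq q = s) :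
    qf (herm X) q ≤ s * (tp (herm X)).toReal := by
  obtain ⟨r, hr⟩ : ∃ r, r = √s := ⟨_, rfl⟩
  have hr0 : 0 < r := hr ▸ Real.sqrt_pos.2 hs
  have hr2 : r ^ 2 = s := by rw [hr, Real.sq_sqrt hs.le]
  have h1 : ENNReal.ofReal (qf (herm X) ((r⁻¹ : ℝ) • q : Fin m → ℂ)) ≤ tp (herm X) := by
    refine le_iSup (fun q : {q : Fin m → ℂ // nsq q ≤ 1} => ENNReal.ofReal (qf (herm X) q.1))
      ⟨(r⁻¹ : ℝ) • q, ?_⟩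
    have : ((r⁻¹ : ℝ) • q : Fin m → ℂ) = (((r⁻¹ : ℝ) : ℂ) • q) := by
      funext i; simp
    rw [this, nsq_smul, hq, ← hr2]
    apply le_of_eq; field_simp
  have : ((r⁻¹ : ℝ) • q : Fin m → ℂ) = (((r⁻¹ : ℝ) : ℂ) • q) := by
    funext i; simp
  rw [this, qf_smul, ENNReal.ofReal_le_iff_le_toReal (tp_lt_top X)] at h1
  rw [← hr2]
  have := mul_le_mul_of_nonneg_left h1 (sq_nonneg r)
  refine le_trans (le_of_eq ?_) this
  field_simp

lemma UU2_lower (m : ℕ) (L : List ℝ) (b : ℝ) (hpos : ∀ v ∈ L, 0 ≤ v) (hL : L.length ≤ m + 1) (hs : 0 < sqs L)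
    (hb : ∀ j, m + 1 < j + L.length → j < m + 1 →
      b * gI j 0 ≤ ∫ w : Fin j → ℂ, √(nsq w) * Real.exp (-nsq w))
    (t : ℝ) (ht : 0 ≤ t) (htL : t * sqs L ≤ cfs L * b) : t ^ 2 * UU m 0 ≤ UU m 2 := by
  have hZ := UU0_pos m
  have hw := gue_weyl m tp tp_uinv measurable_tp
  obtain ⟨c, hc⟩ := gue_lint (m + 1)
  have hone := hc (fun _ => 1) measurable_const
  simp only [lintegral_one, measure_univ, one_mul] at hone
  have hJ := hc tp measurable_tp
  have h3 : ∫⁻ X : HC (m + 1), ENNReal.ofReal (gw (herm X)) = ENNReal.ofReal (WW (m + 1)) := by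
    rw [WW, ofReal_integral_eq_lintegral_ofReal (gwherm_int (m + 1))
      (Filter.Eventually.of_forall fun X => (gw_pos (herm X)).le)]
  rw [h3] at hone
  have hc0 : c ≠ 0 := by rintro rfl; simp at hone
  obtain ⟨J, hJd⟩ : ∃ J, J = ∫⁻ X : HC (m + 1), tp (herm X) * ENNReal.ofReal (gw (herm X)) := ⟨_, rfl⟩
  have hE : ∫⁻ H, tp H ∂(GUE (m + 1)) ≠ ⊤ := by
    have h1 := tp_chamber m 1 (by norm_num)
    rw [← hw] at h1
    intro hT
    rw [hT, ENNReal.mul_top (by simpa using hZ), ENNReal.mul_top (by simp)] at h1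
    exact absurd (top_le_iff.1 h1) ENNReal.ofReal_ne_top
  have hJt : J ≠ ⊤ := by
    intro hT
    rw [← hJd, hT, ENNReal.mul_top hc0] at hJ
    exact hE hJ
  have hms : Measurable fun X : HC (m + 1) => tp (herm X) * ENNReal.ofReal (gw (herm X)) :=
    (measurable_tp.comp measurable_herm).mul (measurable_gw.comp measurable_herm)
  have hfun : ∀ X : HC (m + 1), (tp (herm X) * ENNReal.ofReal (gw (herm X))).toReal =
      (tp (herm X)).toReal * gw (herm X) := fun X => by
    rw [ENNReal.toReal_mul, ENNReal.toReal_ofReal (gw_pos _).le]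
  have hintg : Integrable fun X : HC (m + 1) => (tp (herm X)).toReal * gw (herm X) := by
    refine (integrable_toReal_of_lintegral_ne_top hms.aemeasurable (by rwa [← hJd])).congr
      (Filter.Eventually.of_forall hfun)
  have hval : ∫ X : HC (m + 1), (tp (herm X)).toReal * gw (herm X) = J.toReal := by
    rw [hJd, ← integral_toReal hms.aemeasurable]
    · exact integral_congr_ae (Filter.Eventually.of_forall fun X => (hfun X).symm)
    · exact Filter.Eventually.of_forall fun X =>
        ENNReal.mul_lt_top (tp_lt_top X).lt_top ENNReal.ofReal_lt_top
  have hedge := edge (m + 1) L b hpos hL hb (fun X => sqs L * (tp (herm X)).toReal)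
    ((hintg.const_mul (sqs L)).congr (Filter.Eventually.of_forall fun X => by simp only; ring))
    (fun X q h1 _ => qf_le_tp X q (sqs L) hs h1)
  simp only [mul_assoc] at hedge
  rw [integral_const_mul, hval, ← mul_assoc] at hedge
  have hW := WW_pos (m + 1)
  have h5 : t * WW (m + 1) ≤ J.toReal := by
    have := mul_le_mul_of_nonneg_right htL hW.le
    nlinarith
  have h6 : ENNReal.ofReal t ≤ ∫⁻ H, tp H ∂(GUE (m + 1)) := by
    rw [hJ, ← hJd]
    calc ENNReal.ofReal t = c * (ENNReal.ofReal (t * WW (m + 1))) := by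
          rw [ENNReal.ofReal_mul ht, mul_left_comm, ← hone, mul_one]
      _ ≤ _ := by
        gcongr
        exact (ENNReal.ofReal_le_iff_le_toReal hJt).2 h5
  have h7 := tp_chamber m t ht
  rw [← hw] at h7
  have h8 : ENNReal.ofReal (2 * t * (UU m 0 * t)) ≤ ENNReal.ofReal (UU m 2 + t ^ 2 * UU m 0) := by
    refine le_trans ?_ h7
    rw [ENNReal.ofReal_mul (p := 2 * t) (by positivity), ENNReal.ofReal_mul hZ.le]
    gcongr
  rw [ENNReal.ofReal_le_ofReal_iff (add_nonneg (UU_nonneg m 1) (mul_nonneg (sq_nonneg t) hZ.le))] at h8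
  nlinarith

end GUEGap

namespace GUEGap
open scoped ComplexOrder
open MvPolynomial (pderiv)

/-- the list of sines used as a test vector -/
noncomputable def sL (θ : ℝ) : ℕ → List ℝ
  | 0 => []
  | k + 1 => Real.sin ((k + 1 : ℕ) * θ) :: sL θ k

lemma sL_length (θ : ℝ) (k : ℕ) : (sL θ k).length = k := by
  induction k with
  | zero => rfl
  | succ k ih => simp [sL, ih]

lemma sL_head (θ : ℝ) (k : ℕ) : (sL θ k).headD 0 = Real.sin (k * θ) := by
  cases k with
  | zero => simp [sL]
  | succ k => simp [sL]

lemma sL_cfs (θ : ℝ) (k : ℕ) : cfs (sL θ k) + Real.sin (k * θ) * Real.sin ((k + 1 : ℕ) * θ) =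
    2 * Real.cos θ * sqs (sL θ k) := by
  induction k with
  | zero => simp [sL, cfs, sqs]
  | succ k ih =>
    rw [sL, cfs, sqs, sL_head]
    have h : Real.sin (k * θ) + Real.sin ((k + 1 + 1 : ℕ) * θ) = 2 * Real.cos θ * Real.sin ((k + 1 : ℕ) * θ) := by
      push_cast
      rw [show (k : ℝ) * θ = (k + 1) * θ - θ by ring, show ((k : ℝ) + 1 + 1) * θ = (k + 1) * θ + θ by ring,
        Real.sin_sub, Real.sin_add]
      ring
    linear_combination ih + Real.sin ((k + 1 : ℕ) * θ) * h

lemma sL_nonneg (θ : ℝ) (h0 : 0 ≤ θ) (k : ℕ) (hk : k * θ ≤ Real.pi) : ∀ v ∈ sL θ k, 0 ≤ v := by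
  induction k with
  | zero => simp [sL]
  | succ k ih =>
    intro v hv
    rw [sL, List.mem_cons] at hv
    rcases hv with rfl | hv
    · exact Real.sin_nonneg_of_nonneg_of_le_pi (by positivity) hk
    · refine ih (le_trans ?_ hk) v hv
      push_cast
      nlinarith

lemma sqs_nonneg (L : List ℝ) : 0 ≤ sqs L := by
  induction L with
  | nil => simp [sqs]
  | cons v L ih => rw [sqs]; positivity

lemma DP2_upper (m : ℕ) (r : ℝ) (hr : 0 < r) (hr3 : r ^ 3 = (m : ℝ) + 1) : IP m (DP2 m) ≤ 16 * r * UU m 0 := by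
  have hr1 : 1 ≤ r := by
    by_contra h
    have h1 : r ^ 3 < 1 := pow_lt_one₀ hr.le (not_le.1 h) (by norm_num)
    have : (0 : ℝ) ≤ m := by positivity
    linarith
  obtain ⟨l, hl⟩ : ∃ l, l = ⌊r⌋₊ := ⟨_, rfl⟩
  have hl1 : 1 ≤ l := by rw [hl]; exact (Nat.one_le_floor_iff _).2 hr1
  have hlr : (l : ℝ) ≤ r := by rw [hl]; exact Nat.floor_le hr.le
  have hrl : r < l + 1 := by rw [hl]; exact Nat.lt_floor_add_one r
  have hln : (l : ℝ) ≤ m + 1 := by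
    rw [← hr3]; nlinarith [mul_le_mul hr1 hr1 (by norm_num) hr.le]
  have hln' : l ≤ m + 1 := by exact_mod_cast hln
  have hl0 : (1 : ℝ) ≤ l := by exact_mod_cast hl1
  obtain ⟨θ, hθ⟩ : ∃ θ, θ = Real.pi / (l + 1) := ⟨_, rfl⟩
  have hpi := Real.pi_pos
  have hθ0 : 0 < θ := by rw [hθ]; positivity
  have hθl : (l + 1) * θ = Real.pi := by rw [hθ]; field_simp
  have hθ2 : θ ≤ Real.pi / 2 := by nlinarith
  have hcos : 0 ≤ Real.cos θ := Real.cos_nonneg_of_neg_pi_div_two_le_of_le (by linarith) hθ2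
  have hcf := sL_cfs θ l
  rw [show ((l + 1 : ℕ) : ℝ) * θ = Real.pi by push_cast; exact hθl, Real.sin_pi, mul_zero, add_zero] at hcf
  have hsq : 0 < sqs (sL θ l) := by
    obtain ⟨k, rfl⟩ : ∃ k, l = k + 1 := ⟨l - 1, by omega⟩
    rw [sL, sqs]
    have : 0 < Real.sin ((k + 1 : ℕ) * θ) := by
      refine Real.sin_pos_of_pos_of_lt_pi (by positivity) ?_
      push_cast at hθl ⊢
      nlinarith
    have h2 := sqs_nonneg (sL θ k)
    positivity
  obtain ⟨b, hb⟩ : ∃ b, b = √((m : ℝ) + 1 - l) := ⟨_, rfl⟩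
  have hb0 : 0 ≤ b := hb ▸ Real.sqrt_nonneg _
  have hb2 : b ^ 2 = (m : ℝ) + 1 - l := by rw [hb, Real.sq_sqrt (by linarith)]
  have hlow := UU2_lower m (sL θ l) b (sL_nonneg θ hθ0.le l (by nlinarith)) (by rw [sL_length]; exact hln') hsq
    (fun j h1 h2 => by
      rw [sL_length] at h1
      refine beta_bound j (by omega) b ?_
      rw [hb2]
      have : ((m + 1 + 1 : ℕ) : ℝ) ≤ ((j + l : ℕ) : ℝ) := by exact_mod_cast h1
      push_cast at this
      linarith) (2 * Real.cos θ * b) (by positivity) (by rw [hcf]; apply le_of_eq; ring)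
  have hD := mom_D m
  have hZ := UU0_pos m
  have hsin : Real.sin θ ^ 2 ≤ θ ^ 2 := by
    have h1 := Real.sin_le hθ0.le
    have h2 := Real.sin_nonneg_of_nonneg_of_le_pi hθ0.le (by linarith)
    exact pow_le_pow_left₀ h2 h1 2
  have hsc := Real.sin_sq_add_cos_sq θ
  have hpi10 : Real.pi ^ 2 ≤ 10 := by nlinarith [Real.pi_lt_d2]
  have hnθ : (m + 1) * θ ^ 2 ≤ 10 * r := by
    have h1 : r * θ ≤ Real.pi := by rw [← hθl]; nlinarith
    have h2 : (r * θ) ^ 2 ≤ 10 := (pow_le_pow_left₀ (by positivity) h1 2).trans hpi10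
    rw [← hr3]
    calc r ^ 3 * θ ^ 2 = r * (r * θ) ^ 2 := by ring
      _ ≤ r * 10 := mul_le_mul_of_nonneg_left h2 hr.le
      _ = _ := by ring
  have hkey : (m + 1) - Real.cos θ ^ 2 * (m + 1 - l) ≤ 11 * r := by
    have h1 : (m + 1 : ℝ) * Real.sin θ ^ 2 ≤ (m + 1) * θ ^ 2 := mul_le_mul_of_nonneg_left hsin (by positivity)
    have h2 : Real.cos θ ^ 2 * l ≤ 1 * l := mul_le_mul_of_nonneg_right (by nlinarith [sq_nonneg (Real.sin θ)]) (by positivity)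
    have h3 : (m + 1 : ℝ) - Real.cos θ ^ 2 * (m + 1 - l) = (m + 1) * Real.sin θ ^ 2 + Real.cos θ ^ 2 * l := by
      rw [show Real.sin θ ^ 2 = 1 - Real.cos θ ^ 2 by linarith]; ring
    linarith
  have h5 : (2 * Real.cos θ * b) ^ 2 = 4 * (Real.cos θ ^ 2 * (m + 1 - l)) := by
    rw [mul_pow, mul_pow, hb2]; ring
  rw [h5] at hlow
  have := mul_le_mul_of_nonneg_right hkey hZ.le
  nlinarith

lemma RR_upper (m : ℕ) (r : ℝ) (hr : 0 < r) (hr3 : r ^ 3 = (m : ℝ) + 1) :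
    ∫ l in Om m, |MvPolynomial.eval l (MvPolynomial.X 0 * RR m) * ew l| ≤ 10 * r ^ 2 * UU m 0 := by
  have h1 := (int_poly ((MvPolynomial.X 0 ^ 2 : Pol m) * PP m)).integrableOn (s := Om m)
  have h2 := (int_poly (DP2 m)).integrableOn (s := Om m)
  have h3 := (int_poly ((MvPolynomial.X 0 : Pol m) * RR m)).integrableOn (s := Om m)
  have hle : ∫ l in Om m, |MvPolynomial.eval l (MvPolynomial.X 0 * RR m) * ew l| ≤
      ∫ l in Om m, ((1 / (2 * r)) * (MvPolynomial.eval l (MvPolynomial.X 0 ^ 2 * PP m) * ew l) +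
        (r / 2) * (MvPolynomial.eval l (DP2 m) * ew l)) := by
    refine setIntegral_mono_on h3.abs ((h1.const_mul _).add (h2.const_mul _)) (isOpen_Om m).measurableSet
      fun l hl => ?_
    rw [map_mul, eval_RR l (om_ne hl), map_mul, eval_PP, eval_DP2 l (om_ne hl), map_pow, MvPolynomial.eval_X]
    have hv := vd2_nonneg l
    have he := (ew_pos l).le
    have e1 : |l 0 * -(Dd l * vd2 l) * ew l| = |l 0 * Dd l| * (vd2 l * ew l) := by
      rw [← abs_of_nonneg (mul_nonneg hv he), ← abs_mul, ← abs_neg]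
      congr 1; ring
    rw [e1]
    have e2 : |l 0 * Dd l| ≤ 1 / (2 * r) * l 0 ^ 2 + r / 2 * Dd l ^ 2 := by
      have e3 : 1 / (2 * r) * l 0 ^ 2 + r / 2 * Dd l ^ 2 = (l 0 ^ 2 + (r * Dd l) ^ 2) / (2 * r) := by
        field_simp
      rw [e3, le_div_iff₀ (by positivity), abs_mul]
      have := sq_nonneg (|l 0| - r * |Dd l|)
      have a1 := sq_abs (l 0)
      have a2 := sq_abs (Dd l)
      rw [mul_pow, ← a1, ← a2]
      nlinarith
    calc _ ≤ _ := mul_le_mul_of_nonneg_right e2 (mul_nonneg hv he)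
      _ = _ := by ring
  refine hle.trans ?_
  rw [integral_add (h1.const_mul _) (h2.const_mul _), integral_const_mul, integral_const_mul, ← IP_apply, ← IP_apply]
  change _ * UU m 2 + _ ≤ _
  have hD := DP2_upper m r hr hr3
  have hU := mom2 m
  rw [← hr3] at hU
  calc 1 / (2 * r) * UU m 2 + r / 2 * IP m (DP2 m) ≤
      1 / (2 * r) * (4 * r ^ 3 * UU m 0) + r / 2 * (16 * r * UU m 0) := by gcongr
    _ = 10 * r ^ 2 * UU m 0 := by field_simp; ring

lemma exp_small (x : ℝ) (hx : 1 ≤ x) : 0 ≤ Real.exp (1 / x) - 1 ∧ Real.exp (1 / x) - 1 ≤ 2 / x := by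
  have h0 : 0 < 1 / x := by positivity
  have h1 : 1 / x ≤ 1 := by rw [div_le_one (by linarith)]; exact hx
  have h2 := Real.abs_exp_sub_one_sub_id_le (x := 1 / x) (by rw [abs_of_pos h0]; exact h1)
  have h3 := (abs_le.1 h2).2
  have h4 := Real.add_one_le_exp (1 / x)
  refine ⟨by linarith, ?_⟩
  have : 2 / x = 1 / x + 1 / x := by ring
  nlinarith

lemma gap_main (m : ℕ) (hm : 0 < m) (x : ℝ) (hx : 1 ≤ x) :
    GUE (m + 1) {H | |absSortedEigs H ⟨0, by omega⟩| <
      Real.exp (1 / x) * |absSortedEigs H ⟨1 % (m + 1), Nat.mod_lt _ (by omega)⟩|} ≤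
    ENNReal.ofReal (40 * ((m : ℝ) + 1) ^ ((2 : ℝ) / 3) / x + 768 * ((m : ℝ) + 1) ^ 4 / x ^ 3) := by
  obtain ⟨he0, he2⟩ := exp_small x hx
  obtain ⟨ε, hε⟩ : ∃ ε, ε = Real.exp (1 / x) - 1 := ⟨_, rfl⟩
  rw [← hε] at he0 he2
  have h := gue_event m hm ε he0
  rw [show Real.exp (1 / x) = 1 + ε by rw [hε]; ring]
  have hZ := UU0_pos m
  have hn : (0 : ℝ) < (m : ℝ) + 1 := by positivity
  obtain ⟨r, hr⟩ : ∃ r, r = ((m : ℝ) + 1) ^ ((1 : ℝ) / 3) := ⟨_, rfl⟩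
  have hr0 : 0 < r := by rw [hr]; positivity
  have hr3 : r ^ 3 = (m : ℝ) + 1 := by
    rw [hr, ← Real.rpow_natCast, ← Real.rpow_mul hn.le]; norm_num
  have hr2 : ((m : ℝ) + 1) ^ ((2 : ℝ) / 3) = r ^ 2 := by
    rw [hr, ← Real.rpow_natCast, ← Real.rpow_mul hn.le]; norm_num
  rw [hr2]
  have hR := RR_upper m r hr0 hr3
  have hQ := mom_Q m
  have hx0 : 0 < x := by linarith
  have h1 : (1 : ℝ) ≤ m + 1 := by
    have : (0 : ℝ) ≤ m := by positivity
    linarith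
  have hb : 2 * (ε * (∫ l in Om m, |MvPolynomial.eval l (MvPolynomial.X 0 * RR m) * ew l|) +
        ε ^ 3 * IP m (MvPolynomial.X 0 ^ 4 * QP m)) ≤
      UU m 0 * (40 * r ^ 2 / x + 768 * ((m : ℝ) + 1) ^ 4 / x ^ 3) := by
    have b1 : ε * (∫ l in Om m, |MvPolynomial.eval l (MvPolynomial.X 0 * RR m) * ew l|) ≤
        2 / x * (10 * r ^ 2 * UU m 0) :=
      (mul_le_mul_of_nonneg_left hR he0).trans (mul_le_mul_of_nonneg_right he2 (by positivity))
    have b2 : ε ^ 3 * IP m (MvPolynomial.X 0 ^ 4 * QP m) ≤ (2 / x) ^ 3 * (48 * ((m : ℝ) + 1) ^ 3 * UU m 0) :=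
      (mul_le_mul_of_nonneg_left hQ (by positivity)).trans
        (mul_le_mul_of_nonneg_right (pow_le_pow_left₀ he0 he2 3) (by positivity))
    have b3 : (2 / x) ^ 3 * (48 * ((m : ℝ) + 1) ^ 3 * UU m 0) ≤ (2 / x) ^ 3 * (48 * ((m : ℝ) + 1) ^ 4 * UU m 0) := by
      have : ((m : ℝ) + 1) ^ 3 ≤ ((m : ℝ) + 1) ^ 4 := pow_le_pow_right₀ h1 (by norm_num)
      gcongr
    calc _ ≤ 2 * (2 / x * (10 * r ^ 2 * UU m 0) + (2 / x) ^ 3 * (48 * ((m : ℝ) + 1) ^ 4 * UU m 0)) := by linarith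
      _ = _ := by field_simp; ring
  have e2 : ∀ y : ℝ, 2 * ENNReal.ofReal y = ENNReal.ofReal (2 * y) := fun y => by
    rw [ENNReal.ofReal_mul (by norm_num), ENNReal.ofReal_ofNat]
  rw [e2] at h
  have h3 := h.trans (ENNReal.ofReal_le_ofReal hb)
  rw [ENNReal.ofReal_mul hZ.le] at h3
  exact (ENNReal.mul_le_mul_iff_right (by simpa using hZ) ENNReal.ofReal_ne_top).1 h3

end GUEGap
/-- singular value gap of GUE.  There are absolute constants
`C, c > 0` so that for all `n ≥ 1`, `x ≥ 1` and an `n × n` GUE matrix `H` with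
eigenvalues `λ₁, …, λₙ` ordered by absolute value `|λ₁| ≥ … ≥ |λₙ|`:
`Prob{log|λ₁| − log|λ₂| < 1/x} ≤ C·n^{2/3}/x + C·n⁴/x³ + C·e^{−cn}`, where the event is
interpreted as `{|λ₁| < e^{1/x}|λ₂|}`. -/
theorem gue_singular_value_gap_bound :
    ∃ C c : ℝ, 0 < C ∧ 0 < c ∧
      ∀ (n : ℕ) (hn : 1 ≤ n) (x : ℝ) (hx : 1 ≤ x),
        GUE n {H | |absSortedEigs H ⟨0, by omega⟩| <
            Real.exp (1 / x) * |absSortedEigs H ⟨1 % n, Nat.mod_lt _ (by omega)⟩|} ≤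
          ENNReal.ofReal (C * (n : ℝ) ^ ((2 : ℝ) / 3) / x + C * (n : ℝ) ^ 4 / x ^ 3
            + C * Real.exp (-(c * n))) := by
  refine ⟨1000, 1, by norm_num, by norm_num, fun n hn x hx => ?_⟩
  have hx0 : 0 < x := by linarith
  rcases Nat.lt_or_ge n 2 with h | h
  · have h1 : n = 1 := by omega
    subst h1
    refine prob_le_one.trans ?_
    rw [← ENNReal.ofReal_one]
    refine ENNReal.ofReal_le_ofReal ?_
    have h2 : Real.exp 1 < 3 := Real.exp_one_lt_d9.trans (by norm_num)
    have h3 : 1 ≤ 1000 * Real.exp (-1) := by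
      rw [Real.exp_neg, ← div_eq_mul_inv, le_div_iff₀ (Real.exp_pos 1)]; linarith
    have h4 : (0 : ℝ) ≤ 1000 * ((1 : ℕ) : ℝ) ^ ((2 : ℝ) / 3) / x + 1000 * ((1 : ℕ) : ℝ) ^ 4 / x ^ 3 := by positivity
    have h5 : Real.exp (-(1 * ((1 : ℕ) : ℝ))) = Real.exp (-1) := by norm_num
    rw [h5]
    linarith
  · obtain ⟨m, rfl⟩ : ∃ m, n = m + 1 := ⟨n - 1, by omega⟩
    refine (GUEGap.gap_main m (by omega) x hx).trans (ENNReal.ofReal_le_ofReal ?_)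
    push_cast
    have a1 : 40 * ((m : ℝ) + 1) ^ ((2 : ℝ) / 3) / x ≤ 1000 * ((m : ℝ) + 1) ^ ((2 : ℝ) / 3) / x := by
      gcongr; norm_num
    have a2 : 768 * ((m : ℝ) + 1) ^ 4 / x ^ 3 ≤ 1000 * ((m : ℝ) + 1) ^ 4 / x ^ 3 := by
      gcongr; norm_num
    have a3 := Real.exp_pos (-(1 * ((m : ℝ) + 1)))
    linarith
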